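/- arXiv:1404.0429 — 2 statements merged into one kernel-verified Lean document; each statement's English description precedes it below -/
import Mathlib

section
/- Let g ∈ ℚ[y] be the degree 24 polynomial g(y) = y^24 - 30y^20 + 540y^18 + 945y^16 - 22500y^14 - 58860y^12 + 421200y^10 + 1350000y^8 - 7970400y^6 + 11638080y^4 - 6480000y^2 + 1166400. Then the Galois group of g over ℚ has cardinality 190080 (the order of the double cover 2.M₁₂ of the Mathieu group M₁₂). -/
open Polynomial

section MultipleTransitivity

open MulAction

variable {G Ω : Type*} [Group G] [MulAction G Ω]

theorem ncard_modEq_ncard_inter_fixedBy [Finite Ω] {q m : ℕ} [Fact q.Prime] {g : G}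
    (hg : ∀ x : Ω, g ^ q ^ m • x = x) {S : Set Ω} (hS : ∀ x ∈ S, g • x ∈ S) :
    S.ncard ≡ (S ∩ fixedBy Ω g).ncard [MOD q] := by
  classical
  have := Fintype.ofFinite S
  let f : Function.End S := fun x ↦ ⟨g • x.1, hS x x.2⟩
  have hf (k : ℕ) (x : S) : ((f ^ k) x : Ω) = g ^ k • (x : Ω) := by
    induction k generalizing x with
    | zero => rw [pow_zero, pow_zero, one_smul]; rfl
    | succ k ih =>
      rw [pow_succ, pow_succ, mul_smul]
      exact ih (f x)
  have h := Equiv.Perm.card_fixedPoints_modEq (f := f) (p := q) (n := m)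
    (funext fun x ↦ Subtype.ext ((hf _ x).trans (hg x)))
  rw [← Nat.card_eq_fintype_card, ← Nat.card_eq_fintype_card, Nat.card_coe_set_eq] at h
  refine h.trans (congrArg (· % q) ?_)
  rw [← Nat.card_coe_set_eq]
  exact Nat.card_congr
    { toFun x := ⟨x.1, x.1.2, congrArg Subtype.val x.2⟩
      invFun x := ⟨⟨x.1, x.2.1⟩, Subtype.ext x.2.2⟩
      left_inv _ := rfl
      right_inv _ := rfl }

theorem four_dvd_ncard [Finite Ω] {g : G} (hg : ∀ x : Ω, g ^ 4 • x = x) {S : Set Ω}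
    (hS : ∀ x ∈ S, g • x ∈ S) (hfix : ∀ x ∈ S, g ^ 2 • x ≠ x) : 4 ∣ S.ncard := by
  induction hn : S.ncard using Nat.strong_induction_on generalizing S with
  | _ n ih =>
    subst hn
    obtain rfl | ⟨x, hx⟩ := S.eq_empty_or_nonempty
    · simp
    have h0 : ∀ y : Ω, g • g • g • g • y = y := fun y ↦ by
      have := hg y
      simpa only [pow_succ, pow_zero, one_mul, mul_smul] using this
    have h2 : ∀ y ∈ S, g • g • y ≠ y := fun y hy ↦ by
      have := hfix y hy
      rwa [pow_two, mul_smul] at this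
    have h1 : ∀ y ∈ S, g • y ≠ y := fun y hy h ↦ h2 y hy (by rw [h, h])
    have h3 : ∀ y ∈ S, g • g • g • y ≠ y := fun y hy h ↦ h1 y hy (by rw [← h, h0, h])
    set O : Set Ω := {x, g • x, g • g • x, g • g • g • x} with hO
    have hOS : O ⊆ S := by
      rintro y (rfl | rfl | rfl | rfl)
      · exact hx
      · exact hS _ hx
      · exact hS _ (hS _ hx)
      · exact hS _ (hS _ (hS _ hx))
    have hc : O.ncard = 4 := by
      have hinj := MulAction.injective (β := Ω) g
      rw [hO, Set.ncard_eq_succ (Set.toFinite _)]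
      refine ⟨x, {g • x, g • g • x, g • g • g • x}, ?_, rfl, ?_⟩
      · rintro (h | h | h)
        exacts [h1 x hx h.symm, h2 x hx h.symm, h3 x hx h.symm]
      · rw [Set.ncard_eq_three]
        exact ⟨_, _, _, fun h ↦ h1 _ hx (hinj h).symm, fun h ↦ h2 _ hx (hinj h).symm,
          fun h ↦ h1 _ hx (hinj (hinj h)).symm, rfl⟩
    have hd := Set.ncard_sdiff_add_ncard_of_subset hOS (Set.toFinite _)
    rw [hc] at hd
    rw [← hd]
    refine dvd_add (ih (S \ O).ncard (by omega) (S := S \ O) ?_ ?_ rfl) dvd_rfl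
    · rintro y ⟨hy, hyO⟩
      refine ⟨hS y hy, fun h ↦ hyO ?_⟩
      have hinj := MulAction.injective (β := Ω) g
      rcases h with h | h | h | h
      · rw [← h0 x] at h
        exact Or.inr (Or.inr (Or.inr (hinj h)))
      · exact Or.inl (hinj h)
      · exact Or.inr (Or.inl (hinj h))
      · exact Or.inr (Or.inr (Or.inl (hinj h)))
    · exact fun y hy ↦ hfix y hy.1

theorem exists_forall_smul_mem {n : ℕ} [IsMultiplyPretransitive G Ω n] [Finite Ω] (b : Fin n ↪ Ω)
    (T : Set Ω) (hT : n ≤ T.ncard) :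
    ∃ g : G, ∀ i, g • b i ∈ T := by
  obtain ⟨e⟩ : Nonempty (Fin n ↪ T) := by
    have := Fintype.ofFinite T
    apply Function.Embedding.nonempty_of_card_le
    rwa [Fintype.card_fin, ← Nat.card_eq_fintype_card, Nat.card_coe_set_eq]
  obtain ⟨g, hg⟩ := exists_smul_eq G b (e.trans (Function.Embedding.subtype _))
  exact ⟨g, fun i ↦ by
    have := DFunLike.congr_fun hg i
    simp only [Function.Embedding.smul_apply] at this
    rw [this]; exact (e i).2⟩

theorem mem_stabilizer_embedding {n : ℕ} {b : Fin n ↪ Ω} {g : G} :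
    g ∈ stabilizer G b ↔ ∀ i, g • b i = b i := by
  rw [mem_stabilizer_iff, DFunLike.ext_iff]; rfl

theorem ncard_fixedBy_conj (g h : G) : (fixedBy Ω (g * h * g⁻¹)).ncard = (fixedBy Ω h).ncard := by
  rw [← smul_fixedBy]
  exact Set.ncard_image_of_injective _ (MulAction.injective g)

/-- Extend multiple transitivity. -/
theorem isMultiplyPretransitive_succ {n : ℕ} [IsMultiplyPretransitive G Ω n] (b : Fin n ↪ Ω)
    (h : ∀ x ∉ Set.range b, (Set.range b)ᶜ ⊆ orbit (stabilizer G b) x) :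
    IsMultiplyPretransitive G Ω (n + 1) := by
  refine ⟨fun t t' ↦ ?_⟩
  obtain ⟨g, hg⟩ := exists_smul_eq G (Fin.castSuccEmb.trans t) b
  obtain ⟨g', hg'⟩ := exists_smul_eq G (Fin.castSuccEmb.trans t') b
  have hr (g : G) (t : Fin (n + 1) ↪ Ω) (hg : g • (Fin.castSuccEmb.trans t) = b) :
      g • t (Fin.last n) ∉ Set.range b := by
    rintro ⟨i, hi⟩
    rw [← hg] at hi
    have := t.injective (MulAction.injective g hi)
    exact (Fin.castSucc_lt_last i).ne this
  obtain ⟨k, hk⟩ := h _ (hr g t hg) (hr g' t' hg')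
  refine ⟨g'⁻¹ * k * g, ?_⟩
  ext i
  rw [mul_assoc, mul_smul, Function.Embedding.smul_apply, inv_smul_eq_iff, mul_smul,
    Function.Embedding.smul_apply, Function.Embedding.smul_apply]
  induction i using Fin.lastCases with
  | last => exact hk
  | cast i =>
    have h1 : g • t i.castSucc = b i := DFunLike.congr_fun hg i
    have h2 : g' • t' i.castSucc = b i := DFunLike.congr_fun hg' i
    rw [h1, h2]
    exact mem_stabilizer_embedding.1 k.2 i

theorem exists_conj_mem_stabilizer_embedding {n : ℕ} [IsMultiplyPretransitive G Ω n] [Finite Ω]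
    (b : Fin n ↪ Ω) {g : G} (hg : n ≤ (fixedBy Ω g).ncard) :
    ∃ c : G, c * g * c⁻¹ ∈ stabilizer G b := by
  obtain ⟨c, hc⟩ := exists_forall_smul_mem (G := G) b _ hg
  refine ⟨c⁻¹, mem_stabilizer_embedding.2 fun i ↦ ?_⟩
  rw [inv_inv, mul_smul, mul_smul, (hc i : g • c • b i = c • b i), inv_smul_smul]

theorem ncard_inter_add_le {n : ℕ} [Finite Ω] {b : Fin n ↪ Ω} {S T : Set Ω}
    (hS : Disjoint S (Set.range b)) (hT : ∀ i, b i ∈ T) : (S ∩ T).ncard + n ≤ T.ncard := by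
  have hb : (Set.range b).ncard = n := by
    rw [← Set.image_univ, Set.ncard_image_of_injective _ b.injective, Set.ncard_univ, Nat.card_fin]
  conv_lhs => rw [← hb]
  rw [← Set.ncard_union_eq (hS.mono_left Set.inter_subset_left)]
  exact Set.ncard_le_ncard (Set.union_subset Set.inter_subset_right (Set.range_subset_iff.2 hT))

theorem smul_conj_pow_eq {g c : G} {k : ℕ} (hg : ∀ x : Ω, g ^ k • x = x) (x : Ω) :
    (c * g * c⁻¹) ^ k • x = x := by
  rw [conj_pow, mul_smul, mul_smul, hg, smul_inv_smul]

/-- A set which is stable under the stabilizer of an `n`-tuple and disjoint from it has, modulo `q`,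
at most `f - n` elements, if some element of `q`-power order has `f` fixed points. -/
theorem exists_ncard_modEq_prime {n q m f : ℕ} [IsMultiplyPretransitive G Ω n] [Finite Ω]
    [Fact q.Prime] (b : Fin n ↪ Ω) {g : G} (hg : ∀ x : Ω, g ^ q ^ m • x = x)
    (hf : (fixedBy Ω g).ncard = f) (hn : n ≤ f) {S : Set Ω}
    (hS : ∀ k ∈ stabilizer G b, ∀ x ∈ S, k • x ∈ S) (hSb : Disjoint S (Set.range b)) :
    ∃ r, r + n ≤ f ∧ S.ncard ≡ r [MOD q] := by
  obtain ⟨c, hc⟩ := exists_conj_mem_stabilizer_embedding b (hn.trans_eq hf.symm)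
  refine ⟨_, ?_, ncard_modEq_ncard_inter_fixedBy (smul_conj_pow_eq hg) (hS _ hc)⟩
  rw [← hf, ← ncard_fixedBy_conj c g]
  exact ncard_inter_add_le hSb (mem_stabilizer_embedding.1 hc)

/-- The variant of `exists_ncard_modEq_prime` modulo `4`. -/
theorem exists_ncard_modEq_four {n f : ℕ} [IsMultiplyPretransitive G Ω n] [Finite Ω]
    (b : Fin n ↪ Ω) {g : G} (hg : ∀ x : Ω, g ^ 4 • x = x) (hf : (fixedBy Ω g).ncard = f)
    (hf2 : (fixedBy Ω (g ^ 2)).ncard = f) (hn : n ≤ f) {S : Set Ω}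
    (hS : ∀ k ∈ stabilizer G b, ∀ x ∈ S, k • x ∈ S) (hSb : Disjoint S (Set.range b)) :
    ∃ r, r + n ≤ f ∧ S.ncard ≡ r [MOD 4] := by
  obtain ⟨c, hc⟩ := exists_conj_mem_stabilizer_embedding b (hn.trans_eq hf.symm)
  set g' := c * g * c⁻¹
  have hc2 : g' ^ 2 ∈ stabilizer G b := pow_mem hc 2
  refine ⟨(S ∩ fixedBy Ω (g' ^ 2)).ncard, ?_, ?_⟩
  · rw [← hf2, ← ncard_fixedBy_conj c (g ^ 2), ← conj_pow]
    exact ncard_inter_add_le hSb (mem_stabilizer_embedding.1 hc2)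
  · rw [← Set.ncard_inter_add_ncard_sdiff_eq_ncard S (fixedBy Ω (g' ^ 2))]
    refine (Nat.modEq_iff_dvd' (Nat.le_add_right _ _)).2 ?_ |>.symm
    rw [Nat.add_sub_cancel_left]
    refine four_dvd_ncard (smul_conj_pow_eq hg) ?_ fun x hx ↦ hx.2
    rintro x ⟨hx, hx2⟩
    refine ⟨hS _ hc x hx, fun h ↦ hx2 (MulAction.injective (β := Ω) g' ?_)⟩
    change g' • g' ^ 2 • x = g' • x
    rw [smul_smul, ← pow_succ', pow_succ, mul_smul]
    exact h

theorem isMultiplyPretransitive_five [Finite Ω] (hΩ : Nat.card Ω = 12) {a β κ ρ : G}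
    (ha : ∀ x : Ω, a ^ 11 • x = x) (ha1 : (fixedBy Ω a).ncard = 1)
    (hβ : ∀ x : Ω, β ^ 10 • x = x) (hβ2 : (fixedBy Ω (β ^ 2)).ncard = 2)
    (hβ5 : (fixedBy Ω (β ^ 5)).ncard = 0)
    (hκ : ∀ x : Ω, κ ^ 8 • x = x) (hκ1 : (fixedBy Ω κ).ncard = 2)
    (hκ2 : (fixedBy Ω (κ ^ 2)).ncard = 4) (hκ4 : (fixedBy Ω (κ ^ 4)).ncard = 4)
    (hρ : ∀ x : Ω, ρ ^ 6 • x = x) (hρ2 : (fixedBy Ω (ρ ^ 2)).ncard = 3)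
    (hρ3 : (fixedBy Ω (ρ ^ 3)).ncard = 4) :
    IsMultiplyPretransitive G Ω 5 := by
  have hβ' : ∀ x : Ω, (β ^ 2) ^ 5 ^ 1 • x = x := by simpa [← pow_mul] using hβ
  have hβ'' : ∀ x : Ω, (β ^ 5) ^ 2 ^ 1 • x = x := by simpa [← pow_mul] using hβ
  have hκ' : ∀ x : Ω, (κ ^ 2) ^ 4 • x = x := by simpa only [← pow_mul] using hκ
  have hρ' : ∀ x : Ω, (ρ ^ 2) ^ 3 ^ 1 • x = x := by simpa [← pow_mul] using hρ
  have : Fact (Nat.Prime 11) := ⟨by norm_num⟩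
  have : Fact (Nat.Prime 5) := ⟨by norm_num⟩
  have hdisj {n : ℕ} (b : Fin n ↪ Ω) (x : Ω) (hx : x ∉ Set.range b) :
      Disjoint (orbit (stabilizer G b) x) (Set.range b) := by
    rw [Set.disjoint_left]
    rintro _ ⟨k, rfl⟩ ⟨i, hi⟩
    have := mem_stabilizer_embedding.1 k.2 i
    refine hx ⟨i, MulAction.injective (k : G) ?_⟩
    change (k : G) • b i = (k : G) • x
    rw [this]
    exact hi
  have hst {n : ℕ} (b : Fin n ↪ Ω) (x : Ω) :
      ∀ k ∈ stabilizer G b, ∀ y ∈ orbit (stabilizer G b) x, k • y ∈ orbit (stabilizer G b) x :=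
    fun k hk y hy ↦ mem_orbit_of_mem_orbit (⟨k, hk⟩ : stabilizer G b) hy
  have hcompl {n : ℕ} (b : Fin n ↪ Ω) : (Set.range b)ᶜ.ncard = 12 - n := by
    rw [Set.ncard_compl, hΩ, ← Set.image_univ, Set.ncard_image_of_injective _ b.injective,
      Set.ncard_univ, Nat.card_fin]
  have hpos {n : ℕ} (b : Fin n ↪ Ω) (x : Ω) : 0 < (orbit (stabilizer G b) x).ncard :=
    (Set.ncard_pos (Set.toFinite _)).2 ⟨x, mem_orbit_self x⟩
  have hle {n : ℕ} (b : Fin n ↪ Ω) (x : Ω) (hx : x ∉ Set.range b) :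
      (orbit (stabilizer G b) x).ncard ≤ 12 - n :=
    hcompl b ▸ Set.ncard_le_ncard (hdisj b x hx).subset_compl_right
  have hcl {n : ℕ} (b : Fin n ↪ Ω) (x : Ω) (hx : x ∉ Set.range b)
      (h : 12 - n ≤ (orbit (stabilizer G b) x).ncard) :
      (Set.range b)ᶜ ⊆ orbit (stabilizer G b) x :=
    (Set.eq_of_subset_of_ncard_le (hdisj b x hx).subset_compl_right (hcompl b ▸ h)).ge
  have hemb (n : ℕ) (T : Set Ω) (hT : T.ncard = n) : ∃ b : Fin n ↪ Ω, Set.range b = T := by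
    have e := (Finite.equivFinOfCardEq (α := T) (Nat.card_coe_set_eq T ▸ hT)).symm
    exact ⟨e.toEmbedding.trans (Function.Embedding.subtype _), by
      change Set.range (Subtype.val ∘ e) = T
      rw [e.surjective.range_comp, Subtype.range_coe]⟩
  have hemb' (n : ℕ) (hn : n ≤ 12) : ∃ b : Fin n ↪ Ω, True := by
    obtain ⟨T, -, hT⟩ := Set.exists_subset_card_eq (s := (Set.univ : Set Ω)) (n := n)
      (by rwa [Set.ncard_univ, hΩ])
    exact ⟨(hemb n T hT).choose, trivial⟩
  have t0 : IsMultiplyPretransitive G Ω 0 := inferInstance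
  have t1 : IsMultiplyPretransitive G Ω 1 := by
    obtain ⟨b, -⟩ := hemb' 0 (by norm_num)
    refine isMultiplyPretransitive_succ b fun x hx ↦ hcl b x hx ?_
    obtain ⟨r, hr, h⟩ := exists_ncard_modEq_prime (m := 1) b (by simpa using ha) ha1 (by norm_num)
      (hst b x) (hdisj b x hx)
    obtain ⟨s, hs, h'⟩ := exists_ncard_modEq_prime (m := 1) b hβ'' hβ5 (by norm_num)
      (hst b x) (hdisj b x hx)
    have := hpos b x
    have := hle b x hx
    unfold Nat.ModEq at h h'
    have : r ≤ 1 := by omega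
    interval_cases r <;> omega
  have t2 : IsMultiplyPretransitive G Ω 2 := by
    obtain ⟨b, -⟩ := hemb' 1 (by norm_num)
    refine isMultiplyPretransitive_succ b fun x hx ↦ hcl b x hx ?_
    obtain ⟨r, hr, h⟩ := exists_ncard_modEq_prime (m := 1) b (by simpa using ha) ha1 (by norm_num)
      (hst b x) (hdisj b x hx)
    have := hpos b x
    have := hle b x hx
    unfold Nat.ModEq at h
    omega
  have t3 : IsMultiplyPretransitive G Ω 3 := by
    obtain ⟨b, -⟩ := hemb' 2 (by norm_num)
    refine isMultiplyPretransitive_succ b fun x hx ↦ hcl b x hx ?_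
    obtain ⟨r, hr, h⟩ := exists_ncard_modEq_prime b hβ' hβ2 (by norm_num)
      (hst b x) (hdisj b x hx)
    obtain ⟨s, hs, h'⟩ := exists_ncard_modEq_prime (q := 2) (m := 3) b hκ hκ1 (by norm_num)
      (hst b x) (hdisj b x hx)
    have := hpos b x
    have := hle b x hx
    unfold Nat.ModEq at h h'
    omega
  have h4 {n : ℕ} (hn : n ≤ 4) [IsMultiplyPretransitive G Ω n] (b : Fin n ↪ Ω) {S : Set Ω} :=
    exists_ncard_modEq_four (S := S) b hκ' hκ2 (by rwa [← pow_mul]) hn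
  have t4 : IsMultiplyPretransitive G Ω 4 := by
    obtain ⟨b, -⟩ := hemb' 3 (by norm_num)
    refine isMultiplyPretransitive_succ b fun x hx ↦ hcl b x hx ?_
    obtain ⟨r, hr, h⟩ := exists_ncard_modEq_prime b hρ' hρ2 (by norm_num)
      (hst b x) (hdisj b x hx)
    obtain ⟨s, hs, h'⟩ := h4 (by norm_num) b (hst b x) (hdisj b x hx)
    have := hpos b x
    have := hle b x hx
    unfold Nat.ModEq at h h'
    have : r ≤ 1 := by omega
    have : s ≤ 1 := by omega
    interval_cases r <;> interval_cases s <;> omega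
  obtain ⟨b, hb⟩ := hemb 4 _ hρ3
  have hbρ (i) : ρ ^ 3 • b i = b i := (hb ▸ Set.mem_range_self i : b i ∈ fixedBy Ω (ρ ^ 3))
  have hρr {x : Ω} (hx : x ∉ Set.range b) : ρ • x ∉ Set.range b := by
    rw [hb, mem_fixedBy] at hx ⊢
    intro h
    refine hx (MulAction.injective (β := Ω) ρ ?_)
    change ρ • ρ ^ 3 • x = ρ • x
    rwa [smul_smul, ← pow_succ', pow_succ, mul_smul]
  have hρi (i) : ρ⁻¹ • b i ∈ Set.range b := by
    by_contra h
    exact hρr h ⟨i, (smul_inv_smul ρ (b i)).symm⟩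
  have hρ3s : ρ ^ 3 ∈ stabilizer G b := mem_stabilizer_embedding.2 hbρ
  have hρo {x y : Ω} (h : y ∈ orbit (stabilizer G b) x) :
      ρ • y ∈ orbit (stabilizer G b) (ρ • x) := by
    obtain ⟨k, rfl⟩ := h
    refine ⟨⟨ρ * k * ρ⁻¹, mem_stabilizer_embedding.2 fun i ↦ ?_⟩, ?_⟩
    · obtain ⟨j, hj⟩ := hρi i
      rw [mul_smul, mul_smul, ← hj, mem_stabilizer_embedding.1 k.2 j, hj, smul_inv_smul]
    · change (ρ * k * ρ⁻¹) • ρ • x = ρ • (k : G) • x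
      rw [mul_smul, mul_smul, inv_smul_smul]
  have hdvd (x) (hx : x ∉ Set.range b) : 4 ∣ (orbit (stabilizer G b) x).ncard := by
    obtain ⟨s, hs, h'⟩ := h4 le_rfl b (hst b x) (hdisj b x hx)
    exact (Nat.modEq_zero_iff_dvd.1 (by rwa [show s = 0 by omega] at h'))
  refine isMultiplyPretransitive_succ b fun x hx ↦ hcl b x hx ?_
  by_contra! hlt
  have hx3 : ρ • ρ • ρ • x ∈ orbit (stabilizer G b) x := by
    have := hst b x _ hρ3s x (mem_orbit_self x)
    simpa only [pow_succ, pow_zero, one_mul, mul_smul] using this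
  have hρx : ρ • x ∈ orbit (stabilizer G b) x := by
    by_contra hn
    have d12 := (orbit.eq_or_disjoint (G := stabilizer G b) x (ρ • x)).resolve_left fun h ↦
      hn (orbit_eq_iff.1 h.symm)
    have d23 := (orbit.eq_or_disjoint (G := stabilizer G b) (ρ • x) (ρ • ρ • x)).resolve_left
      fun h ↦ hn <| orbit_eq_iff.1 <| by
        rw [h, ← orbit_eq_iff.2 hx3, orbit_eq_iff.2 (hρo (orbit_eq_iff.1 h.symm))]
    have d13 := (orbit.eq_or_disjoint (G := stabilizer G b) x (ρ • ρ • x)).resolve_left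
      fun h ↦ hn <| orbit_eq_iff.1 <| by
        rw [← orbit_eq_iff.2 hx3, orbit_eq_iff.2 (hρo (orbit_eq_iff.1 h.symm))]
    have hu := Set.ncard_le_ncard (Set.union_subset (Set.union_subset
      (hdisj b x hx).subset_compl_right (hdisj b _ (hρr hx)).subset_compl_right)
      (hdisj b _ (hρr (hρr hx))).subset_compl_right)
    rw [Set.ncard_union_eq (Set.disjoint_union_left.2 ⟨d13, d23⟩), Set.ncard_union_eq d12,
      hcompl b] at hu
    have e1 := hdvd x hx
    have e2 := hdvd _ (hρr hx)
    have e3 := hdvd _ (hρr (hρr hx))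
    have p1 := hpos b x
    have p2 := hpos b (ρ • x)
    have p3 := hpos b (ρ • ρ • x)
    omega
  have hρS : ∀ y ∈ orbit (stabilizer G b) x, ρ • y ∈ orbit (stabilizer G b) x := fun y hy ↦ by
    rw [← orbit_eq_iff.2 hρx]
    exact hρo hy
  have hmod := ncard_modEq_ncard_inter_fixedBy hρ' (S := orbit (stabilizer G b) x) fun y hy ↦ by
    rw [pow_two, mul_smul]
    exact hρS _ (hρS y hy)
  have h3 : (orbit (stabilizer G b) x ∩ fixedBy Ω (ρ ^ 2)).ncard = 1 := by
    have := (Set.ncard_le_ncard (s := orbit (stabilizer G b) x ∩ fixedBy Ω (ρ ^ 2))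
      Set.inter_subset_right).trans_eq hρ2
    have e1 := hdvd x hx
    have p1 := hpos b x
    unfold Nat.ModEq at hmod
    omega
  obtain ⟨e, he⟩ := Set.ncard_eq_one.1 h3
  have heS : e ∈ orbit (stabilizer G b) x ∩ fixedBy Ω (ρ ^ 2) := he ▸ rfl
  have he2 : ρ ^ 2 • e = e := heS.2
  have hρe : ρ • e ∈ orbit (stabilizer G b) x ∩ fixedBy Ω (ρ ^ 2) := by
    refine ⟨hρS _ heS.1, ?_⟩
    rw [mem_fixedBy, smul_smul, ← pow_succ, pow_succ', mul_smul, he2]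
  rw [he, Set.mem_singleton_iff] at hρe
  refine Set.disjoint_left.1 (hdisj b x hx) heS.1 ?_
  rw [hb, mem_fixedBy, pow_succ, mul_smul, hρe, he2]

end MultipleTransitivity

section ListPolynomial

/-- The value at `a` of the integer polynomial with the given coefficients, lowest degree first. -/
def listEval {R : Type*} [CommRing R] (a : R) : List ℤ → R
  | [] => 0
  | c :: l => c + a * listEval a l

/-- Coefficientwise addition. -/
def listAdd : List ℤ → List ℤ → List ℤ
  | [], m => m
  | l, [] => l
  | c :: l, d :: m => (c + d) :: listAdd l m

/-- Multiplication by a constant. -/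
def listScale (c : ℤ) (l : List ℤ) : List ℤ := l.map (c * ·)

/-- Reduction of the coefficients modulo `p`. -/
def listMod (p : ℕ) (l : List ℤ) : List ℤ := l.map (· % (p : ℤ))

/-- Multiplication by `X`, reduced modulo the monic polynomial `X ^ low.length + low`. -/
def listShift (low s : List ℤ) : List ℤ :=
  if low.length = 0 then []
  else if s.length = low.length then
    listAdd (0 :: s.dropLast) (listScale (-s.getLastD 0) low)
  else 0 :: s

/-- Multiplication of polynomials modulo `p`, where `shift` implements multiplication by `X`. -/
def listMulWith (p : ℕ) (shift : List ℤ → List ℤ) (l m : List ℤ) : List ℤ :=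
  l.foldr (fun c acc ↦ listMod p (listAdd (listScale c m) (shift acc))) []

/-- Multiplication modulo `p` and modulo `X ^ low.length + low`. -/
def listMul (p : ℕ) (low l m : List ℤ) : List ℤ := listMulWith p (listShift low) l m

/-- Equality of coefficients modulo `p`. -/
def listEq (p : ℕ) (l m : List ℤ) : Bool :=
  (listMod p (listAdd l (listScale (-1) m))).all (· == 0)

/-- The coefficients of the derivative. -/
def listDeriv : List ℤ → List ℤ
  | [] => []
  | _ :: l => listAdd l (0 :: listDeriv l)

variable {R : Type*} [CommRing R] {a : R}

theorem map_listEval {S : Type*} [CommRing S] (φ : R →+* S) (a : R) (l : List ℤ) :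
    φ (listEval a l) = listEval (φ a) l := by
  induction l with
  | nil => exact map_zero φ
  | cons c l ih => simp [listEval, ih]

theorem listEval_add (l m : List ℤ) : listEval a (listAdd l m) = listEval a l + listEval a m := by
  induction l generalizing m with
  | nil => simp [listAdd, listEval]
  | cons c l ih =>
    cases m with
    | nil => simp [listAdd, listEval]
    | cons d m => simp only [listAdd, listEval, ih]; push_cast; ring

theorem listEval_scale (c : ℤ) (l : List ℤ) : listEval a (listScale c l) = c * listEval a l := by
  induction l with
  | nil => simp [listScale, listEval]
  | cons d l ih =>
    simp only [listScale, List.map_cons, listEval] at ih ⊢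
    rw [ih]; push_cast; ring

theorem listEval_mod (p : ℕ) [CharP R p] (l : List ℤ) :
    listEval a (listMod p l) = listEval a l := by
  induction l with
  | nil => rfl
  | cons d l ih =>
    simp only [listMod, List.map_cons, listEval] at ih ⊢
    rw [ih, (CharP.intCast_eq_intCast R p).2 (Int.mod_modEq d p)]

theorem listEval_append (l m : List ℤ) :
    listEval a (l ++ m) = listEval a l + a ^ l.length * listEval a m := by
  induction l with
  | nil => simp [listEval]
  | cons d l ih => simp only [List.cons_append, listEval, ih, List.length_cons, pow_succ]; ring

/-- The value at `a` of the monic polynomial whose lower coefficients are given. -/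
def monicEval (a : R) (low : List ℤ) : R := a ^ low.length + listEval a low

theorem map_monicEval {S : Type*} [CommRing S] (φ : R →+* S) (a : R) (l : List ℤ) :
    φ (monicEval a l) = monicEval (φ a) l := by
  simp [monicEval, map_listEval]

theorem listEval_append_one (low : List ℤ) : listEval a (low ++ [1]) = monicEval a low := by
  rw [listEval_append, monicEval]; simp [listEval, add_comm]

theorem listEval_shift {low : List ℤ} (ha : monicEval a low = 0) (s : List ℤ) :
    listEval a (listShift low s) = a * listEval a s := by
  unfold listShift
  split_ifs with h0 h
  · rw [List.length_eq_zero_iff] at h0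
    subst h0
    refine eq_of_zero_eq_one ?_ _ _
    simpa [monicEval, listEval] using ha.symm
  · have hs : s ≠ [] := by
      rintro rfl
      exact h0 h.symm
    rw [monicEval, add_eq_zero_iff_eq_neg] at ha
    have := listEval_append (a := a) s.dropLast [s.getLast hs]
    rw [List.dropLast_append_getLast] at this
    rw [listEval_add, listEval_scale, this, List.getLastD_eq_getLast?,
      List.getLast?_eq_some_getLast hs]
    have hl : a * a ^ s.dropLast.length = a ^ low.length := by
      rw [← pow_succ', List.length_dropLast, h, Nat.sub_add_cancel (Nat.one_le_iff_ne_zero.2 h0)]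
    simp only [listEval, Option.getD_some, Int.cast_neg, Int.cast_zero]
    linear_combination (-(s.getLast hs : R)) * hl - (s.getLast hs : R) * ha
  · simp [listEval]

theorem listEval_mulWith (p : ℕ) [CharP R p] {shift : List ℤ → List ℤ}
    (h : ∀ s, listEval a (shift s) = a * listEval a s) (l m : List ℤ) :
    listEval a (listMulWith p shift l m) = listEval a l * listEval a m := by
  induction l with
  | nil => simp [listMulWith, listEval]
  | cons c l ih =>
    simp only [listMulWith, List.foldr_cons] at ih ⊢
    rw [listEval_mod, listEval_add, listEval_scale, h, ih, listEval]
    ring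

theorem listEval_mul (p : ℕ) [CharP R p] {low : List ℤ} (ha : monicEval a low = 0)
    (l m : List ℤ) : listEval a (listMul p low l m) = listEval a l * listEval a m :=
  listEval_mulWith p (listEval_shift ha) l m

theorem listEval_eq_zero_of_all {l : List ℤ} (h : l.all (· == 0)) : listEval a l = 0 := by
  induction l with
  | nil => rfl
  | cons c l ih =>
    simp only [List.all_cons, Bool.and_eq_true, beq_iff_eq] at h
    simp [listEval, ih h.2, h.1]

theorem listEval_eq (p : ℕ) [CharP R p] {l m : List ℤ} (h : listEq p l m) :
    listEval a l = listEval a m := by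
  have := listEval_eq_zero_of_all (a := a) h
  rw [listEval_mod, listEval_add, listEval_scale] at this
  push_cast at this
  linear_combination this

theorem degree_listEval_lt (l : List ℤ) : (listEval (X : R[X]) l).degree < l.length := by
  induction l with
  | nil => simp [listEval]
  | cons c l ih =>
    nontriviality R
    refine (degree_add_le _ _).trans_lt (max_lt ?_ ?_)
    · exact (degree_intCast_le c).trans_lt (by exact_mod_cast Nat.succ_pos _)
    · rw [mul_comm, degree_mul_X, List.length_cons, Nat.cast_succ]
      exact WithBot.add_lt_add_right (by simp) ih

theorem monic_monicEval (low : List ℤ) : (monicEval (X : R[X]) low).Monic :=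
  monic_X_pow_add (degree_listEval_lt low)

theorem natDegree_monicEval [Nontrivial R] (low : List ℤ) :
    (monicEval (X : R[X]) low).natDegree = low.length := by
  rw [monicEval, add_comm, natDegree_add_eq_right_of_degree_lt, natDegree_X_pow]
  simpa using degree_listEval_lt low

theorem eval_listEval (l : List ℤ) : (listEval (X : R[X]) l).eval a = listEval a l := by
  rw [← coe_evalRingHom, map_listEval, coe_evalRingHom, eval_X]

theorem eval_monicEval (l : List ℤ) : (monicEval (X : R[X]) l).eval a = monicEval a l := by
  rw [← coe_evalRingHom, map_monicEval, coe_evalRingHom, eval_X]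

theorem map_monicEval_X {S : Type*} [CommRing S] (φ : R →+* S) (l : List ℤ) :
    (monicEval (X : R[X]) l).map φ = monicEval X l := by
  rw [← coe_mapRingHom, map_monicEval, coe_mapRingHom, map_X]

theorem derivative_listEval (l : List ℤ) :
    derivative (listEval (X : R[X]) l) = listEval X (listDeriv l) := by
  induction l with
  | nil => simp [listEval, listDeriv]
  | cons c l ih => simp [listEval, listDeriv, listEval_add, ih]

theorem derivative_monicEval (low : List ℤ) :
    derivative (monicEval (X : R[X]) low) = listEval X (listDeriv (low ++ [1])) := by
  rw [← listEval_append_one, derivative_listEval]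

/-! Fast arithmetic modulo a prime and a monic polynomial: residues are lists of `n` natural
numbers, highest degree first, and the monic polynomial `X ^ n - nl` is given by the list `nl`. -/

/-- The value at `a` of the polynomial with the given coefficients, highest degree first. -/
def natEval (a : R) : List ℕ → R
  | [] => 0
  | c :: l => c * a ^ l.length + natEval a l

/-- The coefficients of `c * l + d * m + X * s`. -/
def natComb (p c d : ℕ) : List ℕ → List ℕ → List ℕ → List ℕ
  | a :: l, b :: m, e :: s => ((c * a + d * b + e) % p) :: natComb p c d l m s
  | a :: l, b :: m, [] => ((c * a + d * b) % p) :: natComb p c d l m []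
  | _, _, _ => []

/-- The residue of `c * m + X * acc`. -/
def natStep (p : ℕ) (nl m acc : List ℕ) (c : ℕ) : List ℕ :=
  match acc with
  | [] => natComb p c 0 m nl []
  | d :: s => natComb p c d m nl s

/-- Multiplication of residues. -/
def natMul (p : ℕ) (nl l m : List ℕ) : List ℕ := l.foldl (natStep p nl m) []

/-- Powers of residues by repeated squaring; correct if `1 ≤ n ≤ fuel`. -/
def natPow (p : ℕ) (nl l : List ℕ) : ℕ → ℕ → List ℕ
  | 0, _ => l
  | fuel + 1, n =>
    if n < 2 then l
    else
      let r := natPow p nl l fuel (n / 2)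
      if n % 2 = 0 then natMul p nl r r else natMul p nl l (natMul p nl r r)

/-- The residue of `X`. -/
def natX (p : ℕ) (nl : List ℕ) : List ℕ :=
  natMul p nl [1, 0] (List.replicate (nl.length - 1) 0 ++ [1])

/-- The iterates of `q ↦ w * q ^ p`. -/
def natFrob (p : ℕ) (nl q w : List ℕ) : ℕ → List ℕ
  | 0 => q
  | k + 1 => natMul p nl w (natPow p nl (natFrob p nl q w k) p p)

/-- Reduction modulo `p` of the coefficients of `-low`, highest degree first. -/
def natNeg (p : ℕ) (low : List ℤ) : List ℕ := (low.map fun c ↦ (-c % (p : ℤ)).toNat).reverse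

/-- The conversion of residues to lists of integers, lowest degree first. -/
def natToInt (l : List ℕ) : List ℤ := l.reverse.map Int.ofNat

theorem length_natComb (p c d : ℕ) {l m : List ℕ} (s : List ℕ) (h : l.length = m.length) :
    (natComb p c d l m s).length = l.length := by
  induction l generalizing m s with
  | nil => simp [natComb]
  | cons b l ih =>
    obtain _ | ⟨e, m⟩ := m
    · simp at h
    · cases s <;> simpa [natComb] using ih _ (by simpa using h)

theorem natCast_mod (p : ℕ) [CharP R p] (n : ℕ) : ((n % p : ℕ) : R) = n :=
  (CharP.natCast_eq_natCast R p).2 (Nat.mod_modEq n p)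

theorem natEval_comb_nil (p c d : ℕ) [CharP R p] {l m : List ℕ} (h : l.length = m.length) :
    natEval a (natComb p c d l m []) = c * natEval a l + d * natEval a m := by
  induction l generalizing m with
  | nil =>
    obtain rfl : m = [] := List.length_eq_zero_iff.1 h.symm
    simp [natComb, natEval]
  | cons b l ih =>
    obtain _ | ⟨e, m⟩ := m
    · simp at h
    have h' : l.length = m.length := by simpa using h
    rw [natComb, natEval, ih h', length_natComb p c d _ h', natCast_mod, natEval, natEval, ← h']
    push_cast
    ring

theorem natEval_comb (p c d : ℕ) [CharP R p] {l m s : List ℕ} (h : l.length = m.length)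
    (hs : s.length + 1 = l.length) :
    natEval a (natComb p c d l m s) = c * natEval a l + d * natEval a m + a * natEval a s := by
  induction s generalizing l m with
  | nil => rw [natEval_comb_nil p c d h, natEval, mul_zero, add_zero]
  | cons e s ih =>
    obtain _ | ⟨b, l⟩ := l
    · simp at hs
    obtain _ | ⟨b', m⟩ := m
    · simp at h
    have h' : l.length = m.length := by simpa using h
    have hs' : s.length + 1 = l.length := by simpa using hs
    rw [natComb, natEval, ih h' hs', length_natComb p c d _ h', natCast_mod, natEval, natEval,
      natEval, ← h', ← hs']
    push_cast
    ring

theorem natEval_append_singleton (l : List ℕ) (c : ℕ) :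
    natEval a (l ++ [c]) = natEval a l * a + c := by
  induction l with
  | nil => simp [natEval]
  | cons d l ih => simp only [List.cons_append, natEval, ih, List.length_append,
      List.length_singleton, pow_succ]; ring

section Residue

variable {p : ℕ} [CharP R p] {nl : List ℕ}

theorem length_natStep {m acc : List ℕ} (c : ℕ) (hm : m.length = nl.length) :
    (natStep p nl m acc c).length = nl.length := by
  unfold natStep
  split <;> rw [length_natComb _ _ _ _ hm, hm]

theorem natEval_step (ha : a ^ nl.length = natEval a nl) {m acc : List ℕ} (c : ℕ)
    (hm : m.length = nl.length) (hacc : acc = [] ∨ acc.length = nl.length) :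
    natEval a (natStep p nl m acc c) = c * natEval a m + a * natEval a acc := by
  unfold natStep
  split
  · rw [natEval_comb_nil p c 0 hm]
    simp [natEval]
  · rename_i d s
    have hs : s.length + 1 = nl.length := by simpa using hacc
    rw [natEval_comb p c d hm (hs.trans hm.symm), natEval, ← ha, ← hs]
    ring

theorem natEval_foldl (ha : a ^ nl.length = natEval a nl) {m : List ℕ} (l acc : List ℕ)
    (hm : m.length = nl.length) (hacc : acc = [] ∨ acc.length = nl.length) :
    natEval a (l.foldl (natStep p nl m) acc) =
      natEval a l * natEval a m + a ^ l.length * natEval a acc := by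
  induction l generalizing acc with
  | nil => simp [natEval]
  | cons c l ih =>
    rw [List.foldl_cons, ih _ (Or.inr (length_natStep c hm)), natEval_step ha c hm hacc, natEval,
      List.length_cons, pow_succ]
    ring

theorem length_natMul {l m : List ℕ} (hl : l ≠ []) (hm : m.length = nl.length) :
    (natMul p nl l m).length = nl.length := by
  rw [natMul, ← List.dropLast_append_getLast hl, List.foldl_append]
  exact length_natStep _ hm

theorem natEval_mul (ha : a ^ nl.length = natEval a nl) (l : List ℕ) {m : List ℕ}
    (hm : m.length = nl.length) :
    natEval a (natMul p nl l m) = natEval a l * natEval a m := by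
  rw [natMul, natEval_foldl ha l [] hm (Or.inl rfl)]
  simp [natEval]

theorem length_natPow {l : List ℕ} (hnl : nl ≠ []) (hl : l.length = nl.length) (fuel n : ℕ) :
    (natPow p nl l fuel n).length = nl.length := by
  have hne {m : List ℕ} (hm : m.length = nl.length) : m ≠ [] := by
    rintro rfl
    exact hnl (List.length_eq_zero_iff.1 hm.symm)
  induction fuel generalizing n with
  | zero => exact hl
  | succ fuel ih =>
    rw [natPow]
    split_ifs
    · exact hl
    · exact length_natMul (hne (ih _)) (ih _)
    · exact length_natMul (hne hl) (length_natMul (hne (ih _)) (ih _))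

theorem natEval_pow (ha : a ^ nl.length = natEval a nl) {l : List ℕ} (hnl : nl ≠ [])
    (hl : l.length = nl.length) {fuel n : ℕ} (hn : 1 ≤ n) (hf : n ≤ fuel) :
    natEval a (natPow p nl l fuel n) = natEval a l ^ n := by
  induction fuel generalizing n with
  | zero => omega
  | succ fuel ih =>
    rw [natPow]
    split_ifs with h1 h2
    · rw [show n = 1 by omega, pow_one]
    · rw [natEval_mul ha _ (length_natPow hnl hl _ _), ih (by omega) (by omega), ← pow_add]
      congr 1
      omega
    · have hlen := length_natPow (p := p) hnl hl fuel (n / 2)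
      have hne : natPow p nl l fuel (n / 2) ≠ [] := by
        intro h
        rw [h] at hlen
        exact hnl (List.length_eq_zero_iff.1 hlen.symm)
      rw [natEval_mul ha _ (length_natMul hne hlen), natEval_mul ha _ hlen,
        ih (by omega) (by omega), ← pow_add, ← pow_succ']
      congr 1
      omega

theorem natEval_replicate_zero (n : ℕ) : natEval a (List.replicate n 0) = 0 := by
  induction n with
  | zero => rfl
  | succ n ih => simp [List.replicate_succ, natEval, ih]

theorem length_natX (hnl : nl ≠ []) : (natX p nl).length = nl.length := by
  have := List.length_pos_of_ne_nil hnl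
  exact length_natMul (by simp) (by simp; omega)

theorem natEval_X (ha : a ^ nl.length = natEval a nl) (hnl : nl ≠ []) :
    natEval a (natX p nl) = a := by
  have := List.length_pos_of_ne_nil hnl
  rw [natX, natEval_mul ha _ (by simp; omega), natEval_append_singleton, natEval_replicate_zero]
  simp [natEval]

theorem length_natFrob {q w : List ℕ} (hnl : nl ≠ []) (hq : q.length = nl.length) (hw : w ≠ [])
    (k : ℕ) : (natFrob p nl q w k).length = nl.length := by
  induction k with
  | zero => exact hq
  | succ k ih => exact length_natMul hw (length_natPow hnl ih _ _)

theorem natEval_frob_succ (ha : a ^ nl.length = natEval a nl) {q w : List ℕ} (hnl : nl ≠ [])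
    (hq : q.length = nl.length) (hw : w ≠ []) (hp : 1 ≤ p) (k : ℕ) :
    natEval a (natFrob p nl q w (k + 1)) = natEval a w * natEval a (natFrob p nl q w k) ^ p := by
  have hl := length_natFrob (p := p) hnl hq hw k
  rw [natFrob, natEval_mul ha _ (length_natPow hnl hl _ _), natEval_pow ha hnl hl hp le_rfl]

theorem natEval_frob_one (ha : a ^ nl.length = natEval a nl) {q : List ℕ} (hnl : nl ≠ [])
    (hq : q.length = nl.length) (hp : 1 ≤ p) (k : ℕ) :
    natEval a (natFrob p nl q [1] k) = natEval a q ^ p ^ k := by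
  induction k with
  | zero => rw [natFrob, pow_zero, pow_one]
  | succ k ih =>
    rw [natEval_frob_succ ha hnl hq (by simp) hp, ih, ← pow_mul, ← pow_succ]
    simp [natEval]

theorem listEval_natToInt (l : List ℕ) : listEval a (natToInt l) = natEval a l := by
  induction l using List.reverseRecOn with
  | nil => rfl
  | append_singleton l c ih =>
    rw [natEval_append_singleton, ← ih]
    simp [natToInt, listEval]
    ring

theorem length_natNeg (p : ℕ) (low : List ℤ) : (natNeg p low).length = low.length := by
  simp [natNeg]

theorem natEval_neg (hp : p ≠ 0) (low : List ℤ) :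
    natEval a (natNeg p low) = -listEval a low := by
  induction low with
  | nil => simp [natNeg, natEval, listEval]
  | cons c low ih =>
    have hc : ((-c % (p : ℤ)).toNat : R) = -c := by
      rw [← Int.cast_natCast, Int.toNat_of_nonneg (Int.emod_nonneg _ (by exact_mod_cast hp)),
        (CharP.intCast_eq_intCast R p).2 (Int.mod_modEq _ _), Int.cast_neg]
    rw [natNeg, List.map_cons, List.reverse_cons, natEval_append_singleton, hc, listEval]
    rw [natNeg] at ih
    rw [ih]
    ring

theorem pow_length_natNeg (hp : p ≠ 0) {low : List ℤ} (ha : monicEval a low = 0) :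
    a ^ (natNeg p low).length = natEval a (natNeg p low) := by
  rw [length_natNeg, natEval_neg hp, ← add_eq_zero_iff_eq_neg]
  exact ha

end Residue

/-- The power `X ^ p ^ k` modulo `p` and modulo `X ^ low.length + low`. -/
def listFrob (p : ℕ) (low : List ℤ) (k : ℕ) : List ℤ :=
  natToInt (natFrob p (natNeg p low) (natX p (natNeg p low)) [1] k)

theorem listEval_frob {p : ℕ} [CharP R p] (hp : p ≠ 0) {low : List ℤ} (hlow : low ≠ [])
    (ha : monicEval a low = 0) (k : ℕ) : listEval a (listFrob p low k) = a ^ p ^ k := by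
  have hnl : natNeg p low ≠ [] := by simpa [natNeg] using hlow
  have ha' := pow_length_natNeg hp ha
  rw [listFrob, listEval_natToInt, natEval_frob_one ha' hnl (length_natX hnl)
    (Nat.one_le_iff_ne_zero.2 hp), natEval_X ha' hnl]

end ListPolynomial

section FrobeniusCount

theorem mem_rootSet_monicEval {O : Type*} [CommRing O] [IsDomain O] {low : List ℤ} {x : O} :
    x ∈ (monicEval (X : ℤ[X]) low).rootSet O ↔ monicEval x low = 0 := by
  rw [mem_rootSet', aeval_def, ← eval_map, map_monicEval_X, eval_monicEval]
  exact and_iff_right (monic_monicEval low).ne_zero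

theorem mem_roots_monicEval {O : Type*} [CommRing O] [IsDomain O] {low : List ℤ} {x : O} :
    x ∈ (monicEval (X : O[X]) low).roots ↔ monicEval x low = 0 := by
  rw [mem_roots (monic_monicEval low).ne_zero, IsRoot, eval_monicEval]

theorem nodup_roots_monicEval {p : ℕ} {k : Type*} [Field k] [CharP k p] {low s : List ℤ}
    (h : listEq p (listMul p low (listDeriv (low ++ [1])) s) [1]) :
    (monicEval (X : k[X]) low).roots.Nodup := by
  classical
  rw [Multiset.nodup_iff_count_le_one]
  intro b
  rw [count_roots]
  by_contra! hb
  obtain ⟨h1, h2⟩ := (one_lt_rootMultiplicity_iff_isRoot (monic_monicEval low).ne_zero).1 hb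
  rw [IsRoot, eval_monicEval] at h1
  rw [IsRoot, derivative_monicEval, eval_listEval] at h2
  have := listEval_eq (a := b) p h
  rw [listEval_mul p h1, h2, zero_mul] at this
  simp [listEval] at this

theorem exists_root_map_eq {O k : Type*} [CommRing O] [IsDomain O] [CommRing k] [IsDomain k]
    (φ : O →+* k) {low : List ℤ} (hF : (monicEval (X : O[X]) low).Splits) {b : k}
    (hb : monicEval b low = 0) : ∃ x : O, monicEval x low = 0 ∧ φ x = b := by
  have hr := hF.roots_map_of_ne_zero (φ := φ)
    (by rw [map_monicEval_X]; exact (monic_monicEval low).ne_zero)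
  rw [map_monicEval_X] at hr
  have := mem_roots_monicEval.2 hb
  rw [hr, Multiset.mem_map] at this
  obtain ⟨x, hx, rfl⟩ := this
  exact ⟨x, mem_roots_monicEval.1 hx, rfl⟩

theorem injOn_of_listEq {O : Type*} [CommRing O] [IsDomain O]
    {p : ℕ} {k : Type*} [Field k] [CharP k p] (φ : O →+* k) {low s : List ℤ}
    (hF : (monicEval (X : O[X]) low).Splits)
    (h : listEq p (listMul p low (listDeriv (low ++ [1])) s) [1]) :
    Set.InjOn φ {x | monicEval x low = 0} := by
  have hr := hF.roots_map_of_ne_zero (φ := φ)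
    (by rw [map_monicEval_X]; exact (monic_monicEval low).ne_zero)
  have hn := nodup_roots_monicEval (k := k) h
  rw [← map_monicEval_X φ, hr] at hn
  intro x hx y hy
  exact Multiset.inj_on_of_nodup_map hn x (mem_roots_monicEval.2 hx) y (mem_roots_monicEval.2 hy)

/-- A certificate for the number of roots `b` of `low` with `b ^ p ^ k = b` in characteristic `p`:
`low` is the product of `u` and `v`, the roots of `u` are fixed by the Frobenius power, those of `v`
are not (`t` is an inverse of `X ^ p ^ k - X`). -/
def frobCheck (p k : ℕ) (low u v t : List ℤ) : Bool :=
  !v.isEmpty && listEq p (listMulWith p (0 :: ·) (u ++ [1]) (v ++ [1])) (low ++ [1]) &&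
  (u.isEmpty || listEq p (listFrob p u k) (listMul p u [0, 1] [1])) &&
  listEq p (listMul p v t (listAdd (listFrob p v k) [0, -1])) [1]

theorem map_pow_smul {O Γ k : Type*} [CommRing O] [Group Γ] [MulSemiringAction Γ O] [CommRing k]
    {φ : O →+* k} {σ : Γ} {p : ℕ} (hφ : ∀ x, φ (σ • x) = φ x ^ p) (n : ℕ) (x : O) :
    φ (σ ^ n • x) = φ x ^ p ^ n := by
  induction n with
  | zero => simp
  | succ n ih => rw [pow_succ', mul_smul, hφ, ih, ← pow_mul, ← pow_succ]

variable {O Γ : Type*} [CommRing O] [IsDomain O] [Group Γ] [MulSemiringAction Γ O]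
  [SMulCommClass Γ ℤ O]

theorem smul_pow_eq_of_frob {p : ℕ} (hp : p ≠ 0) {n : ℕ} {low s : List ℤ}
    {k : Type*} [Field k] [CharP k p]
    (hF : (monicEval (X : O[X]) low).Splits) {φ : O →+* k} {σ : Γ}
    (hφ : ∀ x, φ (σ • x) = φ x ^ p) (hlow : low ≠ [])
    (h : listEq p (listMul p low (listDeriv (low ++ [1])) s) [1])
    (hn : listEq p (listFrob p low n) [0, 1]) (x : (monicEval (X : ℤ[X]) low).rootSet O) :
    σ ^ n • x = x := by
  refine Subtype.ext <| injOn_of_listEq φ hF h (mem_rootSet_monicEval.1 (σ ^ n • x).2)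
    (mem_rootSet_monicEval.1 x.2) ?_
  have hx : monicEval (φ x) low = 0 := by
    rw [← map_monicEval, mem_rootSet_monicEval.1 x.2, map_zero]
  have := listEval_eq (a := φ x) p hn
  rw [rootSet.coe_smul, map_pow_smul hφ, ← listEval_frob hp hlow hx, this]
  simp [listEval]

theorem ncard_fixedBy_pow {p : ℕ} (hp : p ≠ 0) {n : ℕ} {low u v t s : List ℤ}
    {k : Type*} [Field k] [CharP k p]
    (hF : (monicEval (X : O[X]) low).Splits) {φ : O →+* k} {σ : Γ}
    (hφ : ∀ x, φ (σ • x) = φ x ^ p)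
    (hs : listEq p (listMul p low (listDeriv (low ++ [1])) s) [1])
    (h : frobCheck p n low u v t) :
    (MulAction.fixedBy ((monicEval (X : ℤ[X]) low).rootSet O) (σ ^ n)).ncard = u.length := by
  classical
  simp only [frobCheck, Bool.and_eq_true, Bool.or_eq_true, Bool.not_eq_true',
    List.isEmpty_eq_false_iff, List.isEmpty_iff] at h
  obtain ⟨⟨⟨hv0, huv⟩, hu⟩, hv⟩ := h
  have hinj := injOn_of_listEq φ hF hs
  have huv' : monicEval (X : k[X]) u * monicEval X v = monicEval X low := by
    have := listEval_eq (a := (X : k[X])) p huv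
    rw [listEval_mulWith p (fun s ↦ by simp [listEval])] at this
    simpa only [listEval_append_one] using this
  have hFk : (monicEval (X : k[X]) low).Splits := map_monicEval_X φ low ▸ hF.map φ
  have hns := nodup_roots_monicEval (k := k) hs
  have hdvd : monicEval (X : k[X]) u ∣ monicEval X low := ⟨_, huv'.symm⟩
  have hle := roots.le_of_dvd (monic_monicEval low).ne_zero hdvd
  have huS : (monicEval (X : k[X]) u).Splits := hFk.of_dvd (monic_monicEval low).ne_zero hdvd
  rw [← natDegree_monicEval (R := k) u, huS.natDegree_eq_card_roots,
    ← Multiset.toFinset_card_of_nodup (Multiset.nodup_of_le hle hns), ← Set.ncard_coe_finset]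
  have hfix (b : k) (hb : monicEval b u = 0) : b ^ p ^ n = b := by
    by_cases hu0 : u = []
    · subst hu0
      simp [monicEval, listEval] at hb
    rw [← listEval_frob hp hu0 hb, listEval_eq p (hu.resolve_left hu0), listEval_mul p hb]
    simp [listEval]
  have hnfix (b : k) (hb : monicEval b v = 0) : b ^ p ^ n ≠ b := fun h ↦ by
    have := listEval_eq (a := b) p hv
    rw [listEval_mul p hb, listEval_add, listEval_frob hp hv0 hb, h] at this
    simp [listEval] at this
  have hmul (b : k) : monicEval b u * monicEval b v = monicEval b low := by
    simpa only [eval_mul, eval_monicEval] using congrArg (eval b) huv'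
  refine Set.ncard_congr (fun x _ ↦ φ x) (fun x hx ↦ ?_) (fun x y _ _ hxy ↦ ?_) (fun b hb ↦ ?_)
  · rw [Finset.mem_coe, Multiset.mem_toFinset, mem_roots_monicEval]
    have hx0 : monicEval (φ x) low = 0 := by
      rw [← map_monicEval, mem_rootSet_monicEval.1 x.2, map_zero]
    rw [← hmul] at hx0
    refine (mul_eq_zero.1 hx0).resolve_right fun h ↦ hnfix _ h ?_
    rw [← map_pow_smul hφ, ← rootSet.coe_smul, (hx : σ ^ n • x = x)]
  · exact Subtype.ext <| hinj (mem_rootSet_monicEval.1 x.2) (mem_rootSet_monicEval.1 y.2) hxy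
  · rw [Finset.mem_coe, Multiset.mem_toFinset, mem_roots_monicEval] at hb
    obtain ⟨x, hx, rfl⟩ := exists_root_map_eq φ hF (b := b) (by rw [← hmul, hb, zero_mul])
    let x' : (monicEval (X : ℤ[X]) low).rootSet O := ⟨x, mem_rootSet_monicEval.2 hx⟩
    refine ⟨x', Subtype.ext ?_, rfl⟩
    refine hinj (mem_rootSet_monicEval.1 (σ ^ n • x').2) hx ?_
    rw [rootSet.coe_smul, map_pow_smul hφ]
    exact hfix _ hb

end FrobeniusCount

section Certificates

/-- The lower coefficients of the degree 12 polynomial `f` with `g(y) = f(y²)`. -/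
def fLow : List ℤ :=
  [1166400, -6480000, 11638080, -7970400, 1350000, 421200, -58860, -22500, 945, 540, -30, 0]

theorem separable_fLow_11 :
    listEq 11 (listMul 11 fLow (listDeriv (fLow ++ [1]))
      [3, 1, 7, 0, 7, 9, 6, 7, 8, 1, 7, 5]) [1] := by
  decide +kernel

theorem separable_fLow_13 :
    listEq 13 (listMul 13 fLow (listDeriv (fLow ++ [1]))
      [11, 2, 2, 11, 10, 9, 0, 10, 4, 11, 7, 5]) [1] := by
  decide +kernel

theorem listFrob_fLow_13 : listEq 13 (listFrob 13 fLow 11) [0, 1] := by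
  decide +kernel

theorem separable_fLow_29 :
    listEq 29 (listMul 29 fLow (listDeriv (fLow ++ [1]))
      [2, 6, 12, 3, 1, 19, 22, 9, 13, 10, 1, 24]) [1] := by
  decide +kernel

theorem listFrob_fLow_29 : listEq 29 (listFrob 29 fLow 8) [0, 1] := by
  decide +kernel

theorem separable_fLow_47 :
    listEq 47 (listMul 47 fLow (listDeriv (fLow ++ [1]))
      [41, 8, 13, 43, 33, 27, 45, 22, 13, 7, 42, 7]) [1] := by
  decide +kernel

theorem listFrob_fLow_47 : listEq 47 (listFrob 47 fLow 6) [0, 1] := by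
  decide +kernel

theorem listFrob_fLow_11 : listEq 11 (listFrob 11 fLow 10) [0, 1] := by
  decide +kernel

theorem natFrob_fLow_11 :
    listEq 11 (natToInt (natFrob 11 (natNeg 11 fLow) (List.replicate 11 0 ++ [1])
      [1, 0, 0, 0, 0, 0] 10)) [-1] := by
  decide +kernel

theorem frobCheck_fLow_13_1 :
    frobCheck 13 1 fLow [4]
      [10, 12, 0, 1, 10, 4, 0, 4, 11, 12, 9]
      [6, 10, 7, 5, 1, 7, 5, 11, 11, 7] := by
  decide +kernel

theorem frobCheck_fLow_11_2 :
    frobCheck 11 2 fLow [8, 3]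
      [6, 2, 3, 3, 3, 8, 5, 2, 4, 8]
      [2, 6, 7, 2, 8, 4, 5, 7, 6, 9] := by
  decide +kernel

theorem frobCheck_fLow_11_5 :
    frobCheck 11 5 fLow []
      [4, 1, 3, 2, 3, 10, 1, 6, 10, 1, 3, 0]
      [0, 8, 5, 9, 0, 1, 3, 5, 8, 4, 9, 5] := by
  decide +kernel

theorem frobCheck_fLow_29_1 :
    frobCheck 29 1 fLow [14, 27]
      [18, 2, 22, 25, 18, 28, 20, 26, 18, 2]
      [11, 2, 18, 3, 20, 4, 10, 21, 5, 27] := by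
  decide +kernel

theorem frobCheck_fLow_29_2 :
    frobCheck 29 2 fLow [5, 22, 12, 23]
      [4, 4, 14, 1, 5, 4, 23, 6]
      [12, 3, 4, 25, 18, 19, 23, 13] := by
  decide +kernel

theorem frobCheck_fLow_29_4 :
    frobCheck 29 4 fLow [5, 22, 12, 23]
      [4, 4, 14, 1, 5, 4, 23, 6]
      [25, 23, 8, 9, 6, 28, 23, 3] := by
  decide +kernel

theorem frobCheck_fLow_47_2 :
    frobCheck 47 2 fLow [29, 7, 31]
      [13, 19, 7, 10, 29, 14, 2, 31, 16]
      [37, 19, 6, 12, 16, 12, 17, 33, 21] := by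
  decide +kernel

theorem frobCheck_fLow_47_3 :
    frobCheck 47 3 fLow [42, 15, 30, 35]
      [28, 12, 28, 4, 12, 45, 37, 12]
      [28, 1, 29, 29, 42, 26, 17, 37] := by
  decide +kernel

end Certificates

section BivariateLists

/-- The value at `(x, w)` of a polynomial in `w` whose coefficients are polynomials in `x`. -/
def biEval {R : Type*} [CommRing R] (x w : R) : List (List ℤ) → R
  | [] => 0
  | l :: L => listEval x l + w * biEval x w L

/-- Coefficientwise addition. -/
def biAdd : List (List ℤ) → List (List ℤ) → List (List ℤ)
  | [], M => M
  | L, [] => L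
  | l :: L, m :: M => listAdd l m :: biAdd L M

/-- Multiplication of polynomials with coefficients in `ℤ[x]` modulo `x ^ low.length + low`. -/
def biMul (low : List ℤ) (L M : List (List ℤ)) : List (List ℤ) :=
  L.foldr (fun l acc ↦ biAdd (M.map (listMul 0 low l)) ([] :: acc)) []

variable {R : Type*} [CommRing R] {x w : R}

theorem map_biEval {S : Type*} [CommRing S] (φ : R →+* S) (x w : R) (L : List (List ℤ)) :
    φ (biEval x w L) = biEval (φ x) (φ w) L := by
  induction L with
  | nil => exact map_zero φ
  | cons l L ih => simp [biEval, ih, map_listEval]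

theorem biEval_add (L M : List (List ℤ)) :
    biEval x w (biAdd L M) = biEval x w L + biEval x w M := by
  induction L generalizing M with
  | nil => simp [biAdd, biEval]
  | cons l L ih =>
    cases M with
    | nil => simp [biAdd, biEval]
    | cons m M => simp only [biAdd, biEval, ih, listEval_add]; ring

theorem biEval_mul [CharP R 0] {low : List ℤ} (hx : monicEval x low = 0) (L M : List (List ℤ)) :
    biEval x w (biMul low L M) = biEval x w L * biEval x w M := by
  have hmap (l : List ℤ) :
      biEval x w (M.map (listMul 0 low l)) = listEval x l * biEval x w M := by
    induction M with
    | nil => simp [biEval]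
    | cons m M ih => rw [List.map_cons, biEval, biEval, ih, listEval_mul 0 hx]; ring
  induction L with
  | nil => simp [biMul, biEval]
  | cons l L ih =>
    rw [biMul, List.foldr_cons, biEval_add, hmap, ← biMul, biEval, biEval, ih]
    simp only [listEval]
    ring

theorem biEval_eq_zero_of_all [CharP R 0] {L : List (List ℤ)} (h : L.all (listEq 0 · [])) :
    biEval x w L = 0 := by
  induction L with
  | nil => rfl
  | cons l L ih =>
    simp only [List.all_cons, Bool.and_eq_true] at h
    rw [biEval, ih h.2, listEval_eq 0 h.1]
    simp [listEval]

theorem biEval_map_singleton (l : List ℤ) : biEval x w (l.map ([·])) = listEval w l := by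
  induction l with
  | nil => rfl
  | cons c l ih => simp [biEval, listEval, ih]

end BivariateLists

section Incidence

/-- The lower coefficients of a degree 12 polynomial `h` such that the roots of `h(z²)` are the
twins of those of `f(y²)`. -/
def hLow : List ℤ :=
  [212576400, -1417759200, 2659479480, -1567665900, 711765225, -312797700, 99868140, -18508500,
   1682910, -37980, -1980, 0]

/-- The part of the incidence polynomial that is even in `y` and `z`, in terms of `y²`, `z²`. -/
def incEven : List (List ℤ) :=
  [[94478400000, -339366412800, 348625296000, -78732000000, -30705480000, 5149072800, 2296350000,
    -110224800, -70858800, 4374000, 0, -174960],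
   [-49996569600, 20925216000, 236163340800, -310024454400, 92261073600, 19120212000,
    -5610578400, -1093694400, 151308000, 23198400, -894240, 0],
   [-310134096000, 810664329600, -622223661600, 102800664000, 33655597200, -1178015400,
    -1519746300, -146917800, -29767500, 2726460, 2145960, 100980],
   [-28385510400, 94086489600, -126041184000, 78558984000, -20406556800, -1389960000, 883580400,
    113157000, -24512760, -2813400, 207720, 3600],
   [7394976000, -24139814400, 28076414400, -14182646400, 3198463200, 9622800, -117401400,
    1108080, 4976640, -298080, -89640, 7200],
   [-251942400, 1283040000, -2094854400, 1291204800, -194400000, -53071200, 6356880, 2025000,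
    -68040, -29160, 1080, 0],
   [-6480000, 23276160, -23911200, 5400000, 2106000, -353160, -157500, 7560, 4860, -300, 0, 12]]

/-- The part of the incidence polynomial that is odd in `y` and `z`, divided by `y * z`. -/
def incOdd : List (List ℤ) :=
  [[-100702310400, 225983001600, -173539324800, 22286016000, 11106460800, 416599200, -230979600,
    35283600, -20574000, -3607200, 349920, 29520],
   [492209136000, -1304679052800, 1060517707200, -175311475200, -78516118800, 6418893600,
    4328089200, -16661700, -69384600, -1827360, -443880, -33660],
   [281157609600, -777439036800, 652146681600, -150050880000, -21111742800, 4941777600,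
    1309937400, -41836500, -29251800, 1171440, -352080, -99420],
   [-28362960000, 93040773120, -94363315200, 31785436800, 130734000, -994634640, -119939400,
    18929700, 2643840, 116280, 65880, 1524],
   [-346550400, -1029283200, 3499200000, -2628374400, 407235600, 116920800, -14117400, -4536540,
    276840, 54480, -4800, 140],
   [38880000, -139656960, 143467200, -32400000, -12636000, 2118960, 945000, -45360, -29160, 1800,
    0, -72]]

/-- For `f(y²) = 0` this is `f'(y²)` times a monic factor of degree 12 in `z` of `h(z²)`. -/
def incEval {R : Type*} [CommRing R] (y z : R) : R :=
  biEval (y ^ 2) (z ^ 2) incEven + y * z * biEval (y ^ 2) (z ^ 2) incOdd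

theorem inc_identity :
    (biAdd (biMul fLow incEven incEven) (biAdd (biMul fLow [[], [0, -1]] (biMul fLow incOdd incOdd))
      (biMul fLow [[-1]] (biMul fLow (biMul fLow [listDeriv (fLow ++ [1])]
        [listDeriv (fLow ++ [1])]) ((hLow ++ [1]).map ([·])))))).all (listEq 0 · []) := by
  decide +kernel

/-- Signs of a Hadamard matrix of order 12. -/
def hadamard (i j : Fin 12) : ℤˣ :=
  if ([0, 3908, 3496, 2786, 2454, 1842, 366, 3162, 2620, 1678, 1268,
      984] : List ℕ)[i].testBit j then -1 else 1

/-- Roots of `f(y²)` modulo `76493`. -/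
def yRes (i : Fin 12) : ℤ :=
  [2407, 70005, 63639, 57087, 20249, 22267, 46302, 30354, 31031, 44648, 35955, 39526][i]

/-- Roots of `h(z²)` modulo `76493`. -/
def zRes (j : Fin 12) : ℤ :=
  [2256, 10828, 60038, 52728, 52353, 51947, 28999, 47124, 46240, 43664, 41360, 35863][j]

theorem separable_fLow_76493 :
    listEq 76493 (listMul 76493 fLow (listDeriv (fLow ++ [1]))
      [42758, 8984, 13242, 70753, 24307, 57356, 32634, 1779, 43502, 55544, 6888, 53339]) [1] := by
  decide +kernel

theorem forall_yRes : ∀ i, monicEval (yRes i ^ 2) fLow % 76493 = 0 := by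
  decide +kernel

theorem forall_zRes : ∀ i, monicEval (zRes i ^ 2) hLow % 76493 = 0 := by
  decide +kernel

theorem yRes_sq_ne : ∀ i j, i ≠ j → (yRes i ^ 2 - yRes j ^ 2) % 76493 ≠ 0 := by
  decide +kernel

theorem zRes_sq_ne : ∀ i j, i ≠ j → (zRes i ^ 2 - zRes j ^ 2) % 76493 ≠ 0 := by
  decide +kernel

theorem incEval_res_ne : ∀ i j, incEval (yRes i) (-hadamard i j * zRes j) % 76493 ≠ 0 := by
  decide +kernel

theorem hadamard_signs_eq_one : ∀ e : Fin 5 → ℤˣ, e 0 = 1 →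
    (∀ j, ∃ j' d, ∀ i : Fin 5, hadamard (i.castLE (by decide)) j' =
      e i * d * hadamard (i.castLE (by decide)) j) → ∀ i, e i = 1 := by
  decide +kernel

theorem hadamard_column_unique : ∀ j, j ≠ 6 → j ≠ 9 → ∀ j' d,
    (∀ i : Fin 5, hadamard (i.castLE (by decide)) j' = d * hadamard (i.castLE (by decide)) j) →
      j' = j ∧ d = 1 := by
  decide +kernel

theorem hadamard_row_unique : ∀ i i' e,
    (∀ j, j ≠ 6 → j ≠ 9 → hadamard i' j = e * hadamard i j) → i' = i ∧ e = 1 := by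
  decide +kernel

theorem map_incEval {R S : Type*} [CommRing R] [CommRing S] (φ : R →+* S) (y z : R) :
    φ (incEval y z) = incEval (φ y) (φ z) := by
  simp [incEval, map_biEval]

theorem incEval_units_mul {R : Type*} [CommRing R] (e : ℤˣ) (y z : R) :
    incEval ((e : ℤ) * y) ((e : ℤ) * z) = incEval y z := by
  obtain rfl | rfl := Int.units_eq_one_or e <;> simp [incEval]

theorem incEval_mul_incEval_neg {R : Type*} [CommRing R] [CharP R 0] {y z : R}
    (hy : monicEval (y ^ 2) fLow = 0) (hz : monicEval (z ^ 2) hLow = 0) :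
    incEval y z * incEval y (-z) = 0 := by
  have := biEval_eq_zero_of_all (x := y ^ 2) (w := z ^ 2) inc_identity
  simp only [biEval_add, biEval_mul hy, biEval_map_singleton, listEval_append_one, hz,
    biEval, listEval] at this
  push_cast at this
  rw [incEval, incEval, neg_sq]
  linear_combination this

end Incidence

section Lifting

theorem natCard_rootSet_monicEval {O k : Type*} [CommRing O] [IsDomain O] {p : ℕ} [Field k]
    [CharP k p] (φ : O →+* k) {low s : List ℤ} (hF : (monicEval (X : O[X]) low).Splits)
    (hs : listEq p (listMul p low (listDeriv (low ++ [1])) s) [1]) :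
    Nat.card ((monicEval (X : ℤ[X]) low).rootSet O) = low.length := by
  classical
  have hr := hF.roots_map_of_ne_zero (φ := φ)
    (by rw [map_monicEval_X]; exact (monic_monicEval low).ne_zero)
  have hn := nodup_roots_monicEval (k := k) hs
  rw [← map_monicEval_X φ, hr] at hn
  rw [← natDegree_monicEval (R := O) low, hF.natDegree_eq_card_roots,
    ← Multiset.toFinset_card_of_nodup (Multiset.Nodup.of_map _ hn), Nat.card_coe_set_eq,
    ← Set.ncard_coe_finset]
  congr 1
  ext x
  rw [mem_rootSet_monicEval, Finset.mem_coe, Multiset.mem_toFinset, mem_roots_monicEval]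

/-- Square roots of the roots of a polynomial lift along `φ`, and distinct squares exhaust the
roots. -/
theorem exists_sq_root_lifts {O k : Type*} [CommRing O] [IsDomain O] {p : ℕ} [Field k]
    [CharP k p] (φ : O →+* k) {low : List ℤ} (hF : (monicEval (X : O[X]) low).Splits)
    (hsq : ∀ x : O, monicEval x low = 0 → IsSquare x) (b : Fin low.length → ℤ)
    (hb : ∀ i, monicEval (b i ^ 2) low % p = 0) (hne : ∀ i j, i ≠ j → (b i ^ 2 - b j ^ 2) % p ≠ 0) :
    ∃ y : Fin low.length → O, (∀ i, φ (y i) = b i) ∧ (∀ i, monicEval (y i ^ 2) low = 0) ∧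
      (∀ i j, y i ^ 2 = y j ^ 2 → i = j) ∧
      ∀ u, monicEval (u ^ 2) low = 0 → ∃ i, ∃ e : ℤˣ, u = (e : ℤ) * y i := by
  classical
  have hex (i) : ∃ y : O, φ y = b i ∧ monicEval (y ^ 2) low = 0 := by
    obtain ⟨x, hx, hxb⟩ := exists_root_map_eq φ hF (b := (b i : k) ^ 2) (by
      have := (CharP.intCast_eq_zero_iff k p _).2 (Int.dvd_of_emod_eq_zero (hb i))
      rw [← eq_intCast (Int.castRingHom k), map_monicEval] at this
      simpa using this)
    obtain ⟨y, rfl⟩ := hsq x hx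
    rw [map_mul, ← sq] at hxb
    obtain h | h := sq_eq_sq_iff_eq_or_eq_neg.1 hxb
    · exact ⟨y, h, by rwa [sq]⟩
    · exact ⟨-y, by rw [map_neg, h, neg_neg], by rwa [neg_sq, sq]⟩
  choose y hyb hy using hex
  have hinj (i j) (h : y i ^ 2 = y j ^ 2) : i = j := by
    by_contra hij
    refine hne i j hij (Int.emod_eq_zero_of_dvd ((CharP.intCast_eq_zero_iff k p _).1 ?_))
    have := congrArg φ h
    rw [map_pow, map_pow, hyb, hyb] at this
    push_cast
    rw [this, sub_self]
  refine ⟨y, hyb, hy, hinj, fun u hu ↦ ?_⟩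
  have h0 := (monic_monicEval (R := O) low).ne_zero
  have huniv : (Finset.univ.image fun i ↦ y i ^ 2) = (monicEval (X : O[X]) low).roots.toFinset := by
    refine Finset.eq_of_subset_of_card_le (fun x hx ↦ ?_) ?_
    · obtain ⟨i, -, rfl⟩ := Finset.mem_image.1 hx
      rw [Multiset.mem_toFinset, mem_roots_monicEval, hy]
    · rw [Finset.card_image_of_injective _ fun i j ↦ hinj i j, Finset.card_univ, Fintype.card_fin]
      exact (Multiset.toFinset_card_le _).trans ((card_roots' _).trans (natDegree_monicEval low).le)
  have : u ^ 2 ∈ Finset.univ.image fun i ↦ y i ^ 2 := by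
    rw [huniv, Multiset.mem_toFinset, mem_roots_monicEval, hu]
  obtain ⟨i, -, hi⟩ := Finset.mem_image.1 this
  obtain h | h := sq_eq_sq_iff_eq_or_eq_neg.1 hi
  · exact ⟨i, 1, by simp [h]⟩
  · exact ⟨i, -1, by simp [h]⟩

end Lifting

section Core

variable {O Γ : Type*} [CommRing O] [Group Γ] [MulSemiringAction Γ O]

theorem smul_units_mul (γ : Γ) (e : ℤˣ) (u : O) : γ • (((e : ℤ) : O) * u) = (e : ℤ) * γ • u := by
  obtain rfl | rfl := Int.units_eq_one_or e <;> simp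

theorem smul_monicEval (γ : Γ) (x : O) (low : List ℤ) :
    γ • monicEval x low = monicEval (γ • x) low :=
  map_monicEval (MulSemiringAction.toRingHom Γ O γ) x low

theorem smul_incEval (γ : Γ) (y z : O) : γ • incEval y z = incEval (γ • y) (γ • z) :=
  map_incEval (MulSemiringAction.toRingHom Γ O γ) y z

/-- An automorphism that fixes the square of `y i` for `i < 5` and fixes `y 0` fixes every `y i`,
if incidence between the `± y i` and the `± z j` is given by the Hadamard matrix. -/
theorem smul_eq_of_smul_sq_eq [IsDomain O] {y z : Fin 12 → O}
    (hy : ∀ i, monicEval (y i ^ 2) fLow = 0)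
    (hz : ∀ i, monicEval (z i ^ 2) hLow = 0)
    (hyall : ∀ u, monicEval (u ^ 2) fLow = 0 → ∃ i, ∃ e : ℤˣ, u = (e : ℤ) * y i)
    (hzall : ∀ u, monicEval (u ^ 2) hLow = 0 → ∃ i, ∃ e : ℤˣ, u = (e : ℤ) * z i)
    (hinc : ∀ i j, ∀ e : ℤˣ, incEval (y i) ((e : ℤ) * z j) = 0 ↔ e = hadamard i j)
    {γ : Γ} (h0 : γ • y 0 = y 0)
    (hγ : ∀ i : Fin 5, (γ • y (i.castLE (by decide))) ^ 2 = y (i.castLE (by decide)) ^ 2)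
    (i : Fin 12) : γ • y i = y i := by
  have hinc' (i j) (e d : ℤˣ) :
      incEval ((e : ℤ) * y i : O) ((d : ℤ) * z j) = 0 ↔ d = e * hadamard i j := by
    rw [← incEval_units_mul e, ← mul_assoc, ← mul_assoc, ← Int.cast_mul, ← Int.cast_mul,
      ← Units.val_mul, ← Units.val_mul, Int.units_mul_self, Units.val_one, Int.cast_one, one_mul,
      hinc, ← mul_right_inj e, ← mul_assoc, Int.units_mul_self, one_mul]
  have hrel {i i' j j' : Fin 12} {e d : ℤˣ} (hi : γ • y i = (e : ℤ) * y i')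
      (hj : γ • z j = (d : ℤ) * z j') : hadamard i' j' = e * d * hadamard i j := by
    have := (hinc i j _).2 rfl
    rw [← smul_eq_zero_iff_eq γ, smul_incEval, smul_units_mul, hi, hj, ← mul_assoc, ← Int.cast_mul,
      ← Units.val_mul, hinc'] at this
    rw [← mul_right_inj e, ← this, mul_assoc, ← mul_assoc e, Int.units_mul_self, one_mul, mul_comm]
  have hyγ (i) : ∃ i', ∃ e : ℤˣ, γ • y i = (e : ℤ) * y i' :=
    hyall _ (by rw [← smul_pow', ← smul_monicEval, hy, smul_zero])
  have hzγ (i) : ∃ i', ∃ e : ℤˣ, γ • z i = (e : ℤ) * z i' :=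
    hzall _ (by rw [← smul_pow', ← smul_monicEval, hz, smul_zero])
  have hsign (i : Fin 5) : ∃ e : ℤˣ, γ • y (i.castLE (by decide)) =
      (e : ℤ) * y (i.castLE (by decide)) ∧ (i = 0 → e = 1) := by
    by_cases hi : i = 0
    · subst hi
      exact ⟨1, by simpa using h0, fun _ ↦ rfl⟩
    · obtain h | h := sq_eq_sq_iff_eq_or_eq_neg.1 (hγ i)
      · exact ⟨1, by simp [h], fun h ↦ absurd h hi⟩
      · exact ⟨-1, by simp [h], fun h ↦ absurd h hi⟩
  choose e he he0 using hsign
  have he1 := hadamard_signs_eq_one e (he0 0 rfl) fun j ↦ by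
    obtain ⟨j', d, hj⟩ := hzγ j
    exact ⟨j', d, fun i ↦ hrel (he i) hj⟩
  have hzfix (j) (h6 : j ≠ 6) (h9 : j ≠ 9) : γ • z j = ((1 : ℤˣ) : ℤ) * z j := by
    obtain ⟨j', d, hj⟩ := hzγ j
    obtain ⟨rfl, rfl⟩ := hadamard_column_unique j h6 h9 j' d fun i ↦ by
      simpa [he1] using hrel (he i) hj
    exact hj
  obtain ⟨i', d, hi⟩ := hyγ i
  obtain ⟨rfl, rfl⟩ := hadamard_row_unique i i' d fun j h6 h9 ↦ by
    simpa using hrel hi (hzfix j h6 h9)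
  simpa using hi

theorem smul_pow_ten_eq_neg [IsDomain O] {k : Type*} [Field k] [CharP k 11] {φ : O →+* k} {σ : Γ}
    (hφ : ∀ x, φ (σ • x) = φ x ^ 11) {y : O} (hy : monicEval (y ^ 2) fLow = 0)
    (hfix : σ ^ 10 • y ^ 2 = y ^ 2) : σ ^ 10 • y = -y := by
  rw [smul_pow'] at hfix
  refine (sq_eq_sq_iff_eq_or_eq_neg.1 hfix).resolve_left fun h ↦ ?_
  have hx : monicEval (φ y ^ 2) fLow = 0 := by rw [← map_pow, ← map_monicEval, hy, map_zero]
  have hnl : natNeg 11 fLow ≠ [] := by decide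
  have ha := pow_length_natNeg (p := 11) (by simp) hx
  have key (n : ℕ) : φ y ^ 11 ^ n = φ y * natEval (φ y ^ 2) (natFrob 11 (natNeg 11 fLow)
      (List.replicate 11 0 ++ [1]) [1, 0, 0, 0, 0, 0] n) := by
    induction n with
    | zero => simp [natFrob, natEval]
    | succ n ih =>
      rw [natEval_frob_succ ha hnl (by decide) (by simp) (by simp), pow_succ, pow_mul, ih, mul_pow]
      simp [natEval]
      ring
  have h10 := listEval_eq (a := φ y ^ 2) 11 natFrob_fLow_11
  rw [listEval_natToInt] at h10
  have h' := congrArg φ h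
  rw [map_pow_smul hφ, key, h10] at h'
  have hy0 : φ y = 0 := by
    have h2 : (2 : k) ≠ 0 := by
      have := (CharP.cast_eq_zero_iff k 11 2).not.2 (by decide)
      exact_mod_cast this
    have : 2 * φ y = 0 := by
      simp only [listEval] at h'
      push_cast at h'
      linear_combination -h'
    exact (mul_eq_zero.1 this).resolve_left h2
  have h0 := (CharP.intCast_eq_zero_iff k 11 1166400).not.2 (by decide)
  rw [hy0] at hx
  simp [monicEval, listEval, fLow] at hx
  exact h0 (by exact_mod_cast hx)

end Core

section Core

variable {O Γ : Type*} [CommRing O] [IsDomain O] [Group Γ] [MulSemiringAction Γ O]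

theorem isMultiplyPretransitive_rootSet
    (hFr : ∀ p : ℕ, p.Prime → ∃ (k : Type) (_ : Field k) (_ : CharP k p) (φ : O →+* k) (σ : Γ),
      ∀ x, φ (σ • x) = φ x ^ p)
    (hf : (monicEval (X : O[X]) fLow).Splits) :
    MulAction.IsMultiplyPretransitive Γ ((monicEval (X : ℤ[X]) fLow).rootSet O) 5 := by
  have h0 : fLow ≠ [] := by decide
  obtain ⟨k, _, _, φ, a, ha⟩ := hFr 13 (by norm_num)
  obtain ⟨kβ, _, _, φβ, β, hβ⟩ := hFr 11 (by norm_num)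
  obtain ⟨kκ, _, _, φκ, κ, hκ⟩ := hFr 29 (by norm_num)
  obtain ⟨kρ, _, _, φρ, ρ, hρ⟩ := hFr 47 (by norm_num)
  refine isMultiplyPretransitive_five (a := a) (β := β) (κ := κ) (ρ := ρ)
    (natCard_rootSet_monicEval φ hf separable_fLow_13)
    (smul_pow_eq_of_frob (by simp) hf ha h0 separable_fLow_13 listFrob_fLow_13) ?_ ?_
    (ncard_fixedBy_pow (by simp) hf hβ separable_fLow_11 frobCheck_fLow_11_2)
    (ncard_fixedBy_pow (by simp) hf hβ separable_fLow_11 frobCheck_fLow_11_5)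
    (smul_pow_eq_of_frob (by simp) hf hκ h0 separable_fLow_29 listFrob_fLow_29) ?_
    (ncard_fixedBy_pow (by simp) hf hκ separable_fLow_29 frobCheck_fLow_29_2)
    (ncard_fixedBy_pow (by simp) hf hκ separable_fLow_29 frobCheck_fLow_29_4)
    (smul_pow_eq_of_frob (by simp) hf hρ h0 separable_fLow_47 listFrob_fLow_47)
    (ncard_fixedBy_pow (by simp) hf hρ separable_fLow_47 frobCheck_fLow_47_2)
    (ncard_fixedBy_pow (by simp) hf hρ separable_fLow_47 frobCheck_fLow_47_3)
  · simpa using ncard_fixedBy_pow (by simp) hf ha separable_fLow_13 frobCheck_fLow_13_1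
  · exact smul_pow_eq_of_frob (by simp) hf hβ h0 separable_fLow_11 listFrob_fLow_11
  · simpa using ncard_fixedBy_pow (by simp) hf hκ separable_fLow_29 frobCheck_fLow_29_1

/-- The faithful quotient of a group acting on the roots of `f(y²)` has order `190080`. -/
theorem natCard_eq_of_frob [CharZero O] {G : Type*} [Group G]
    (hFr : ∀ p : ℕ, p.Prime → ∃ (k : Type) (_ : Field k) (_ : CharP k p) (φ : O →+* k) (σ : Γ),
      ∀ x, φ (σ • x) = φ x ^ p)
    (hf : (monicEval (X : O[X]) fLow).Splits)
    (hfsq : ∀ x : O, monicEval x fLow = 0 → IsSquare x)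
    (hh : (monicEval (X : O[X]) hLow).Splits)
    (hhsq : ∀ x : O, monicEval x hLow = 0 → IsSquare x)
    (r : Γ →* G) (hr : Function.Surjective r)
    (hker : ∀ γ, r γ = 1 ↔ ∀ y : O, monicEval (y ^ 2) fLow = 0 → γ • y = y) :
    Nat.card G = 190080 := by
  classical
  have h5 := isMultiplyPretransitive_rootSet hFr hf
  obtain ⟨k, _, _, φ, -, -⟩ := hFr 76493 (by norm_num)
  obtain ⟨y, hyφ, hy, hyinj, hyall⟩ : ∃ y : Fin 12 → O, (∀ i, φ (y i) = yRes i) ∧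
      (∀ i, monicEval (y i ^ 2) fLow = 0) ∧ (∀ i j, y i ^ 2 = y j ^ 2 → i = j) ∧
      ∀ u, monicEval (u ^ 2) fLow = 0 → ∃ i, ∃ e : ℤˣ, u = (e : ℤ) * y i :=
    exists_sq_root_lifts φ hf hfsq yRes forall_yRes yRes_sq_ne
  obtain ⟨z, hzφ, hz, -, hzall⟩ : ∃ z : Fin 12 → O, (∀ i, φ (z i) = zRes i) ∧
      (∀ i, monicEval (z i ^ 2) hLow = 0) ∧ (∀ i j, z i ^ 2 = z j ^ 2 → i = j) ∧
      ∀ u, monicEval (u ^ 2) hLow = 0 → ∃ i, ∃ e : ℤˣ, u = (e : ℤ) * z i :=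
    exists_sq_root_lifts φ hh hhsq zRes forall_zRes zRes_sq_ne
  have hinc (i j) (e : ℤˣ) : incEval (y i) ((e : ℤ) * z j) = 0 ↔ e = hadamard i j := by
    have hne : incEval (y i) (-(((hadamard i j : ℤ) : O) * z j)) ≠ 0 := fun h ↦ by
      refine incEval_res_ne i j (Int.emod_eq_zero_of_dvd
        ((CharP.intCast_eq_zero_iff k 76493 _).1 ?_))
      have := congrArg φ h
      rw [map_incEval, map_zero, map_neg, map_mul, map_intCast, hyφ, hzφ] at this
      rw [← eq_intCast (Int.castRingHom k), map_incEval]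
      simpa using this
    have heq : incEval (y i) (((hadamard i j : ℤ) : O) * z j) = 0 := by
      refine (mul_eq_zero.1 (incEval_mul_incEval_neg (hy i) ?_)).resolve_right hne
      rw [mul_pow, ← Int.cast_pow, ← Units.val_pow_eq_pow_val, Int.units_sq]
      simpa using hz j
    refine ⟨fun h ↦ ?_, fun h ↦ h ▸ heq⟩
    by_contra hne'
    rw [← ne_eq, Int.units_ne_iff_eq_neg] at hne'
    refine hne ?_
    rw [← neg_mul, ← Int.cast_neg, ← Units.val_neg, ← hne', h]
  set Ω := (monicEval (X : ℤ[X]) fLow).rootSet O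
  let base : Fin 5 ↪ Ω := ⟨fun i ↦ ⟨y (i.castLE (by decide)) ^ 2, mem_rootSet_monicEval.2 (hy _)⟩,
    fun i j hij ↦ by simpa using hyinj _ _ (congrArg Subtype.val hij)⟩
  have hsqrt (x : Ω) : ∃ s : O, s ^ 2 = x := by
    obtain ⟨s, hs⟩ := hfsq x (mem_rootSet_monicEval.1 x.2)
    exact ⟨s, by rw [hs, sq]⟩
  choose s hs using hsqrt
  have hsign (γ : Γ) : ∃ e : ℤˣ, γ • y 0 = (e : ℤ) * s (γ • base 0) := by
    have : (γ • y 0) ^ 2 = s (γ • base 0) ^ 2 := by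
      rw [hs, rootSet.coe_smul, ← smul_pow']
      rfl
    obtain h | h := sq_eq_sq_iff_eq_or_eq_neg.1 this
    · exact ⟨1, by simp [h]⟩
    · exact ⟨-1, by simp [h]⟩
  choose sgn hsgn using hsign
  have hy0 : y 0 ≠ 0 := fun h ↦ by
    have := hy 0
    simp [h, monicEval, listEval, fLow] at this
  let Φ : Γ → (Fin 5 ↪ Ω) × ℤˣ := fun γ ↦ (γ • base, sgn γ)
  have hΦ (γ γ' : Γ) : Φ γ = Φ γ' ↔ γ • base = γ' • base ∧ γ • y 0 = γ' • y 0 := by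
    rw [Prod.ext_iff]
    refine and_congr_right fun (h : γ • base = γ' • base) ↦ ?_
    have hb : γ • base 0 = γ' • base 0 := DFunLike.congr_fun h 0
    have hs0 : s (γ' • base 0) ≠ 0 := fun h0 ↦ hy0 <| by
      rw [← smul_eq_zero_iff_eq γ', hsgn, h0, mul_zero]
    rw [hsgn, hsgn, hb, mul_left_inj' hs0, Int.cast_inj, Units.val_inj]
  have hΦr (γ γ' : Γ) : Φ γ = Φ γ' ↔ r γ = r γ' := by
    have hrr : r γ = r γ' ↔ r (γ⁻¹ * γ') = 1 := by rw [map_mul, map_inv, inv_mul_eq_one]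
    rw [hΦ, hrr, hker]
    constructor
    · rintro ⟨hb, h0⟩ u hu
      obtain ⟨i, e, rfl⟩ := hyall u hu
      rw [smul_units_mul, smul_eq_of_smul_sq_eq hy hz hyall hzall hinc
        (by rw [mul_smul, ← h0, inv_smul_smul]) fun i ↦ ?_]
      have := congrArg Subtype.val (DFunLike.congr_fun hb i)
      simp only [Function.Embedding.smul_apply] at this
      rw [← smul_pow', mul_smul, inv_smul_eq_iff]
      exact this.symm
    · intro h
      have hfix (i) : γ' • y i = γ • y i := by
        rw [← inv_smul_eq_iff, ← mul_smul, h _ (hy i)]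
      refine ⟨DFunLike.ext _ _ fun i ↦ Subtype.ext ?_, (hfix 0).symm⟩
      simp only [Function.Embedding.smul_apply]
      change γ • (y _ ^ 2) = γ' • (y _ ^ 2)
      rw [smul_pow', smul_pow', hfix]
  have hΦs : Function.Surjective Φ := by
    rintro ⟨v, e⟩
    obtain ⟨γ, rfl⟩ := h5.exists_smul_eq base v
    obtain ⟨k, _, _, ψ, β, hβ⟩ := hFr 11 (by norm_num)
    have hβΩ (x : Ω) : β ^ 10 • x = x :=
      smul_pow_eq_of_frob (by simp) hf hβ (by decide) separable_fLow_11 listFrob_fLow_11 x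
    have hβy : β ^ 10 • y 0 = -y 0 :=
      smul_pow_ten_eq_neg hβ (hy 0) (congrArg Subtype.val (hβΩ (base 0)))
    by_cases he : e = sgn γ
    · exact ⟨γ, by rw [he]⟩
    have hb : (γ * β ^ 10) • base = γ • base := by
      rw [mul_smul]
      congr 1
      exact DFunLike.ext _ _ fun i ↦ hβΩ _
    refine ⟨γ * β ^ 10, Prod.ext hb ?_⟩
    have hne : Φ (γ * β ^ 10) ≠ Φ γ := fun h ↦ by
      have := ((hΦ _ _).1 h).2
      rw [mul_smul, hβy, smul_left_cancel_iff, neg_eq_self] at this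
      exact hy0 this
    have hne' : sgn (γ * β ^ 10) ≠ sgn γ := fun h ↦ hne (Prod.ext hb h)
    rw [← ne_eq, Int.units_ne_iff_eq_neg] at he
    rw [Int.units_ne_iff_eq_neg] at hne'
    exact hne'.trans he.symm
  have hker' : Setoid.ker Φ = Setoid.ker r := Setoid.ext hΦr
  rw [← Nat.card_congr (Setoid.quotientKerEquivOfSurjective r hr), ← hker',
    Nat.card_congr (Setoid.quotientKerEquivOfSurjective Φ hΦs), Nat.card_prod]
  have hΩ : Nat.card Ω = 12 := natCard_rootSet_monicEval φ hf separable_fLow_76493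
  have : Finite Ω := Nat.finite_of_card_ne_zero (by rw [hΩ]; decide)
  have := Fintype.ofFinite Ω
  rw [Nat.card_eq_fintype_card, Nat.card_eq_fintype_card, Fintype.card_embedding_eq,
    ← Nat.card_eq_fintype_card, hΩ]
  rfl

end Core

theorem comp_X_sq_monicEval {R : Type*} [CommRing R] (low : List ℤ) :
    (monicEval (X : R[X]) low).comp (X ^ 2) = monicEval (X ^ 2) low := by
  rw [← coe_compRingHom_apply, map_monicEval, coe_compRingHom_apply, X_comp]

theorem map_monicEval_X_sq {R S : Type*} [CommRing R] [CommRing S] (φ : R →+* S) (low : List ℤ) :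
    (monicEval (X ^ 2 : R[X]) low).map φ = monicEval (X ^ 2) low := by
  rw [← coe_mapRingHom, map_monicEval, coe_mapRingHom, Polynomial.map_pow, map_X]

theorem monic_monicEval_X_sq {R : Type*} [CommRing R] [IsDomain R] (low : List ℤ) :
    (monicEval (X ^ 2 : R[X]) low).Monic :=
  comp_X_sq_monicEval (R := R) low ▸ (monic_monicEval low).comp (monic_X_pow 2) (by simp)

section NumberField

open NumberField

variable {L : Type*} [Field L]

theorem exists_ringOfIntegers_eq {x : L} {low : List ℤ} (hx : monicEval x low = 0) :
    ∃ y : 𝓞 L, (y : L) = x := by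
  have : IsIntegral ℤ x := ⟨monicEval X low, monic_monicEval low, by
    rw [← eval_map, map_monicEval_X, eval_monicEval, hx]⟩
  exact ⟨⟨x, this⟩, rfl⟩

theorem splits_monicEval_ringOfIntegers {low : List ℤ} (h : (monicEval (X : L[X]) low).Splits) :
    (monicEval (X : (𝓞 L)[X]) low).Splits := by
  have hlift : ∃ m : Multiset (𝓞 L), m.map (algebraMap (𝓞 L) L) =
      (monicEval (X : L[X]) low).roots := by
    have : ∀ x ∈ (monicEval (X : L[X]) low).roots, x ∈ Set.range (algebraMap (𝓞 L) L) :=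
      fun x hx ↦ exists_ringOfIntegers_eq (mem_roots_monicEval.1 hx)
    have : CanLift L (𝓞 L) (algebraMap (𝓞 L) L) (· ∈ Set.range (algebraMap (𝓞 L) L)) := ⟨fun _ ↦ id⟩
    exact CanLift.prf _ ‹_›
  obtain ⟨m, hm⟩ := hlift
  have heq : monicEval (X : (𝓞 L)[X]) low = (m.map fun a ↦ X - C a).prod := by
    apply map_injective (algebraMap (𝓞 L) L) (FaithfulSMul.algebraMap_injective _ _)
    rw [map_monicEval_X, h.eq_prod_roots_of_monic (monic_monicEval low), ← hm,
      Polynomial.map_multiset_prod]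
    simp
  rw [heq]
  exact Splits.multisetProd fun q hq ↦ by
    obtain ⟨a, -, rfl⟩ := Multiset.mem_map.1 hq
    exact Splits.X_sub_C a

theorem isSquare_of_splits {low : List ℤ} (h : (monicEval (X ^ 2 : L[X]) low).Splits) {x : 𝓞 L}
    (hx : monicEval x low = 0) : IsSquare x := by
  have hx' : monicEval (x : L) low = 0 := by
    rw [← map_monicEval, hx, map_zero]
  have hdvd : (X ^ 2 - C (x : L)) ∣ monicEval (X ^ 2) low := by
    obtain ⟨q, hq⟩ := dvd_iff_isRoot.2 (by rwa [IsRoot, eval_monicEval] :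
      (monicEval (X : L[X]) low).IsRoot x)
    rw [← comp_X_sq_monicEval, hq, mul_comp]
    simp
  obtain ⟨y, hy⟩ := (h.of_dvd (monic_monicEval_X_sq low).ne_zero hdvd).exists_eval_eq_zero
    (by rw [degree_X_pow_sub_C (by simp)]; decide)
  simp only [eval_sub, eval_pow, eval_X, eval_C, sub_eq_zero] at hy
  have : IsIntegral ℤ y := .of_pow (n := 2) (by simp) (hy ▸ x.isIntegral_coe)
  exact ⟨⟨y, this⟩, RingOfIntegers.ext (by simp [← hy, sq]; rfl)⟩

theorem exists_frobenius {L : Type} [Field L] [NumberField L] [IsGalois ℚ L] {p : ℕ}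
    (hp : p.Prime) : ∃ (k : Type) (_ : Field k) (_ : CharP k p) (φ : 𝓞 L →+* k) (σ : Gal(L/ℚ)),
      ∀ x, φ (σ • x) = φ x ^ p := by
  have := Fact.mk hp
  have hprime : (Ideal.span {(p : ℤ)}).IsPrime :=
    (Ideal.span_singleton_prime (by exact_mod_cast hp.ne_zero)).2 (Nat.prime_iff_prime_int.1 hp)
  have hmax : (Ideal.span {(p : ℤ)}).IsMaximal :=
    hprime.isMaximal (by simpa using hp.ne_zero)
  obtain ⟨⟨P, _, _⟩⟩ := (Ideal.span {(p : ℤ)}).nonempty_primesOver (S := 𝓞 L)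
  have : P.IsMaximal := .of_liesOver_isMaximal P (Ideal.span {(p : ℤ)})
  obtain ⟨σ, hσ⟩ := IsArithFrobAt.exists_of_isInvariant ℤ Gal(L/ℚ) P
  have hcard : Nat.card (ℤ ⧸ P.under ℤ) = p := by
    rw [← Ideal.over_def P (Ideal.span {(p : ℤ)}), Int.card_ideal_quot]
  let := Ideal.Quotient.field P
  refine ⟨𝓞 L ⧸ P, inferInstance, ?_, Ideal.Quotient.mk P, σ, fun x ↦ ?_⟩
  · have : CharP (ℤ ⧸ Ideal.span {(p : ℤ)}) p := ringChar.of_eq <| Int.ringChar_idealQuot p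
    exact charP_of_injective_algebraMap
      (FaithfulSMul.algebraMap_injective (ℤ ⧸ Ideal.span {(p : ℤ)}) (𝓞 L ⧸ P)) p
  · rw [← map_pow, Ideal.Quotient.eq, ← hcard]
    exact hσ x

theorem natCard_gal_monicEval_X_sq_fLow :
    Nat.card (monicEval (X ^ 2 : ℚ[X]) fLow).Gal = 190080 := by
  obtain ⟨P, hPdef⟩ : ∃ P : ℚ[X], P = (monicEval X fLow * monicEval X hLow) *
    (monicEval (X ^ 2) fLow * monicEval (X ^ 2) hLow) := ⟨_, rfl⟩
  have hP : P.Monic := hPdef ▸ ((monic_monicEval _).mul (monic_monicEval _)).mul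
    ((monic_monicEval_X_sq _).mul (monic_monicEval_X_sq _))
  have : IsSplittingField ℚ P.SplittingField P := by
    convert IsSplittingField.splittingField P
    exact Subsingleton.elim _ _
  have : FiniteDimensional ℚ P.SplittingField := IsSplittingField.finiteDimensional _ P
  have : NumberField P.SplittingField := {}
  have : Normal ℚ P.SplittingField := .of_isSplittingField P
  have : IsGalois ℚ P.SplittingField := {}
  have hsplit {q : ℚ[X]} (hq : q ∣ P) : (q.map (algebraMap ℚ P.SplittingField)).Splits :=
    (IsSplittingField.splits _ P).of_dvd (hP.map _).ne_zero (Polynomial.map_dvd _ hq)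
  have hf := hsplit (hPdef ▸ (dvd_mul_right _ _).mul_right _ : monicEval X fLow ∣ P)
  have hh := hsplit (hPdef ▸ (dvd_mul_left _ _).mul_right _ : monicEval X hLow ∣ P)
  have hf2 := hsplit (hPdef ▸ (dvd_mul_right _ _).mul_left _ : monicEval (X ^ 2) fLow ∣ P)
  have hh2 := hsplit (hPdef ▸ (dvd_mul_left _ _).mul_left _ : monicEval (X ^ 2) hLow ∣ P)
  have : Fact (((monicEval (X ^ 2 : ℚ[X]) fLow).map (algebraMap ℚ P.SplittingField)).Splits) :=
    ⟨hf2⟩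
  rw [map_monicEval_X] at hf hh
  rw [map_monicEval_X_sq] at hf2 hh2
  have hroot (x : P.SplittingField) :
      x ∈ (monicEval (X ^ 2 : ℚ[X]) fLow).rootSet P.SplittingField ↔
        monicEval (x ^ 2) fLow = 0 := by
    rw [mem_rootSet, and_iff_right (monic_monicEval_X_sq _).ne_zero, ← AlgHom.coe_toRingHom,
      map_monicEval, AlgHom.coe_toRingHom, map_pow, aeval_X]
  refine natCard_eq_of_frob (fun p ↦ exists_frobenius)
    (splits_monicEval_ringOfIntegers hf) (fun x ↦ isSquare_of_splits hf2)
    (splits_monicEval_ringOfIntegers hh) (fun x ↦ isSquare_of_splits hh2)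
    (Gal.restrict _ P.SplittingField) (Gal.restrict_surjective _ _) fun γ ↦ ?_
  rw [← (Gal.galActionHom_injective _ P.SplittingField).eq_iff, map_one, Equiv.ext_iff]
  simp only [Subtype.forall, Subtype.ext_iff, Gal.galActionHom_restrict, Equiv.Perm.one_apply,
    hroot]
  refine ⟨fun h y hy ↦ RingOfIntegers.ext (h y ?_), fun h x hx ↦ ?_⟩
  · rw [← map_pow, ← map_monicEval, hy, map_zero]
  · obtain ⟨w, hw⟩ := exists_ringOfIntegers_eq hx
    have hx' : IsIntegral ℤ x := .of_pow (n := 2) (by simp) (hw ▸ w.isIntegral_coe)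
    have hfix := congrArg (algebraMap _ P.SplittingField) (h ⟨x, hx'⟩ (RingOfIntegers.ext ?_))
    · exact hfix
    · exact (map_monicEval _ _ _).trans hx

end NumberField

/-- The degree-24 polynomial `g(y)` below has Galois group over `ℚ` of
order `190080`, the order of the Schur double cover `2.M₁₂` of the Mathieu group `M₁₂`. -/
theorem galois_group_of_lifted_fB_has_card_2_M12 :
    let g : Polynomial ℚ :=
      X ^ 24 - 30 * X ^ 20 + 540 * X ^ 18 + 945 * X ^ 16 - 22500 * X ^ 14
        - 58860 * X ^ 12 + 421200 * X ^ 10 + 1350000 * X ^ 8 - 7970400 * X ^ 6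
        + 11638080 * X ^ 4 - 6480000 * X ^ 2 + 1166400
    Nat.card g.Gal = 190080 := by
  intro g
  have hg : g = monicEval (X ^ 2) fLow := by
    simp [g, monicEval, fLow, listEval]
    ring
  rw [hg, natCard_gal_monicEval_X_sq_fLow]
end

section
/- Let f ∈ ℚ[x] be the polynomial f(x) = x^12 - 6x^10 - 6x^9 - 6x^8 + 126x^7 + 104x^6 - 468x^5 + 258x^4 + 456x^3 - 1062x^2 + 774x - 380. Then the Galois group of f over ℚ is isomorphic to PGL₂(𝔽₁₁); in particular it has cardinality 1320. -/
open Polynomial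

namespace GaloisPGL

open scoped NumberField in
/-- For every prime `q` there is a residue field of characteristic `q` of the ring of integers,
together with a Frobenius element. -/
theorem exists_residue_frobenius (K : Type) [Field K] [NumberField K] [IsGalois ℚ K]
    (q : ℕ) [hq : Fact q.Prime] :
    ∃ (k : Type) (_ : Field k) (_ : CharP k q) (π : 𝓞 K →+* k) (φ : Gal(K/ℚ)),
      ∀ b : 𝓞 K, π (φ • b) = π b ^ q := by
  obtain ⟨Q, hQm, hQ⟩ := Ideal.exists_maximal_ideal_liesOver_of_isIntegral (S := 𝓞 K)
    (Ideal.span {(q : ℤ)})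
  have hqZ : Prime (q : ℤ) := Nat.prime_iff_prime_int.mp hq.out
  have hQ0 : Q ≠ ⊥ := by
    rintro rfl
    have h := hQ.over
    rw [Ideal.under_bot, Ideal.span_singleton_eq_bot] at h
    exact hqZ.ne_zero h
  have hmem : (q : 𝓞 K) ∈ Q := by
    have : (q : ℤ) ∈ Q.under ℤ := by
      rw [← hQ.over]; exact Ideal.mem_span_singleton_self _
    simpa [Ideal.under] using this
  have : Finite (𝓞 K ⧸ Q) := Ideal.finiteQuotientOfFreeOfNeBot Q hQ0
  obtain ⟨φ, hφ⟩ := IsArithFrobAt.exists_of_isInvariant ℤ Gal(K/ℚ) Q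
  let := Ideal.Quotient.field Q
  have hcard : Nat.card (ℤ ⧸ Q.under ℤ) = q := by
    rw [← hQ.over]
    simpa using Nat.card_congr (Int.quotientSpanNatEquivZMod q).toEquiv
  refine ⟨𝓞 K ⧸ Q, inferInstance, ?_, Ideal.Quotient.mk Q, φ, fun b => ?_⟩
  · rw [CharP.charP_iff_prime_eq_zero hq.out]
    simpa using Ideal.Quotient.eq_zero_iff_mem.mpr hmem
  · have := hφ.mk_apply b
    rwa [hcard] at this

open scoped NumberField in
/-- Roots in a residue field lift to roots in the ring of integers of a splitting field. -/
theorem exists_root_lift {K : Type} [Field K] [NumberField K] {k : Type} [Field k] (π : 𝓞 K →+* k)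
    {P : ℤ[X]} (hP : P.Monic) (hs : (P.map (Int.castRingHom K)).Splits) {c : k}
    (hc : aeval c P = 0) : ∃ r : 𝓞 K, aeval r P = 0 ∧ π r = c := by
  have hint : ∀ x ∈ (P.map (Int.castRingHom K)).roots, ∃ b : 𝓞 K, algebraMap (𝓞 K) K b = x := by
    intro x hx
    refine IsIntegralClosure.isIntegral_iff (R := ℤ).mp ⟨P, hP, ?_⟩
    have := (mem_roots'.mp hx).2
    rwa [IsRoot, eval_map] at this
  choose! g hg using hint
  obtain ⟨m, hm⟩ : ∃ m : Multiset (𝓞 K),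
      m.map (algebraMap (𝓞 K) K) = (P.map (Int.castRingHom K)).roots :=
    ⟨(P.map (Int.castRingHom K)).roots.map g, by
      rw [Multiset.map_map]
      exact (Multiset.map_congr rfl hg).trans (Multiset.map_id _)⟩
  have hprod : P.map (Int.castRingHom (𝓞 K)) = (m.map fun r => X - C r).prod := by
    apply map_injective (algebraMap (𝓞 K) K) (FaithfulSMul.algebraMap_injective _ _)
    rw [Polynomial.map_map, Polynomial.map_multiset_prod, Multiset.map_map,
      show (algebraMap (𝓞 K) K).comp (Int.castRingHom (𝓞 K)) = Int.castRingHom K from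
        RingHom.ext_int _ _,
      hs.eq_prod_roots_of_monic (hP.map _), ← hm, Multiset.map_map]
    simp
  have hroot : ∀ r ∈ m, aeval r P = 0 := by
    intro r hr
    have : (P.map (Int.castRingHom (𝓞 K))).eval r = 0 := by
      rw [hprod, eval_multiset_prod, Multiset.prod_eq_zero_iff, Multiset.mem_map]
      exact ⟨X - C r, Multiset.mem_map_of_mem _ hr, by simp⟩
    rwa [eval_map] at this
  have h0 : (m.map fun r => c - π r).prod = 0 := by
    have : ((P.map (Int.castRingHom (𝓞 K))).map π).eval c = 0 := by
      rw [Polynomial.map_map, show π.comp (Int.castRingHom (𝓞 K)) = algebraMap ℤ k from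
        RingHom.ext_int _ _, eval_map]
      exact hc
    rw [hprod, Polynomial.map_multiset_prod, eval_multiset_prod, Multiset.map_map,
      Multiset.map_map] at this
    simpa using this
  obtain ⟨r, hr, hr'⟩ := Multiset.mem_map.mp (Multiset.prod_eq_zero_iff.mp h0)
  exact ⟨r, hroot r hr, (sub_eq_zero.mp hr').symm⟩

/-- Two roots with the same reduction agree if the reduction is a simple root. -/
theorem eq_of_reduction_eq {B k : Type} [CommRing B] [IsDomain B] [Field k] (π : B →+* k)
    {P : ℤ[X]} {r s : B} (hr : aeval r P = 0) (hs : aeval s P = 0) (h : π r = π s)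
    (hd : aeval (π r) (derivative P) ≠ 0) : r = s := by
  by_contra hne
  obtain ⟨P₁, h₁⟩ := dvd_iff_isRoot.mpr (show (P.map (Int.castRingHom B)).IsRoot r by
    rw [IsRoot, eval_map]; exact hr)
  have hs' : (P.map (Int.castRingHom B)).eval s = 0 := by rw [eval_map]; exact hs
  rw [h₁, eval_mul, eval_sub, eval_X, eval_C, mul_eq_zero, sub_eq_zero] at hs'
  obtain ⟨P₂, h₂⟩ := dvd_iff_isRoot.mpr (hs'.resolve_left (Ne.symm hne))
  apply hd
  have h₃ : P.map (algebraMap ℤ k) = (X - C (π r)) * ((X - C (π r)) * P₂.map π) := by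
    rw [show algebraMap ℤ k = π.comp (Int.castRingHom B) from (RingHom.ext_int _ _),
      ← Polynomial.map_map, h₁, h₂]
    simp [h]
  rw [← eval_map_algebraMap, ← derivative_map, h₃]
  simp

/-! ### Computing with integer polynomials as coefficient lists -/

section ListPoly

variable {R S : Type*} [CommRing R] [CommRing S]

/-- The value at `x` of the polynomial with coefficient list `l`, constant coefficient first. -/
def ev (l : List ℤ) (x : R) : R := l.foldr (fun (c : ℤ) (s : R) => (c : R) + x * s) 0

@[simp] theorem ev_nil (x : R) : ev [] x = 0 := rfl

@[simp] theorem ev_cons (c : ℤ) (l : List ℤ) (x : R) : ev (c :: l) x = c + x * ev l x := rfl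

theorem map_ev (g : R →+* S) (l : List ℤ) (x : R) : g (ev l x) = ev l (g x) := by
  induction l with
  | nil => simp
  | cons c l ih => simp [ih]

theorem aeval_ev_X (l : List ℤ) (x : R) : aeval x (ev l (X : ℤ[X])) = ev l x := by
  simpa using map_ev (aeval (R := ℤ) x : ℤ[X] →+* R) l X

/-- Prepend a coefficient, dropping it if it is a leading zero. -/
def consTrim (a : ℤ) : List ℤ → List ℤ
  | [] => if a = 0 then [] else [a]
  | b :: l => a :: b :: l

@[simp] theorem ev_consTrim (a : ℤ) (l : List ℤ) (x : R) :
    ev (consTrim a l) x = a + x * ev l x := by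
  cases l with
  | nil => by_cases h : a = 0 <;> simp [consTrim, h]
  | cons b l => rfl

/-- The coefficient list of `l + k * m`, reduced modulo `q`. -/
def addMul (q k : ℤ) (l m : List ℤ) : List ℤ :=
  match l, m with
  | l, [] => l
  | [], b :: m => consTrim (k * b % q) (addMul q k [] m)
  | a :: l, b :: m => consTrim ((a + k * b) % q) (addMul q k l m)

/-- The coefficient list of `l * m`, reduced modulo `q`. -/
def mulList (q : ℤ) (l m : List ℤ) : List ℤ :=
  match l with
  | [] => []
  | a :: l => addMul q a (0 :: mulList q l m) m

/-- The remainder of `l` modulo the monic polynomial `h` and modulo `q`. -/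
def remList (q : ℤ) (h l : List ℤ) : List ℤ :=
  match l with
  | [] => []
  | c :: l =>
    let r := c :: remList q h l
    addMul q (-r.getD (h.length - 1) 0) r h

/-- The coefficient list of the derivative. -/
def derivList : List ℤ → List ℤ
  | [] => []
  | _ :: l => addMul 0 1 l (0 :: derivList l)

theorem cast_emod {q : ℤ} (hq : (q : R) = 0) (a : ℤ) : ((a % q : ℤ) : R) = a := by
  rw [Int.emod_def]; push_cast; rw [hq]; ring

theorem ev_addMul {q : ℤ} (hq : (q : R) = 0) (k : ℤ) (l m : List ℤ) (x : R) :
    ev (addMul q k l m) x = ev l x + k * ev m x := by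
  induction m generalizing l with
  | nil => cases l <;> simp [addMul]
  | cons b m ih =>
    cases l with
    | nil => simp only [addMul, ev_consTrim, ih, cast_emod hq, ev_cons, ev_nil]; push_cast; ring
    | cons a l => simp only [addMul, ev_consTrim, ih, cast_emod hq, ev_cons]; push_cast; ring

theorem ev_mulList {q : ℤ} (hq : (q : R) = 0) (l m : List ℤ) (x : R) :
    ev (mulList q l m) x = ev l x * ev m x := by
  induction l with
  | nil => simp [mulList]
  | cons a l ih => simp only [mulList, ev_addMul hq, ih, ev_cons]; push_cast; ring

theorem ev_remList {q : ℤ} (hq : (q : R) = 0) {h : List ℤ} {x : R} (hx : ev h x = 0)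
    (l : List ℤ) : ev (remList q h l) x = ev l x := by
  induction l with
  | nil => simp [remList]
  | cons c l ih => simp only [remList, ev_addMul hq, hx, ev_cons, ih, mul_zero, add_zero]

theorem derivative_ev_X (l : List ℤ) :
    derivative (ev l (X : ℤ[X])) = ev (derivList l) X := by
  induction l with
  | nil => simp [derivList]
  | cons c l ih => simp [derivList, ev_addMul, ih]

theorem monic_ev_X (l : List ℤ) : (ev (l ++ [1]) (X : ℤ[X])).Monic := by
  induction l with
  | nil => simp
  | cons c l ih =>
    rw [List.cons_append, ev_cons]
    refine (monic_X.mul ih).add_of_right ?_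
    rw [mul_comm, monic_X.degree_mul, degree_X]
    refine lt_of_le_of_lt (degree_intCast_le c) ?_
    rw [degree_eq_natDegree ih.ne_zero]
    exact_mod_cast Nat.succ_pos _

/-- The value at `(t, x)` of a polynomial in `x` whose coefficients are polynomials in `t`. -/
def ev₂ (L : List (List ℤ)) (t x : R) : R := L.foldr (fun (c : List ℤ) (s : R) => ev c t + x * s) 0

@[simp] theorem ev₂_nil (t x : R) : ev₂ [] t x = 0 := rfl

@[simp] theorem ev₂_cons (c : List ℤ) (L : List (List ℤ)) (t x : R) :
    ev₂ (c :: L) t x = ev c t + x * ev₂ L t x := rfl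

theorem map_ev₂ (g : R →+* S) (L : List (List ℤ)) (t x : R) :
    g (ev₂ L t x) = ev₂ L (g t) (g x) := by
  induction L with
  | nil => simp
  | cons c L ih => simp [ih, map_ev]

/-- The bivariate polynomial `L + k * M`, where `k` is a polynomial in `t`. -/
def addMul₂ (k : List ℤ) (L M : List (List ℤ)) : List (List ℤ) :=
  match L, M with
  | L, [] => L
  | [], b :: M => mulList 0 k b :: addMul₂ k [] M
  | a :: L, b :: M => addMul 0 1 a (mulList 0 k b) :: addMul₂ k L M

/-- The product of bivariate polynomials. -/
def mulList₂ (L M : List (List ℤ)) : List (List ℤ) :=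
  match L with
  | [] => []
  | a :: L => addMul₂ a ([] :: mulList₂ L M) M

theorem ev₂_addMul₂ (k : List ℤ) (L M : List (List ℤ)) (t x : R) :
    ev₂ (addMul₂ k L M) t x = ev₂ L t x + ev k t * ev₂ M t x := by
  induction M generalizing L with
  | nil => cases L <;> simp [addMul₂]
  | cons b M ih =>
    cases L with
    | nil => simp [addMul₂, ih, ev_mulList]; ring
    | cons a L => simp [addMul₂, ih, ev_addMul, ev_mulList]; ring

theorem ev₂_mulList₂ (L M : List (List ℤ)) (t x : R) :
    ev₂ (mulList₂ L M) t x = ev₂ L t x * ev₂ M t x := by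
  induction L with
  | nil => simp [mulList₂]
  | cons a L ih => simp [mulList₂, ev₂_addMul₂, ih]; ring

end ListPoly

/-! ### Verifying polynomial identities by evaluation at a large integer -/

section Kronecker

variable {R : Type*} [CommRing R]

/-- The value at `x` of the polynomial with the absolute values of the coefficients of `l`. -/
def absEv (l : List ℤ) (x : ℕ) : ℕ := l.foldr (fun c s => c.natAbs + x * s) 0

/-- The value at `(t, x)` of the bivariate polynomial whose coefficients are the absolute values of
those of `L`. -/
def absEv₂ (L : List (List ℤ)) (t x : ℕ) : ℕ := L.foldr (fun c s => absEv c t + x * s) 0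

@[simp] theorem absEv_nil (x : ℕ) : absEv [] x = 0 := rfl

@[simp] theorem absEv_cons (c : ℤ) (l : List ℤ) (x : ℕ) :
    absEv (c :: l) x = c.natAbs + x * absEv l x := rfl

@[simp] theorem absEv₂_nil (t x : ℕ) : absEv₂ [] t x = 0 := rfl

@[simp] theorem absEv₂_cons (c : List ℤ) (L : List (List ℤ)) (t x : ℕ) :
    absEv₂ (c :: L) t x = absEv c t + x * absEv₂ L t x := rfl

theorem absEv_consTrim (a : ℤ) (l : List ℤ) (x : ℕ) :
    absEv (consTrim a l) x = a.natAbs + x * absEv l x := by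
  cases l with
  | nil => by_cases h : a = 0 <;> simp [consTrim, h]
  | cons b l => rfl

theorem absEv_addMul (k : ℤ) (l m : List ℤ) (x : ℕ) :
    absEv (addMul 0 k l m) x ≤ absEv l x + k.natAbs * absEv m x := by
  induction m generalizing l with
  | nil => cases l <;> simp [addMul]
  | cons b m ih =>
    cases l with
    | nil =>
      have h := Nat.mul_le_mul_left x (ih [])
      simp only [addMul, absEv_consTrim, Int.emod_zero, absEv_cons, absEv_nil,
        Int.natAbs_mul] at h ⊢
      nlinarith
    | cons a l =>
      have h := Nat.mul_le_mul_left x (ih l)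
      have h' := Int.natAbs_add_le a (k * b)
      simp only [addMul, absEv_consTrim, Int.emod_zero, absEv_cons, Int.natAbs_mul] at h h' ⊢
      nlinarith

theorem absEv_mulList (l m : List ℤ) (x : ℕ) :
    absEv (mulList 0 l m) x ≤ absEv l x * absEv m x := by
  induction l with
  | nil => simp [mulList]
  | cons a l ih =>
    refine (absEv_addMul a _ m x).trans ?_
    have h := Nat.mul_le_mul_left x ih
    simp only [absEv_cons, Int.natAbs_zero]
    nlinarith

theorem absEv₂_addMul₂ (k : List ℤ) (L M : List (List ℤ)) (t x : ℕ) :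
    absEv₂ (addMul₂ k L M) t x ≤ absEv₂ L t x + absEv k t * absEv₂ M t x := by
  induction M generalizing L with
  | nil => cases L <;> simp [addMul₂]
  | cons b M ih =>
    have hb := absEv_mulList k b t
    cases L with
    | nil =>
      have h := Nat.mul_le_mul_left x (ih [])
      simp only [addMul₂, absEv₂_cons, absEv₂_nil] at h ⊢
      nlinarith
    | cons a L =>
      have h := Nat.mul_le_mul_left x (ih L)
      have ha := absEv_addMul 1 a (mulList 0 k b) t
      simp only [addMul₂, absEv₂_cons, Int.natAbs_one] at h ha ⊢
      nlinarith

theorem absEv₂_mulList₂ (L M : List (List ℤ)) (t x : ℕ) :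
    absEv₂ (mulList₂ L M) t x ≤ absEv₂ L t x * absEv₂ M t x := by
  induction L with
  | nil => simp [mulList₂]
  | cons a L ih =>
    refine (absEv₂_addMul₂ a _ M t x).trans ?_
    have h := Nat.mul_le_mul_left x ih
    simp only [absEv₂_cons, absEv_nil]
    nlinarith

theorem natAbs_ev_le (l : List ℤ) (x : ℕ) : (ev l (x : ℤ)).natAbs ≤ absEv l x := by
  induction l with
  | nil => simp
  | cons c l ih =>
    refine (Int.natAbs_add_le _ _).trans ?_
    rw [Int.natAbs_mul, Int.natAbs_natCast, Int.cast_id, absEv_cons]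
    exact Nat.add_le_add_left (Nat.mul_le_mul_left x ih) _

theorem eq_zero_of_add_mul_eq_zero {a b : ℤ} {n : ℕ} (h : a + n * b = 0) (ha : a.natAbs < n) :
    a = 0 ∧ b = 0 := by
  have ha' : a = 0 :=
    Int.eq_zero_of_dvd_of_natAbs_lt_natAbs (d := n) ⟨-b, by linarith⟩ (by simpa using ha)
  subst ha'
  rw [zero_add, mul_eq_zero] at h
  exact ⟨rfl, h.resolve_left (by simp at ha; omega)⟩

theorem ev_eq_zero_of_large {l : List ℤ} {b : ℕ} (h : ev l (b : ℤ) = 0) (hb : absEv l 1 < b)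
    (x : R) : ev l x = 0 := by
  induction l with
  | nil => rfl
  | cons c l ih =>
    rw [absEv_cons, one_mul] at hb
    obtain ⟨hc, hl⟩ := eq_zero_of_add_mul_eq_zero h (by simp only [Int.cast_id]; omega)
    rw [Int.cast_id] at hc
    rw [ev_cons, hc, ih hl (by omega)]
    simp

theorem ev₂_eq_zero_of_large {L : List (List ℤ)} {b c : ℕ} (h : ev₂ L (b : ℤ) (c : ℤ) = 0)
    (hb : absEv₂ L 1 1 < b) (hc : absEv₂ L b 1 < c) (t x : R) : ev₂ L t x = 0 := by
  induction L with
  | nil => rfl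
  | cons l L ih =>
    rw [absEv₂_cons, one_mul] at hb hc
    have hl := natAbs_ev_le l b
    obtain ⟨h₁, h₂⟩ := eq_zero_of_add_mul_eq_zero h (by omega)
    rw [ev₂_cons, ev_eq_zero_of_large h₁ (by omega), ih h₂ (by omega) (by omega)]
    simp

/-- The digits of `n` in base `b`, with digits between `-b / 2` and `b / 2`. -/
def balancedDigits (b : ℤ) : ℕ → ℤ → List ℤ
  | 0, _ => []
  | k + 1, n =>
    let d := (n + b / 2) % b - b / 2
    d :: balancedDigits b k ((n - d) / b)

end Kronecker

/-! ### The polynomial and its sextic factors -/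

/-- The coefficients of the polynomial whose Galois group is computed. -/
def fCoeffs : List ℤ := [-380, 774, -1062, 456, 258, -468, 104, 126, -6, -6, -6, 0, 1]

/-- The coefficients of the minimal polynomial of the square of the sum of the roots in a block of
six roots. There are 55 pairs of complementary blocks. -/
def blockResolvent : List ℤ := [-11545962104894891004369924214429266152056464384,
    249131512508364361035052962338337532374848726016,
    594273483488481730706686696493578986526379218944,
    681590773171507656469864620405890625250767768576,
    19178211695392030235896768500737997991956209664,
    -856628478737889624945889867832555617607805106176,
    -1562810252949745844279608068475364657494189489152,
    -1532062950922480651464073948495763846254400572416,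
    -1045711507326221728760499117135501683880350361600,
    -444471518063708615266995606879561193675940419584,
    -55599316258733510021996113940845460217018310656,
    81490376924458184206529451819826672372800265728,
    77833921729216342373583218170067924856835421184,
    38536236416902683165788740156541023775200727040,
    12709525008802971149524305428770559576350462464, 2573225203160317557977026397409705611643350784,
    158513111437648134887124915350301877383685632, -94095919133854308148237588374362083828650240,
    -47470221398691131609482927401858529865942016, -9044797642916934863363121478263817093614336,
    -720962162984246707520684506045878189811200, 186544507202868564969491683591116869604096,
    43942961451269709617191344048897434280384, 882898862179854395271466406063534203584,
    -1436279211534450492082660198432751451072, -44313666250478789665670426852394759168,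
    25190921554647215382763790316905471808, 123113608745929147451698086595964544,
    -301759843539704251191719348622337472, 10169421004655452822187849258257536,
    1672706598653477948041434688889088, -100948467687362604469423149813696,
    -12657198016171406100724282203264, 1593656001991328219159145903552,
    -17635222048602288507734557440, -7257320507358054144727435488, 317737282966227817460737344,
    23555248593790810479257040, -1459042939983931791000384, -145017784807007277952848,
    19377930350174686026816, -711544149567697664304, -29745127483060563696, 5199386625454432320,
    -335660923723875360, 13792612648752288, -404812315789272, 10336677345120, -387843504792,
    21116230368, -1007709876, 35636556, -902100, 15912, -180, 1]

/-- The even part of the sextic factor of `fCoeffs` attached to a root of `blockResolvent`. -/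
def evenPart : List (List ℤ) := [
    [-9686186178958133545339500711777436450336234942464,
    -50214087731572074884634748253696530806281147059200,
    -119371121727248022108518279782221816875976502433280,
    -213203657868825281251210680424086893912427926272512,
    -284238988561582931974606948531387996376537489951232,
    -292845286942576134410685916381280912689299724380672,
    -237549278392148965520166852882421412447825071729152,
    -141581175607092243810687881421697892802233848806912,
    -57830644026641574044369055503989874754809472587520,
    -6619242501631702637018448941866751060854666178304,
    10260074408498727599458874329386465776777552807424,
    9974965212544227237229166790263576203396225455360,
    5191949911960751873162797806590299915012791154176,
    1890339732775630286520495616538883844045132765824,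
    514581700744260910622936244652577380088348112000,
    104319078715306856286811923415232598464850026496,
    16617938024467573772421191288339058717173536512, 889046303388934645973908937666980686865941504,
    -228342153133141203429214459726424734859113728, -12054625968706769191968816106131126050352768,
    17556534486312047737483387858285251585027456, 5567198531873725664332729539494682232895616,
    -27907789865530907363613300225134673034176, -123090092694114012302283197072096897458368,
    676266705358845294150717870104653975872, 2094041925485982833549181234169213843008,
    -140077413432594637236550150507893779424, -12022803186942130607995694433966501344,
    2183671966654533836467831704582192096, 8803692910811001940473372913052160,
    -25552160369037004850565169095725568, 981533964950287293032670930170544,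
    203553787584838670727148661060592, -25815311398332234718116866824704,
    735158871986726632539311630736, 45877381520534237597086236216, 1067333741523463308252846744,
    -773870059679226064489961688, 53455490289952487878945872, 387273429209522968382328,
    -298875741192229801687056, 23531637107156433734160, -944021935277709117456,
    13413448654206777084, 747004660868562144, -55784271189243192, 1788372503586966, -31001369335680,
    501516461964, -38351663604, 2493366858, -91916208, 2083422, -28149, 178],
    [84916254525088445063984774708491685842855692288,
    -10973919743434103060912368777807469443006927979520,
    -61265435880823065516056997049725587611420794166272,
    -131731954538370744773725218236274895869979526134272,
    -171794315683586831315068221541241597253093034552320,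
    -171772382655644449389633433594569316287545325932544,
    -123545522921192555097768243573198206902135677880320,
    -66372239990116161116757492331250681983746701482752,
    -17767688736674104695209879177492517972591796496640,
    8232162528635965935256709270494405509647688188928,
    13956757414809831764375772898055653411183273933056,
    9957279080790631140466969855703739050528663275776,
    4455263330034832191767880487532750236714378781952,
    1239747072155622239123209649967701781309835019136,
    103817539094177465909026831953280009737788006016,
    -86448181019423535033847368734652775963582427136,
    -44378844780799896682220800589997787937428622592,
    -12428707256370655038811679497779948815605713408,
    -1564486590787064590523951007925197159087335808, -29285604054890503924991292911849368610176128,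
    46379909215134342158909763502815457883716224, 5324450829779777320439452295141142263963328,
    300502268298626132529050227448803456387968, -223398165660016105422056495003583612471552,
    -7488323881711802724214427336909473709088, 3673743526454758752920425661447531446752,
    49985417455050151145985885024526800096, -48470266121603473010629625467844113152,
    2227803969660596702501173541763505632, 160726189264138234348601781530236080,
    -3605698281444705367308447422961456, -3356648160261571013352684899605536,
    306564420581227668694861875682944, 1944062225009232929040850526112,
    -1363184802975309179359845574704, 41335531641791986437693092184, -563883780588671876102470632,
    579446342928378174480311448, -89575999196268292241463840, 6321454291653766472225304,
    -171742252821351426415932, -8864822321679030826320, 1160877762278103610632,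
    -61076065151900576652, 1930611886167144864, -39027909588717804, 995101374025566,
    -72673319681376, 4550354362062, -184642682214, 5044518666, -94771416, 1217751, -9708, 36],
    [9602055741386527424880629567462640440981278000128,
    40899770649093534781352739773039996203814711818752,
    53999210658484926012524257487099192521173677268480,
    41200041447885934857373689821218543904904164712960,
    769653532039670568943324675951655610687908915712,
    -30421779927151974185161204035462369209349583326720,
    -43820410988107644179148442408959490937726831740416,
    -33494618724942512350948318873999038233459012259072,
    -19277288787928233111435968283843504015053596813056,
    -6705417326185944761137924005516858575286060115200,
    -462459969797802517490886657447280780253345038080,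
    1486315887054645695204960599676785708991091452928,
    1361695241820557267792283660524500385283753247488,
    666925655468889341829409266244632557250112470144,
    223951915733149759770920211885333877603815556992,
    38305249620609780763959464555343036664763547648, -857635117549201070005036669228335980080288512,
    -2507741151508021026749127645707788077835688448,
    -1025429218639986831492139910533051260106332096, -159899404531010576374404297550861153826347008,
    -7023911637111786250669386539208783018462528, 4537737873024017008308115897762971779591424,
    726997412689447943500052098118393583178560, 38229865639026474514785833550501569785536,
    -32355033070203557935219624091228261398944, -1001487214500183385248117305090976732000,
    631276621149793810870984810694685761760, 6030631871835451585373832783019008576,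
    -7446559921537768558672753979580508992, 240350108883624163932250331592737712,
    33502216896108371138862064115435184, -1174113216044128291031021440057968,
    -316166492714779065876841388112048, 35045539957255810654685886801840,
    -863803678998540504610886520312, -80899178707202064131628576432, 3708572985572032593607942584,
    325837656655757501688475704, -15277621791469310107125696, -2563457363136010370372832,
    313623786137306684400648, -13716699065212468353696, -92967733347070459824, 51268411291299631812,
    -3752611411930201584, 172331137900451610, -5929843677903612, 169726289437764, -4516645042746,
    118909098450, -2899891008, 58054815, -851121, 7332, -21],
    [-1293215582818475352032249658144444344341897291776,
    -4555251579706575248881111147919160791889207449088,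
    -2826258690945306989024676179219957678643631947264,
    4469863211142129168221467270163503820475745357824,
    15705096007930128614386318760332918559460393191424,
    22787181589974251015896401423458907677093467281408,
    23343672971157056499313628752034332757642740563456,
    18069648717984976449404152394223874054350946457088,
    10360212761030644055519131456917202884190251851520,
    4119199392609025831631662360436225129186495805696,
    738200603087035673567921144064748307282666639616,
    -242043362147235780577291908186407836381434983424,
    -241472709545727139855598437903484420852943728640,
    -69866945597129880256745717227102526729341569024,
    5212123380784324392036842962630700361545875200, 11143894105187802706586257802753503007865772032,
    4022004500935679550963116443514425108451597952, 573898768376826494874864918056120921820893184,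
    -85057718087523862600431706824284209621022208, -35524710320227653245247430173265876911419904,
    -3247554383589567793513052669944782332951424, 1558365095635415906744717185673032569334656,
    152311775082155578425212830654831884723840, 10436204886727295470203764133704802318816,
    -3016768281665321769490317923495636926176, -493619657278919362913097570635733767904,
    27384354901184400249043190010458654688, 9450641805268793635187055511420565568,
    -545625698263562011649791013452414992, -49224306643393584287888655373192512,
    701101289136455306114720908929264, 1114573207817840997906369276563328,
    -86337808677085565268050043779568, -1065404961441153423289117316832,
    423589042245057125032509636384, -8542843443760466177593286784, -1665259154620143321657533712,
    -17129022649959811784298288, 25434117478695383342321952, -2337565611611845219112460,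
    78681682027996182971724, 1972095511244562185940, -344767457379847988712, 18060490124067859308,
    -501029229654437520, 6523422286169040, -170503003645752, 25367533353312, -1920003182748,
    88473192864, -2791726434, 62204286, -939618, 8451, -30],
    [-429880579640483580484985971118207777942993407488,
    -10292191738656728132186550162096587293279190916096,
    -21882564270988334771955979040732858770205959219200,
    -17951498642803903431047241352562012232423436498944,
    12360382782835847603172980420719515315322193246208,
    49546296521542665820680191928370454275090538459136,
    70462173166640866865595950596057474879950054504960,
    61866586997968857125389753575150372723234022416384,
    36574951409886343238080610638432441800438624826368,
    11890824403227303451800782376455271261057178970112,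
    -1438197822685616103320559346385257333419496779264,
    -4594809474589868377992643794158632087047681008640,
    -3176342537437356004497800056761560311654789910016,
    -1343061015124681134761584371295725001485934691328,
    -376340396822675198674214449173233223839135265792,
    -59073133412213461634122523885008602347283926016,
    1707886202792431085261181157761579666279292416, 4351214419072552961728592258813240205505223424,
    1393752561522051221987132081195420376855944448, 206064087351559629991777256971501399073730048,
    864533898443597788534002789562505536637952, -6071492078232566439215987328276217445774976,
    -785978885436360161957388358825191525673632, 89285721435602765105608071790141557219840,
    25585852747569891852206515089637254429216, -1300186887505300954870519241932705413504,
    -375240564850804883993662504609402469280, 23624236334892149035780652071932844032,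
    3189018260380982995557868320933150240, -282746066939333902012171162357365888,
    -11520624988243752134861580678439872, 2426472621800806239302608889277696,
    -12214167011170323538426199114112, -15731423372947176982961680080192,
    947188484782919714527593579360, 38257578513227937161514721728, -5633136782089944229074536208,
    -45666342185949070139269584, 29368945812283271743986480, -1165209363564904099595136,
    -57814547229483332491728, 8728695109839514675824, -477377546043728105256, 13110922178824953600,
    -15867627100244400, -13098963664841904, 364183915389804, 14502755309568, -1746633597324,
    87807790296, -2933118378, 69454488, -1176858, 13248, -75],
    [],
    [249131512508364361035052962338337532374848726016,
    1188546966976963461413373392987157973052758437888,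
    2044772319514522969409593861217671875752303305728,
    76712846781568120943587074002951991967824838656,
    -4283142393689448124729449339162778088039025530880,
    -9376861517698475065677648410852187944965136934912,
    -10724440656457364560248517639470346923780804006912,
    -8365692058609773830083992937084013471042802892800,
    -4000243662573377537402960461916050743083463776256,
    -555993162587335100219961139408454602170183106560,
    896394146169040026271823970018093396100802923008,
    934007060750596108482998618040815098282025054208,
    500971073419734881155253622035033309077609451520,
    177933350123241596093340276002787834068906474496,
    38598378047404763369655395961145584174650261760, 2536209783002370158193998645604830038138970112,
    -1599630625275523238520039002364155425087054080, -854463985176440368970692693233453537586956288,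
    -171851155215421762403899308087012524778672384, -14419243259684934150413690120917563796224000,
    3917434651260239864359325355413454261686016, 966745151927933611578209569075743554168448,
    20306673830136651091243727339461286682432, -34470701076826811809983844762386034825728,
    -1107841656261969741641760671309868979200, 654963960420827599951858548239542267008,
    3324067436140086981195848338091042688, -8449275619111719033368141761425449216,
    294913209135008131843447628489468544, 50181197959604338441243040666672640,
    -3129402498308240738552117644224576, -405030336517484995223177030504448,
    52590648065713831232251814817216, -599597549652477809262974952960,
    -254006217757531895065460242080, 11438542186784201428586544384, 871544197970259987732510480,
    -55443631719389408058014592, -5655693607473283840161072, 775117214006987441072640,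
    -29173310132275604236464, -1249295354288543675232, 223573624894540589760, -14769080643850515840,
    620667569193852960, -18621366526306512, 485823835220640, -18616488230016, 1034695288032,
    -50385493800, 1817464356, -46909200, 843336, -9720, 55]]

/-- The odd part of the sextic factor of `fCoeffs` attached to a root of `blockResolvent`. -/
def oddPart : List (List ℤ) := [
    [-1130098532924839540953060228716218418077631416320,
    -33339936174461899302272062516639094336288771450880,
    -111977013266953810099187804193720319365231660386304,
    -211002780295989294668460222039033238998418816862208,
    -271739037673281011126743219446301730376627160008192,
    -261894283874016606519001611947885071335907268296704,
    -196017237465062900448805910145795812343322010715648,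
    -109084439265709991012207356765319002394542933346304,
    -40316938181900095339364134726376694690390816009984,
    -3324808231329147012457963099177476285074374940160,
    6484174673273041605046817368347391549372619392512,
    4625491989464643163477825402935401371784938449408,
    1228471861836046977825412011074333826297197815296,
    -314133717030851165416729944809535711338478923520,
    -457237921207672844817158729292836219530721374464,
    -244032871561565935118256676602016495501419675648,
    -82786289091894418693236377730110512891858000512,
    -21508156184454057288389449930582137391173309696,
    -3085204183325297940135732569342034611766242688, -91154046106866878932804407463219877364513408,
    109799132468882568506672761366581350721281472, 22198806491765688349595164392345177562037376,
    348060975015793301978322827819649038554368, -533282088335222571765028534499796715882752,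
    -43810939023795777580794108189500345664768, 9856202928998898771519887864592143071488,
    715961355721314759209642159927110687008, -162864190288014164103281197295565668064,
    -3153022027509585186415628815556996064, 1509519958604937936872180255175455328,
    -17596959497472592551710236679456640, -12811740046196979026415526172116656,
    749897014149519813151874262285696, 35805106629362863139361545919312,
    -5764534950342824939138749297872, 94957553263945201483590704064, 25009746078724022498758306080,
    -1439789323856094841027916592, -46311782257572680566600512, 4938184612641359987321712,
    325043040902556521214816, -67150963860454868698656, 5123715292301113465452,
    -250111667061720724584, 8705400344306353968, -231924974339895108, 5855157790735968,
    -213114902592972, 10353280162746, -463470895320, 16498300230, -436796532, 8155290, -95535, 525],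
    [2046708710823783238597517819882512482849265035264,
    -34797703645644595067917370444899826898208664810496,
    -71642271176919150540145507878207009241901392594944,
    -127284263909538970087290408510415594704925742807040,
    -115152461439336626812363235476652787318959814915072,
    -86811237720720006272763421442605144718077020750336,
    -23340047967204878412014497601680195613936553392640,
    10457245233970585813267329732941625085463444983296,
    24136389260994513038188826279099616052687257277440,
    18694582581297704359299752598252024502755529592832,
    10704801399075898384908913422119994052293591739392,
    5329911074624752029541048251492815298401620169472,
    2637124345129479303988241686635168212012629776384,
    1378524942578542321167418145747719473858508005504,
    634332584951839039234060510676328025735087053312,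
    231291913115818487835934108568282349097313621760,
    62588348212504809715402823087961036171375508608,
    10688701459736229121940093691199277546449304064, 680341063205473760714447950990073782857069696,
    -145083941594116066928698453536281289222742656, -51130624290747585913841383070738663673284352,
    -2099386616661109698721244752339508264707968, 967265169076897112736039725519862760057728,
    203898014295314277275983377174408721113600, 30063148087332306793201543625621086656864,
    -8848745488280676626453602424586669556032, -606094492361067018443716920706748762976,
    189760714952407212550273094826900835872, 4295401447298641206776546852392150368,
    -2223149373376859426726645990809687296, 46819026228950775945879521449917024,
    12390444582877347983550266305266960, -436142660765877006505635974254704,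
    -100193352572518390056608442887328, 10937521369021026107025023190528,
    -206244515177467351567538015304, -27688472455232107564191847944, 482887903541182748584970280,
    180624922226258839617456072, -8582934543382139365394856, -734005377346985893114656,
    108890112843257725827864, -6211858724439248338236, 157380557612172812160, 3201252163743311064,
    -499036722419100384, 25547110675948542, -853830507235590, 21768561363384, -503369508990,
    12474262854, -310430484, 6238092, -83733, 555],
    [1013187045297702120253468794565820874687521203200,
    8954863902875299963231229289424047757789303375872,
    1009691406039665995321645333217194846216364906496,
    -1391014635678250073632966889356192180393898314752,
    7244259750319128953994616878091858100025766215168,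
    30573208933981078014576672209918696455573261040640,
    38642210213250923466090647624986217508808278018048,
    27521921642326441653893185833958079963245024118784,
    6463257845236905150917166683564938470256342730496,
    -9483600546248732111819135334374490581783575587072,
    -13051237416941387087759739076174501344410731077888,
    -9685083772359343035751564157743446150175840641024,
    -4653861766584669174663720246347429673816454093056,
    -1618324771006548260984686977307377765687523238784,
    -367023202721206171268058184059866769324445502208,
    -29784992971254776289790771556856585589006500864,
    12822204696089168184955843925999201951806472448, 8813440858098007811292355801650718553257166976,
    1810430645626286987093517525544524211429614912, 68980227141552952649989024168100904966782976,
    -71342425751039439187374237632772072067452864, -15068405994553626098459229371953929749544000,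
    1027212009410375776335140843198172601553856, 568502403784655772702099666029226812545536,
    7763001174897499636598833868644443654624, -12081916519229975519745230428292689323360,
    14632487206292602312475398269036999456, 159958903035871019941503006513023680608,
    -4532137384203431881266220369171171680, -1140936369983397371708299385972826528,
    72163549774602986417487977737400640, 6486720271516029360013216010859504,
    -851470470818438512590081672040176, 6328777856724375411471914928528,
    5013569004971407439784361574064, -204366896660161152859734701400,
    -24727058771554867983811745976, 1740155821131612232026999048, 70292655657371346344471784,
    -10689439008699776079203904, 166222599673492780274940, 47738109537141371673756,
    -5494345409044020880260, 349765725892177394868, -15774622345462299036, 560671278272822376,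
    -17760735551377254, 616226483625558, -25917073663752, 1087487662296, -37092533586, 927280791,
    -15885552, 169272, -837],
    [-1529931034446897437785792388124038742156783396864,
    41148096019229145064711095040496657324286427577856,
    89252740004121229376477819508409068660960868694016,
    100950264026163120214868608776796964528835929057280,
    10138663944181961299240857132922204707126243612672,
    -97489460627194968544522725053511544394543930287104,
    -177150971094637050424224904107115679524082207695872,
    -162774685472245530491612184086680217526316830082560,
    -102660374360292930969717694926415196517056700890112,
    -37976669635175025209436980158670057204930461378560,
    -1724502666287274527871236466330209582773412450304,
    8309492811896707171504122013300986675092167220736,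
    6366157263350243359617685045698118103944841660160,
    2611073874920169163323960267752097939077303010048,
    671140232915873440884023043160886800111997046528,
    69871554455054031948472325035091877328095036672,
    -18874927747269347752891986202964503486928821248,
    -10158381114722765335627768748505932172440909568,
    -2755098108534717786643740948745931062546816128, -270622396503737981484467887681708360400022528,
    26022354811317925174010556920280546698073984, 16648355925797726805191350168645647575034624,
    1217625754203270017682136052786516476385280, -229246979411548087674062693554563588091872,
    -75836325695440166113197242159065192209984, 5410762547385660072511037296297212129888,
    1360038997376337474546300716843765586624, -107197307340193356110390419782516377856,
    -12484252496490818216011735395987637248, 1572872086757142734045483497938123936,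
    16065661000351629438458460919257024, -9161451288107687236215207405887328,
    20246438470035880241718083263968, 85203291961427416072006079337888,
    -6210305198184351494236867284960, -59781811295772153306574307088, 27846723672856543667025213216,
    -571285762773263923660805184, -91537198409366792963985432, 3170154631259533825099896,
    492022523434124120633256, -53887876259548194396888, 2138348292861388240392,
    16028775280849441104, -6977140974840480816, 453092763194783496, -17491331071238052,
    435710301809556, -5577595742760, -54151404528, 4614321228, -113497332, 1422846, -9378, 36],
    [-545821045293382268927090771129431747217351113728,
    -989610678775684864640990968957686872730932135424,
    3308058267598261919204105404433057948613277969920,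
    4700001751486833531052228492172359796379219873792,
    2855668826861784240197970742844584295343316598784,
    -5343402963121174181136543809097656157801943523328,
    -8829648998215037181431924166376708013699671457280,
    -7027427457844345040847826417028166358777462221312,
    -1640518226689488556689749928830949345060139477248,
    2451219904847020530971778942210861322675946486016,
    3427383041594155752383393054119028495585075408640,
    2559977820104552544871703945936037458464640179200,
    1261440510713477503610162428201615506379884625920,
    463933104772594908023275110781260975477377854464,
    121007257522998614501003030846067452885496660480,
    18752523454194913181168253739567993122282682368, -776887374890890164597000563578041166809564288,
    -1989493187152494612037213161644239690939975680, -600611183733789149812129631085321783957039360,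
    -78782440099282455696488500536018568300091904, 8504749570191151799564923396295580452106624,
    4458600551419216741479345892900263231840000, 213231796572565531698944012673215744771136,
    -92975898343753139959747770153453302158368, -6340293250451230994415599937425243863776,
    1471272223983563436942478074082893033120, 37356557209604661192630735024731782752,
    -15897185052066363464917369772855782080, 339113929141462383880551872015990640,
    101319287235419431035840466626825408, -8687106205788266909541632023744464,
    -100517801734613987763161814950016, 71434135520055928428705400672080,
    -2864197610398586851078042175712, -338429611027538560163871089856,
    25772783116592138108166346368, 949373439290636641539997728, -183459917808128035958342064,
    8467036656275531821838736, -12213969590882895894540, -8838248368830629737668,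
    -1775790551621068839756, 325953417303773780568, -26246751807483688212, 1360973477927121360,
    -49340677292750496, 1286968502016168, -30481931336736, 1184082681348, -62683288536, 2660666634,
    -78523314, 1590390, -20709, 135],
    [635027915769219005240345831793609638363105541120,
    -13453101675451675495892859966270226748241831204864,
    -31496494624889531727454394914159686285898098604032,
    -35442720204918398136432960261106312513039923965952,
    -978088796464993542030735193537637897589766692864,
    42831423936894481247294493391627780880390255308800,
    76577702394537546369700795355292868217215284968448,
    73539021644279071270275549527796664620211227475968,
    49148440844332421251743458505368579142376466995200,
    20445689830930596302281797916459814909093259300864,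
    2501969231643007950989825127338045709765823979520,
    -3585576584676160105087295880072373584403211692032,
    -3346858634356302722064078381312920768843923110912,
    -1618521929509912692963127086574722998558430535680,
    -521090525360921817130496522579592942630368961024,
    -102929008126412702319081055896388224465734031360,
    -6182011346068277260597871698661773217963739648, 3575644927086463709633028358225759185488709120,
    1756398191751571869550868313868765605039854592, 325612715145009655081072373217497415370116096,
    25233675704448634763223957711605736643392000, -6342513244897531208962717242097973566539264,
    -1450117727891900417367314353613615331252672, -28252763589755340648686924994033094514688,
    44524655557567965254562466151415294983232, 1329409987514363689970112805571842775040,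
    -730536725084769246100149919190258682432, -3447181044886016128647546424687007232,
    8147515775572014782176422412803111744, -264404946121041773376884080714695936,
    -41817664966336948701035867222227200, 2422763224496702507266155595528704,
    291115554371942340316658490675072, -35060432043809220821501209878144,
    370339663020648058662425706240, 145146410147161082894548709760, -6037008376358328531754009536,
    -423994474688234588626626720, 24803729979726840447006528, 2320284556912116447245568,
    -290668955252620290402240, 9961618093947767300256, 386686657279787328048, -62392639505453187840,
    3692270160962628960, -137926126487522880, 3643310842103448, -82693418760960, 2714904533544,
    -126697382208, 5038549380, -142546224, 2706300, -31824, 180]]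

/-- The defect in the norm equation expressing `fCoeffs` as a difference of two squares up to a
factor. -/
def normDefect : List (List ℤ) :=
  addMul₂ [0, -1] (addMul₂ [-1] (mulList₂ [[0, 1]] (mulList₂ evenPart evenPart))
      (mulList₂ oddPart oddPart))
    (mulList₂ (mulList₂ [derivList blockResolvent] [derivList blockResolvent])
      (fCoeffs.map fun c => [c]))

/-- The value at `(t, x)` of the polynomial `normDefect`. -/
def normDefectEv (t x : ℤ) : ℤ :=
  ev₂ [[0, 1]] t x * (ev₂ evenPart t x * ev₂ evenPart t x)
    + ev [-1] t * (ev₂ oddPart t x * ev₂ oddPart t x)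
    + ev [0, -1] t * (ev₂ [derivList blockResolvent] t x * ev₂ [derivList blockResolvent] t x
      * ev₂ (fCoeffs.map fun c => [c]) t x)

/-- The negative of the quotient of `normDefect` by `blockResolvent`. -/
def normQuotient : List (List ℤ) :=
  (balancedDigits (2 ^ 50000) 13
    (-normDefectEv (2 ^ 400) (2 ^ 50000) / ev blockResolvent (2 ^ 400))).map
      (balancedDigits (2 ^ 400) 60)

/-- A bound for the value at `(t, x)` of the polynomial with the absolute values of the coefficients
of `normDefect + normQuotient * blockResolvent`. -/
def normDefectBound (t x : ℕ) : ℕ :=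
  absEv₂ [[0, 1]] t x * (absEv₂ evenPart t x * absEv₂ evenPart t x)
    + absEv [-1] t * (absEv₂ oddPart t x * absEv₂ oddPart t x)
    + absEv [0, -1] t * (absEv₂ [derivList blockResolvent] t x
      * absEv₂ [derivList blockResolvent] t x * absEv₂ (fCoeffs.map fun c => [c]) t x)
    + absEv blockResolvent t * absEv₂ normQuotient t x

theorem normDefectEv_add :
    normDefectEv (2 ^ 400) (2 ^ 50000)
      + ev blockResolvent (2 ^ 400) * ev₂ normQuotient (2 ^ 400) (2 ^ 50000) = 0 := by
  decide +kernel

theorem normDefectBound_lt :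
    normDefectBound 1 1 < 2 ^ 400 ∧ normDefectBound (2 ^ 400) 1 < 2 ^ 50000 := by
  decide +kernel

theorem absEv₂_normDefect (t x : ℕ) :
    absEv₂ (addMul₂ blockResolvent normDefect normQuotient) t x ≤ normDefectBound t x := by
  refine (absEv₂_addMul₂ _ _ _ t x).trans (Nat.add_le_add_right ?_ _)
  refine (absEv₂_addMul₂ _ _ _ t x).trans (Nat.add_le_add ?_ (Nat.mul_le_mul_left _ ?_))
  · refine (absEv₂_addMul₂ _ _ _ t x).trans (Nat.add_le_add ?_ (Nat.mul_le_mul_left _ ?_))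
    · exact (absEv₂_mulList₂ _ _ t x).trans (Nat.mul_le_mul_left _ (absEv₂_mulList₂ _ _ t x))
    · exact absEv₂_mulList₂ _ _ t x
  · exact (absEv₂_mulList₂ _ _ t x).trans (Nat.mul_le_mul_right _ (absEv₂_mulList₂ _ _ t x))

theorem ev₂_normDefect {R : Type*} [CommRing R] {t : R} (ht : ev blockResolvent t = 0) (x : R) :
    ev₂ normDefect t x = 0 := by
  have h : ev₂ (addMul₂ blockResolvent normDefect normQuotient) t x = 0 := by
    refine ev₂_eq_zero_of_large (b := 2 ^ 400) (c := 2 ^ 50000) ?_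
      ((absEv₂_normDefect _ _).trans_lt normDefectBound_lt.1)
      ((absEv₂_normDefect _ _).trans_lt normDefectBound_lt.2) t x
    rw [ev₂_addMul₂]
    simp only [normDefect, ev₂_addMul₂, ev₂_mulList₂, Nat.cast_pow, Nat.cast_ofNat]
    exact normDefectEv_add
  simpa only [ev₂_addMul₂, ht, zero_mul, add_zero] using h

theorem ev₂_cast_coeffs {R : Type*} [CommRing R] (l : List ℤ) (t x : R) :
    ev₂ (l.map fun c => [c]) t x = ev l x := by
  induction l with
  | nil => rfl
  | cons c l ih => simp [ih]

theorem mul_sq_evenPart {R : Type*} [CommRing R] {s r : R} (hs : ev blockResolvent (s ^ 2) = 0)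
    (hr : ev fCoeffs r = 0) :
    (s * ev₂ evenPart (s ^ 2) r - ev₂ oddPart (s ^ 2) r)
      * (s * ev₂ evenPart (s ^ 2) r + ev₂ oddPart (s ^ 2) r) = 0 := by
  have h := ev₂_normDefect hs r
  simp only [normDefect, ev₂_addMul₂, ev₂_mulList₂, ev₂_cast_coeffs, hr] at h
  simp only [ev₂_cons, ev₂_nil, ev_cons, ev_nil] at h
  push_cast at h
  linear_combination h

/-! ### Frobenius elements -/

section Reduction

variable {R : Type*} [CommRing R]

/-- The coefficient list, reduced modulo `q`, of the monic polynomial with the given roots. -/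
def prodLin (q : ℤ) (a : List ℤ) : List ℤ := a.foldr (fun c l => mulList q [-c, 1] l) [1]

theorem ev_prodLin {q : ℤ} (hq : (q : R) = 0) (a : List ℤ) (x : R) :
    ev (prodLin q a) x = (a.map fun c : ℤ => x - c).prod := by
  induction a with
  | nil => simp [prodLin]
  | cons c a ih =>
    rw [List.map_cons, List.prod_cons, ← ih]
    simp only [prodLin, List.foldr_cons, ev_mulList hq, ev_cons, ev_nil]
    push_cast
    ring

theorem ev_congr {q : ℤ} (hq : (q : R) = 0) {l m : List ℤ} (h : addMul q (-1) l m = []) (x : R) :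
    ev l x = ev m x := by
  have := ev_addMul hq (-1) l m x
  rw [h, ev_nil] at this
  push_cast at this
  linear_combination -this

theorem ev_ne_zero [Nontrivial R] {q : ℤ} (hq : (q : R) = 0) {h u l : List ℤ}
    (hu : remList q h (mulList q u l) = [1]) {x : R} (hx : ev h x = 0) : ev l x ≠ 0 := by
  intro hl
  have := ev_remList hq hx (mulList q u l)
  rw [hu, ev_mulList hq, hl] at this
  simp at this

theorem intCast_ne_zero {q : ℕ} [CharP R q] {a : ℤ} (h : a % q ≠ 0) : (a : R) ≠ 0 := by
  rwa [Ne, CharP.intCast_eq_zero_iff R q, Int.dvd_iff_emod_eq_zero]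

theorem intCast_char_eq_zero (q : ℕ) [CharP R q] : ((q : ℤ) : R) = 0 := by simp

/-- The coefficient list of `l ^ n` modulo `h` and `q`, where `n < 2 ^ k`. -/
def powList (q : ℤ) (h l : List ℤ) : ℕ → ℕ → List ℤ
  | 0, _ => [1]
  | k + 1, n =>
    let s := powList q h l k (n / 2)
    let s := remList q h (mulList q s s)
    if n % 2 = 0 then s else remList q h (mulList q l s)

theorem ev_powList {q : ℤ} (hq : (q : R) = 0) {h : List ℤ} {x : R} (hx : ev h x = 0) (l : List ℤ)
    {k n : ℕ} (hn : n < 2 ^ k) : ev (powList q h l k n) x = ev l x ^ n := by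
  induction k generalizing n with
  | zero => obtain rfl : n = 0 := by omega
            simp [powList]
  | succ k ih =>
    have h2 : n / 2 < 2 ^ k := by omega
    have h3 : n = 2 * (n / 2) + n % 2 := by omega
    conv_rhs => rw [h3, pow_add, pow_mul']
    simp only [powList]
    split_ifs with h0
    · rw [ev_remList hq hx, ev_mulList hq, ih h2, h0]
      ring
    · rw [ev_remList hq hx, ev_mulList hq, ev_remList hq hx, ev_mulList hq, ih h2,
        Nat.mod_two_ne_zero.mp h0]
      ring

/-- The coefficient list of `X ^ q ^ n` modulo `h` and `q`. -/
def frobList (q : ℕ) (h : List ℤ) : ℕ → List ℤ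
  | 0 => [0, 1]
  | n + 1 => powList q h (frobList q h n) 5 q

theorem ev_frobList {q : ℕ} (hq : ((q : ℤ) : R) = 0) (hq' : q < 2 ^ 5) {h : List ℤ} {x : R}
    (hx : ev h x = 0) (n : ℕ) : ev (frobList q h n) x = x ^ q ^ n := by
  induction n with
  | zero => simp [frobList]
  | succ n ih => rw [frobList, ev_powList hq hx _ hq', ih, ← pow_mul, ← pow_succ]

theorem pow_frob_ne [Nontrivial R] {q : ℕ} (hq : ((q : ℤ) : R) = 0) (hq' : q < 2 ^ 5)
    {h u : List ℤ} {n : ℕ}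
    (hu : remList q h (mulList q u (addMul q (-1) (frobList q h n) [0, 1])) = [1])
    {x : R} (hx : ev h x = 0) : x ^ q ^ n ≠ x := by
  have := ev_ne_zero hq hu hx
  rw [ev_addMul hq, ev_frobList hq hq' hx] at this
  intro h'
  simp [h'] at this

end Reduction

section NumberField

open scoped NumberField

variable (K : Type) [Field K] [NumberField K]

/-- The roots, in the ring of integers of `K`, of the polynomial with coefficients `fCoeffs`. -/
abbrev IntegralRoot : Type := {r : 𝓞 K // ev fCoeffs r = 0}

variable {K}

theorem exists_reduction [IsGalois ℚ K]
    (hs : ((ev fCoeffs (X : ℤ[X])).map (Int.castRingHom K)).Splits)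
    (q : ℕ) [Fact q.Prime] {a h : List ℤ}
    (hf : addMul q (-1) fCoeffs (mulList q (prodLin q a) h) = [])
    (ha : ∀ c ∈ a, ev (derivList fCoeffs) c % q ≠ 0)
    (hh : ∀ (k : Type) [Field k] [CharP k q] (x : k), ev h x = 0 →
      ev (derivList fCoeffs) x ≠ 0) :
    ∃ (k : Type) (_ : Field k) (_ : CharP k q) (π : 𝓞 K →+* k) (φ : Gal(K/ℚ)),
      (∀ b : 𝓞 K, π (φ • b) = π b ^ q) ∧
      (∀ r s : IntegralRoot K, π r = π s → r = s) ∧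
      (∀ r : IntegralRoot K, (∃ c ∈ a, π r = c) ∨ ev h (π r) = 0) ∧
      ∀ c ∈ a, ∃ r : IntegralRoot K, π r = c := by
  obtain ⟨k, _, _, π, φ, hφ⟩ := exists_residue_frobenius K q
  have hq : ((q : ℤ) : k) = 0 := intCast_char_eq_zero q
  have key (x : k) : ev fCoeffs x = (a.map fun c : ℤ => x - c).prod * ev h x := by
    rw [ev_congr hq hf, ev_mulList hq, ev_prodLin hq]
  have hroot (r : IntegralRoot K) : (∃ c ∈ a, π r = c) ∨ ev h (π r) = 0 := by
    have := map_ev π fCoeffs r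
    rw [r.2, map_zero, key, eq_comm, mul_eq_zero, List.prod_eq_zero_iff, List.mem_map] at this
    refine this.imp_left ?_
    rintro ⟨c, hc, h⟩
    exact ⟨c, hc, sub_eq_zero.mp h⟩
  refine ⟨k, inferInstance, inferInstance, π, φ, hφ, fun r s hrs => ?_, hroot, fun c hc => ?_⟩
  · refine Subtype.ext (eq_of_reduction_eq π (P := ev fCoeffs X) ?_ ?_ hrs ?_)
    · rw [aeval_ev_X]; exact r.2
    · rw [aeval_ev_X]; exact s.2
    · rw [derivative_ev_X, aeval_ev_X]
      rcases hroot r with ⟨c, hc, h⟩ | h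
      · rw [h, ← eq_intCast (Int.castRingHom k), ← map_ev]
        exact intCast_ne_zero (q := q) (ha c hc)
      · exact hh k _ h
  · obtain ⟨r, hr, hr'⟩ := exists_root_lift π (P := ev fCoeffs X) (c := (c : k))
      (monic_ev_X [-380, 774, -1062, 456, 258, -468, 104, 126, -6, -6, -6, 0]) hs (by
        rw [aeval_ev_X, key, mul_eq_zero]
        exact Or.inl (List.prod_eq_zero_iff.mpr (List.mem_map.mpr ⟨c, hc, sub_self _⟩)))
    exact ⟨⟨r, by rwa [aeval_ev_X] at hr⟩, hr'⟩

instance : MulAction Gal(K/ℚ) (IntegralRoot K) where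
  smul σ r := ⟨σ • r.1, by
    rw [← MulSemiringAction.toRingHom_apply, ← map_ev, r.2, map_zero]⟩
  one_smul r := Subtype.ext (one_smul _ _)
  mul_smul σ τ r := Subtype.ext (mul_smul σ τ r.1)

theorem coe_smul_root (σ : Gal(K/ℚ)) (r : IntegralRoot K) : ((σ • r : IntegralRoot K) : 𝓞 K) =
    σ • (r : 𝓞 K) := rfl

theorem reduction_pow_smul {k : Type} [Field k] {q : ℕ} {π : 𝓞 K →+* k} {φ : Gal(K/ℚ)}
    (hφ : ∀ b : 𝓞 K, π (φ • b) = π b ^ q) (n : ℕ) (b : 𝓞 K) : π (φ ^ n • b) = π b ^ q ^ n := by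
  induction n with
  | zero => simp
  | succ n ih => rw [pow_succ', mul_smul, hφ, ih, ← pow_mul, ← pow_succ]

theorem exists_frobenius_five [IsGalois ℚ K]
    (hs : ((ev fCoeffs (X : ℤ[X])).map (Int.castRingHom K)).Splits) :
    ∃ (τ : Gal(K/ℚ)) (r₀ : IntegralRoot K), τ • r₀ = r₀ ∧
      ∀ r ≠ r₀, Function.minimalPeriod (τ • ·) r = 11 := by
  have : Fact (Nat.Prime 5) := ⟨by norm_num⟩
  obtain ⟨k, _, _, π, τ, hτ, hinj, hroot, hlift⟩ := exists_reduction hs 5 (a := [0])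
    (h := [4, 3, 1, 3, 2, 4, 1, 4, 4, 4, 0, 1]) (by decide +kernel) (by decide +kernel)
    (fun k _ _ x hx => ev_ne_zero (intCast_char_eq_zero 5)
      (u := [3, 3, 4, 1, 4, 4, 0, 1, 3, 2, 4]) (by decide +kernel) hx)
  obtain ⟨r₀, hr₀⟩ := hlift 0 (by simp)
  have hq : (((5 : ℕ) : ℤ) : k) = 0 := intCast_char_eq_zero 5
  refine ⟨τ, r₀, hinj _ _ ?_, fun r hr => ?_⟩
  · rw [coe_smul_root, hτ, hr₀]; simp
  have h : ev [4, 3, 1, 3, 2, 4, 1, 4, 4, 4, 0, 1] (π r) = 0 := by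
    refine (hroot r).resolve_left ?_
    simp only [List.mem_singleton, exists_eq_left]
    exact fun h => hr (hinj _ _ (h.trans hr₀.symm))
  have : Fact (Nat.Prime 11) := ⟨by norm_num⟩
  refine Function.minimalPeriod_eq_prime ?_ ?_
  · rw [Function.IsPeriodicPt, Function.IsFixedPt, smul_iterate]
    refine hinj _ _ ?_
    rw [coe_smul_root, reduction_pow_smul hτ, ← ev_frobList hq (by norm_num) h,
      show frobList 5 _ 11 = [0, 1] by decide +kernel]
    simp
  · intro h'
    have := congrArg (fun r : IntegralRoot K => π r) (h' : τ • r = r)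
    simp only [coe_smul_root, hτ] at this
    exact pow_frob_ne hq (by norm_num) (u := [4, 4, 3, 2, 0, 1, 4, 2, 2, 1, 4]) (n := 1)
      (by decide +kernel) h (by simpa using this)

theorem exists_frobenius_nineteen [IsGalois ℚ K]
    (hs : ((ev fCoeffs (X : ℤ[X])).map (Int.castRingHom K)).Splits) :
    ∃ (ρ : Gal(K/ℚ)) (r₁ r₂ : IntegralRoot K), r₁ ≠ r₂ ∧ ρ • r₁ = r₁ ∧ ρ • r₂ = r₂ ∧
      ∀ r, r ≠ r₁ → r ≠ r₂ → Function.minimalPeriod (ρ • ·) r = 10 := by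
  have : Fact (Nat.Prime 19) := ⟨by norm_num⟩
  obtain ⟨k, _, _, π, ρ, hρ, hinj, hroot, hlift⟩ := exists_reduction hs 19 (a := [0, 1])
    (h := [5, 3, 3, 11, 4, 14, 2, 8, 14, 1, 1]) (by decide +kernel) (by decide +kernel)
    (fun k _ _ x hx => ev_ne_zero (intCast_char_eq_zero 19)
      (u := [8, 4, 13, 16, 3, 9, 10, 18, 2, 15]) (by decide +kernel) hx)
  obtain ⟨r₁, hr₁⟩ := hlift 0 (by simp)
  obtain ⟨r₂, hr₂⟩ := hlift 1 (by simp)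
  have hq : (((19 : ℕ) : ℤ) : k) = 0 := intCast_char_eq_zero 19
  refine ⟨ρ, r₁, r₂, ?_, hinj _ _ ?_, hinj _ _ ?_, fun r h₁ h₂ => ?_⟩
  · rintro rfl
    simp [hr₁] at hr₂
  · rw [coe_smul_root, hρ, hr₁]; simp
  · rw [coe_smul_root, hρ, hr₂]; simp
  have h : ev [5, 3, 3, 11, 4, 14, 2, 8, 14, 1, 1] (π r) = 0 := by
    refine (hroot r).resolve_left ?_
    rintro ⟨c, hc, h⟩
    rcases List.mem_pair.mp hc with rfl | rfl
    · exact h₁ (hinj _ _ (h.trans hr₁.symm))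
    · exact h₂ (hinj _ _ (h.trans hr₂.symm))
  have hper (n : ℕ) (h' : Function.IsPeriodicPt (ρ • ·) n r) : π r ^ 19 ^ n = π r := by
    rw [Function.IsPeriodicPt, Function.IsFixedPt, smul_iterate] at h'
    rw [← reduction_pow_smul hρ, ← coe_smul_root]
    exact congrArg (fun r : IntegralRoot K => π r) h'
  have hdvd : Function.minimalPeriod (ρ • ·) r ∣ 10 := by
    rw [← Function.isPeriodicPt_iff_minimalPeriod_dvd, Function.IsPeriodicPt,
      Function.IsFixedPt, smul_iterate]
    refine hinj _ _ ?_
    rw [coe_smul_root, reduction_pow_smul hρ, ← ev_frobList hq (by norm_num) h,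
      show frobList 19 _ 10 = [0, 1] by decide +kernel]
    simp
  have h2 : ¬ Function.minimalPeriod (ρ • ·) r ∣ 2 := fun h' =>
    pow_frob_ne hq (by norm_num) (u := [14, 17, 7, 10, 13, 1, 11, 14, 18, 1]) (n := 2)
      (by decide +kernel) h (hper 2 (Function.isPeriodicPt_iff_minimalPeriod_dvd.mpr h'))
  have h5 : ¬ Function.minimalPeriod (ρ • ·) r ∣ 5 := fun h' =>
    pow_frob_ne hq (by norm_num) (u := [10, 4, 15, 1, 6, 5, 16, 8, 15, 16]) (n := 5)
      (by decide +kernel) h (hper 5 (Function.isPeriodicPt_iff_minimalPeriod_dvd.mpr h'))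
  have hmem : Function.minimalPeriod (ρ • ·) r ∈ Nat.divisors 10 := by simpa using hdvd
  rw [show Nat.divisors 10 = {1, 2, 5, 10} by decide] at hmem
  simp only [Finset.mem_insert, Finset.mem_singleton] at hmem
  rcases hmem with h' | h' | h' | h'
  · simp [h'] at h2
  · simp [h'] at h2
  · simp [h'] at h5
  · exact h'

theorem exists_frobenius_seven [IsGalois ℚ K]
    (hs : ((ev fCoeffs (X : ℤ[X])).map (Int.castRingHom K)).Splits) :
    ∃ μ : Gal(K/ℚ), ∀ r : IntegralRoot K, μ • r ≠ r := by
  have : Fact (Nat.Prime 7) := ⟨by norm_num⟩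
  obtain ⟨k, _, _, π, μ, hμ, -, hroot, -⟩ := exists_reduction hs 7 (a := [])
    (h := [5, 4, 2, 1, 6, 1, 6, 0, 1, 1, 1, 0, 1]) (by decide +kernel) (by simp)
    (fun k _ _ x hx => ev_ne_zero (intCast_char_eq_zero 7)
      (u := [1, 3, 0, 5, 1, 4, 4, 2, 6, 2, 0, 6]) (by decide +kernel) hx)
  refine ⟨μ, fun r h' => ?_⟩
  have := congrArg (fun r : IntegralRoot K => π r) h'
  simp only [coe_smul_root, hμ] at this
  exact pow_frob_ne (intCast_char_eq_zero 7) (by norm_num)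
    (u := [6, 0, 0, 0, 6, 6, 2, 3, 5, 4, 1, 2]) (n := 1) (by decide +kernel)
    ((hroot r).resolve_left (by simp)) (by simpa using this)

end NumberField

/-! ### Triple transitivity -/

section Transitivity

variable {G Y : Type*} [Group G] [MulAction G Y]

theorem exists_pow_smul_eq {g : G} {n : ℕ} {S : Finset Y} (hS : S.card ≤ n)
    (hg : ∀ x ∈ S, g • x ∈ S) (hn : ∀ x ∈ S, Function.minimalPeriod (g • ·) x = n)
    {x y : Y} (hx : x ∈ S) (hy : y ∈ S) : ∃ k : ℕ, g ^ k • x = y := by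
  classical
  have hmem (k : ℕ) : g ^ k • x ∈ S := by
    induction k with
    | zero => simpa
    | succ k ih => rw [pow_succ', mul_smul]; exact hg _ ih
  have hinj : Set.InjOn (fun k => g ^ k • x) (Finset.range n : Set ℕ) := by
    have := Function.iterate_injOn_Iio_minimalPeriod (f := (g • · : Y → Y)) (x := x)
    rw [hn x hx] at this
    intro a ha b hb h
    refine this (by simpa using ha) (by simpa using hb) ?_
    simpa only [smul_iterate] using h
  have hsub : (Finset.range n).image (fun k => g ^ k • x) ⊆ S := by
    intro z hz
    obtain ⟨k, -, rfl⟩ := Finset.mem_image.mp hz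
    exact hmem k
  have heq := Finset.eq_of_subset_of_card_le hsub (by
    rw [Finset.card_image_of_injOn hinj, Finset.card_range]; exact hS)
  rw [← heq] at hy
  obtain ⟨k, -, hk⟩ := Finset.mem_image.mp hy
  exact ⟨k, hk⟩

theorem pow_smul_eq_self {g : G} {x : Y} (h : g • x = x) (k : ℕ) : g ^ k • x = x := by
  induction k with
  | zero => simp
  | succ k ih => rw [pow_succ, mul_smul, h, ih]

theorem exists_smul_eq_of_minimalPeriod [Fintype Y] (hY : Fintype.card Y ≤ 12)
    {τ ρ μ : G} {r₀ r₁ r₂ : Y} (hτ : τ • r₀ = r₀)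
    (hτ' : ∀ r ≠ r₀, Function.minimalPeriod (τ • ·) r = 11) (hr : r₁ ≠ r₂)
    (h₁ : ρ • r₁ = r₁) (h₂ : ρ • r₂ = r₂)
    (hρ : ∀ r, r ≠ r₁ → r ≠ r₂ → Function.minimalPeriod (ρ • ·) r = 10)
    (hμ : ∀ r : Y, μ • r ≠ r) {x y z x' y' z' : Y} (hxy : x ≠ y) (hxz : x ≠ z) (hyz : y ≠ z)
    (hxy' : x' ≠ y') (hxz' : x' ≠ z') (hyz' : y' ≠ z') :
    ∃ g : G, g • x = x' ∧ g • y = y' ∧ g • z = z' := by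
  classical
  have orb₁ {u v : Y} (hu : u ≠ r₀) (hv : v ≠ r₀) : ∃ k : ℕ, τ ^ k • u = v := by
    refine exists_pow_smul_eq (S := Finset.univ.erase r₀) (n := 11) ?_ ?_ ?_ (by simpa) (by simpa)
    · rw [Finset.card_erase_of_mem (Finset.mem_univ _), Finset.card_univ]; omega
    · intro w hw
      simp only [Finset.mem_erase, Finset.mem_univ, and_true] at hw ⊢
      rwa [Ne, smul_eq_iff_eq_inv_smul, inv_smul_eq_iff.mpr hτ.symm]
    · intro w hw
      exact hτ' w (by simpa using hw)
  have orb₂ {u v : Y} (hu₁ : u ≠ r₁) (hu₂ : u ≠ r₂) (hv₁ : v ≠ r₁) (hv₂ : v ≠ r₂) :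
      ∃ k : ℕ, ρ ^ k • u = v := by
    refine exists_pow_smul_eq (S := (Finset.univ.erase r₁).erase r₂) (n := 10) ?_ ?_ ?_
      (by simp [hu₁, hu₂]) (by simp [hv₁, hv₂])
    · rw [Finset.card_erase_of_mem (by simp [hr.symm]),
        Finset.card_erase_of_mem (Finset.mem_univ _), Finset.card_univ]
      omega
    · intro w hw
      simp only [Finset.mem_erase, Finset.mem_univ, and_true, Ne] at hw ⊢
      rwa [smul_eq_iff_eq_inv_smul, smul_eq_iff_eq_inv_smul, inv_smul_eq_iff.mpr h₁.symm,
        inv_smul_eq_iff.mpr h₂.symm]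
    · intro w hw
      simp only [Finset.mem_erase, Finset.mem_univ, and_true, Ne] at hw
      exact hρ w hw.2 hw.1
  have tr₁ (u : Y) : ∃ g : G, g • u = r₀ := by
    by_cases hu : u = r₀
    · exact ⟨1, by simpa using hu⟩
    · obtain ⟨k, hk⟩ := orb₁ hu (v := μ⁻¹ • r₀) (by
        rw [Ne, inv_smul_eq_iff]; exact (hμ r₀).symm)
      exact ⟨μ * τ ^ k, by rw [mul_smul, hk, smul_inv_smul]⟩
  have tr₂ {u v : Y} (huv : u ≠ v) : ∃ g : G, g • u = r₀ ∧ g • v = μ • r₀ := by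
    obtain ⟨g, hg⟩ := tr₁ u
    obtain ⟨k, hk⟩ := orb₁ (u := g • v) (v := μ • r₀)
      (by rw [← hg]; simpa using huv.symm) (hμ r₀)
    exact ⟨τ ^ k * g, by rw [mul_smul, hg, pow_smul_eq_self hτ], by rw [mul_smul, hk]⟩
  have tr₂' {u v : Y} (huv : u ≠ v) : ∃ g : G, g • u = r₁ ∧ g • v = r₂ := by
    obtain ⟨g, hg, hg'⟩ := tr₂ huv
    obtain ⟨g₁, hg₁, hg₁'⟩ := tr₂ hr
    exact ⟨g₁⁻¹ * g, by rw [mul_smul, hg, ← hg₁, inv_smul_smul],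
      by rw [mul_smul, hg', ← hg₁', inv_smul_smul]⟩
  obtain ⟨g, hx, hy⟩ := tr₂' hxy
  obtain ⟨g', hx', hy'⟩ := tr₂' hxy'
  obtain ⟨k, hk⟩ := orb₂ (u := g • z) (v := g' • z') (by rw [← hx]; simpa using hxz.symm)
    (by rw [← hy]; simpa using hyz.symm) (by rw [← hx']; simpa using hxz'.symm)
    (by rw [← hy']; simpa using hyz'.symm)
  refine ⟨g'⁻¹ * (ρ ^ k * g), ?_, ?_, ?_⟩
  · rw [mul_smul, mul_smul, hx, pow_smul_eq_self h₁, ← hx', inv_smul_smul]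
  · rw [mul_smul, mul_smul, hy, pow_smul_eq_self h₂, ← hy', inv_smul_smul]
  · rw [mul_smul, mul_smul, hk, inv_smul_smul]

end Transitivity

/-! ### The blocks of six roots, reduced modulo a totally split prime -/

/-- The roots of `fCoeffs` modulo the totally split prime `38327`. -/
def rootResidue : Fin 12 → ℕ :=
  ![1788, 8692, 9507, 33673, 30532, 32484, 26241, 31602, 30908, 24057, 25763, 13042]

/-- The roots `c` of `blockResolvent (X ^ 2)` modulo `38327`, each with the bit mask of the block of
six roots it determines. -/
def blockTable : List (ℕ × ℕ) := [
    (119, 287), (198, 1954), (939, 2155), (1115, 756), (1865, 970), (2006, 1266), (2398, 2453),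
    (2468, 1859), (2827, 2950), (2907, 1621), (3074, 3024), (3463, 3350), (3562, 876), (3778, 1708),
    (5517, 2166), (6109, 3238), (6474, 2606), (6619, 3880), (6721, 2680), (6851, 3416),
    (7082, 2382), (7862, 1434), (8379, 3143), (8813, 627), (9122, 965), (9155, 476), (9222, 378),
    (9524, 1563), (9526, 1829), (9559, 1340), (9583, 3657), (10881, 1734), (10964, 2583),
    (11023, 3504), (11109, 3857), (12404, 1253), (12598, 915), (12778, 1227), (12899, 1357),
    (13346, 3666), (14537, 3908), (14956, 854), (15186, 1331), (15245, 3425), (16054, 1590),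
    (16479, 373), (16621, 811), (16677, 1904), (16734, 483), (17060, 573), (17619, 1806),
    (17884, 1181), (18560, 1752), (18614, 1382), (18900, 2977), (19427, 1118), (19713, 2713),
    (19767, 2343), (20443, 2914), (20708, 2289), (21267, 3522), (21593, 3612), (21650, 2191),
    (21706, 3284), (21848, 3722), (22273, 2505), (23082, 670), (23141, 2764), (23371, 3241),
    (23790, 187), (24981, 429), (25428, 2738), (25549, 2868), (25729, 3180), (25923, 2842),
    (27218, 238), (27304, 591), (27363, 1512), (27446, 2361), (28744, 438), (28768, 2755),
    (28801, 2266), (28803, 2532), (29105, 3717), (29172, 3619), (29205, 3130), (29514, 3468),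
    (29948, 952), (30465, 2661), (31245, 1713), (31476, 679), (31606, 1415), (31708, 215),
    (31853, 1489), (32218, 857), (32810, 1929), (34549, 2387), (34765, 3219), (34864, 745),
    (35253, 1071), (35420, 2474), (35500, 1145), (35859, 2236), (35929, 1642), (36321, 2829),
    (36462, 3125), (37212, 3339), (37388, 1940), (38129, 2141), (38208, 3808)]

/-- The bit masks of the blocks, with respect to the labelling of the roots by `rootResidue`. -/
def blockMasks : List ℕ := blockTable.map Prod.snd

/-- The coefficient list of the polynomial `l (X ^ 2)`. -/
def expandList : List ℤ → List ℤ
  | [] => []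
  | c :: l => c :: 0 :: expandList l

theorem ev_expandList {R : Type*} [CommRing R] (l : List ℤ) (x : R) :
    ev (expandList l) x = ev l (x ^ 2) := by
  induction l with
  | nil => rfl
  | cons c l ih => simp only [expandList, ev_cons, ih]; push_cast; ring

theorem monic_ev_sq (l : List ℤ) : (ev (l ++ [1]) (X ^ 2 : ℤ[X])).Monic := by
  have := map_ev (expand ℤ 2 : ℤ[X] →+* ℤ[X]) (l ++ [1]) X
  simp only [RingHom.coe_coe, expand_X] at this
  rw [← this]
  exact (monic_ev_X l).expand two_pos

/-- The value of the polynomial with coefficient list `l` at the residue `x` modulo `p`. -/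
def evMod (p : ℕ) (l : List ℤ) (x : ℕ) : ℕ :=
  l.foldr (fun (c : ℤ) s => ((c % (p : ℤ)).toNat + x * s) % p) 0

/-- The value of the bivariate polynomial `L` at the residues `t` and `x` modulo `p`. -/
def evMod₂ (p : ℕ) (L : List (List ℤ)) (t x : ℕ) : ℕ :=
  L.foldr (fun c s => (evMod p c t + x * s) % p) 0

section

variable {R : Type*} [CommRing R] (p : ℕ) [CharP R p]

theorem cast_evMod [NeZero p] (l : List ℤ) (x : ℕ) : (evMod p l x : R) = ev l (x : R) := by
  induction l with
  | nil => simp [evMod]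
  | cons c l ih =>
    rw [ev_cons, ← ih, ← cast_emod (intCast_char_eq_zero (R := R) p) c,
      ← Int.toNat_of_nonneg (Int.emod_nonneg c (Int.natCast_ne_zero.mpr (NeZero.ne p)))]
    simp only [evMod, List.foldr_cons]
    rw [← CharP.cast_eq_mod R p]
    push_cast
    rfl

theorem cast_evMod₂ [NeZero p] (L : List (List ℤ)) (t x : ℕ) :
    (evMod₂ p L t x : R) = ev₂ L (t : R) (x : R) := by
  induction L with
  | nil => simp [evMod₂]
  | cons c L ih =>
    rw [ev₂_cons, ← ih, ← cast_evMod p c]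
    simp only [evMod₂, List.foldr_cons]
    rw [← CharP.cast_eq_mod R p]
    push_cast
    rfl

theorem natCast_ne_zero {n : ℕ} (h : n % p ≠ 0) : (n : R) ≠ 0 := by
  rwa [Ne, CharP.cast_eq_zero_iff R p, Nat.dvd_iff_mod_eq_zero]

end

theorem blockTable_spec : ∀ cm ∈ blockTable, ∀ i : Fin 12,
    (cm.1 * evMod₂ 38327 evenPart (cm.1 ^ 2 % 38327) (rootResidue i)
      + (bif cm.2.testBit i then 1 else 38326)
        * evMod₂ 38327 oddPart (cm.1 ^ 2 % 38327) (rootResidue i)) % 38327 ≠ 0 := by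
  decide +kernel

theorem blockTable_complete : addMul (38327 : ℕ) (-1)
    (prodLin (38327 : ℕ) (blockTable.map fun cm => (cm.1 : ℤ)))
    (expandList blockResolvent) = [] := by
  decide +kernel

section NumberField

open scoped NumberField

variable {K : Type} [Field K] [NumberField K]

/-- The root `r` belongs to the block determined by `s`. -/
def InBlock (s r : 𝓞 K) : Prop := s * ev₂ evenPart (s ^ 2) r = ev₂ oddPart (s ^ 2) r

theorem inBlock_smul_iff (σ : Gal(K/ℚ)) (s r : 𝓞 K) : InBlock (σ • s) (σ • r) ↔ InBlock s r := by
  rw [InBlock, InBlock, ← (MulAction.injective σ).eq_iff (a := s * _), smul_mul']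
  simp only [← MulSemiringAction.toRingHom_apply, map_ev₂, map_pow]

omit [NumberField K] in
theorem testBit_iff_inBlock {k : Type} [Field k] [CharP k 38327] (π : 𝓞 K →+* k) {cm : ℕ × ℕ}
    (hcm : cm ∈ blockTable) {s : 𝓞 K} (hs : ev blockResolvent (s ^ 2) = 0) (hc : π s = cm.1)
    {r : 𝓞 K} (hr : ev fCoeffs r = 0) {i : Fin 12} (hi : π r = rootResidue i) :
    cm.2.testBit i = true ↔ InBlock s r := by
  have h := natCast_ne_zero (R := k) 38327 (blockTable_spec cm hcm i)
  have hz : ((38326 : ℕ) : k) = -1 := by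
    have : ((38326 + 1 : ℕ) : k) = 0 := CharP.cast_eq_zero k 38327
    push_cast at this ⊢
    linear_combination this
  have hP : π (ev₂ evenPart (s ^ 2) r)
      = (evMod₂ 38327 evenPart (cm.1 ^ 2 % 38327) (rootResidue i) : k) := by
    rw [cast_evMod₂, ← CharP.cast_eq_mod k 38327, map_ev₂, map_pow, hc, hi, Nat.cast_pow]
  have hR : π (ev₂ oddPart (s ^ 2) r)
      = (evMod₂ 38327 oddPart (cm.1 ^ 2 % 38327) (rootResidue i) : k) := by
    rw [cast_evMod₂, ← CharP.cast_eq_mod k 38327, map_ev₂, map_pow, hc, hi, Nat.cast_pow]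
  rw [Nat.cast_add, Nat.cast_mul, Nat.cast_mul, ← hP, ← hR, ← hc] at h
  constructor
  · intro hb
    rw [hb, cond_true, Nat.cast_one, one_mul, ← map_mul, ← map_add] at h
    have := (mul_eq_zero.mp (mul_sq_evenPart hs hr)).resolve_right
      (fun h0 => h (by rw [h0, map_zero]))
    exact sub_eq_zero.mp this
  · intro hb
    by_contra hb'
    rw [Bool.not_eq_true] at hb'
    rw [hb', cond_false, hz, ← map_mul, hb] at h
    exact h (by ring)

theorem exists_labelling [IsGalois ℚ K]
    (hs : ((ev fCoeffs (X : ℤ[X])).map (Int.castRingHom K)).Splits)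
    (hs' : ((ev blockResolvent (X ^ 2 : ℤ[X])).map (Int.castRingHom K)).Splits) :
    ∃ e : Fin 12 ≃ IntegralRoot K, ∀ σ : Gal(K/ℚ), ∀ m ∈ blockMasks, ∃ m' ∈ blockMasks,
      ∀ i j, σ • e i = e j → m'.testBit j = m.testBit i := by
  have : Fact (Nat.Prime 38327) := ⟨by norm_num⟩
  obtain ⟨k, _, _, π, -, -, hinj, hroot, hlift⟩ := exists_reduction hs 38327
    (a := (List.finRange 12).map fun i => (rootResidue i : ℤ)) (h := [1]) (by decide +kernel)
    (by decide +kernel) (fun k _ _ x hx => absurd hx (by simp))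
  choose r hr using fun i : Fin 12 =>
    hlift (rootResidue i) (List.mem_map_of_mem (List.mem_finRange i))
  have hr (i : Fin 12) : π (r i) = rootResidue i := by simpa using hr i
  have hbij : Function.Bijective r := by
    constructor
    · intro i j hij
      have h : ((rootResidue i : ℤ) - (rootResidue j : ℤ) : ℤ) % (38327 : ℕ) = 0 := by
        by_contra h
        refine intCast_ne_zero (R := k) h ?_
        push_cast
        rw [← hr, ← hr, hij, sub_self]
      clear hij
      revert i j
      decide +kernel
    · intro x
      obtain ⟨c, hc, h⟩ := (hroot x).resolve_right (by simp)
      obtain ⟨i, -, rfl⟩ := List.mem_map.mp hc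
      exact ⟨i, hinj _ _ (by rw [h, hr]; simp)⟩
  have hq := intCast_char_eq_zero (R := k) 38327
  have key (x : k) : ev blockResolvent (x ^ 2) = 0 ↔ ∃ cm ∈ blockTable, x = (cm.1 : k) := by
    rw [← ev_expandList, ← ev_congr hq blockTable_complete, ev_prodLin hq, List.prod_eq_zero_iff]
    simp only [List.map_map, List.mem_map, Function.comp_apply, Int.cast_natCast, sub_eq_zero]
  refine ⟨Equiv.ofBijective r hbij, fun σ m hm => ?_⟩
  obtain ⟨cm, hcm, rfl⟩ := List.mem_map.mp hm
  obtain ⟨s, hQ, hsc⟩ := exists_root_lift π (P := ev blockResolvent (X ^ 2)) (c := (cm.1 : k))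
    (by
      rw [show blockResolvent = blockResolvent.dropLast ++ [1] by decide +kernel]
      exact monic_ev_sq _) hs' (by
      have := map_ev (aeval (R := ℤ) (cm.1 : k) : ℤ[X] →+* k) blockResolvent (X ^ 2)
      simp only [RingHom.coe_coe, map_pow, aeval_X] at this
      rw [this]
      exact (key _).mpr ⟨cm, hcm, rfl⟩)
  have hQ : ev blockResolvent (s ^ 2) = 0 := by
    have := map_ev (aeval (R := ℤ) s : ℤ[X] →+* 𝓞 K) blockResolvent (X ^ 2)
    simp only [RingHom.coe_coe, map_pow, aeval_X] at this
    rw [← this, hQ]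
  have hQ' : ev blockResolvent ((σ • s) ^ 2) = 0 := by
    rw [← MulSemiringAction.toRingHom_apply, ← map_pow, ← map_ev, hQ, map_zero]
  obtain ⟨cm', hcm', hsc'⟩ := (key (π (σ • s))).mp (by rw [← map_pow, ← map_ev, hQ', map_zero])
  refine ⟨cm'.2, List.mem_map_of_mem hcm', fun i j hij => ?_⟩
  rw [Bool.eq_iff_iff, testBit_iff_inBlock π hcm hQ hsc (r i).2 (hr i),
    testBit_iff_inBlock π hcm' hQ' hsc' (r j).2 (hr j), ← inBlock_smul_iff σ s]
  rw [show σ • (r i : 𝓞 K) = r j from congrArg Subtype.val hij]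

end NumberField

/-! ### Permutations preserving the blocks -/

section Blocks

/-- The permutation maps blocks to blocks. -/
def PreservesBlocks (σ : Equiv.Perm (Fin 12)) : Prop :=
  ∀ m ∈ blockMasks, ∃ m' ∈ blockMasks, ∀ i : Fin 12, m'.testBit (σ i) = m.testBit i

theorem PreservesBlocks.mul {σ τ : Equiv.Perm (Fin 12)} (hσ : PreservesBlocks σ)
    (hτ : PreservesBlocks τ) : PreservesBlocks (σ * τ) := by
  intro m hm
  obtain ⟨m₁, h₁, h₁'⟩ := hτ m hm
  obtain ⟨m₂, h₂, h₂'⟩ := hσ m₁ h₁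
  exact ⟨m₂, h₂, fun i => by rw [Equiv.Perm.mul_apply, h₂', h₁']⟩

/-- There are at least four blocks containing the labels `0`, `i`, `j` and `k`. -/
def InFourBlocks (i j k : Fin 12) : Bool :=
  4 ≤ blockMasks.countP fun m => m.testBit i && m.testBit j && m.testBit k && m.testBit 0

theorem blockMasks_nodup : blockMasks.Nodup := by decide +kernel

theorem blockMasks_lt : ∀ m ∈ blockMasks, m < 2 ^ 12 := by decide +kernel

theorem PreservesBlocks.inFourBlocks {σ : Equiv.Perm (Fin 12)} (hσ : PreservesBlocks σ)
    (h₀ : σ 0 = 0) {i j k : Fin 12} (h : InFourBlocks i j k = true) :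
    InFourBlocks (σ i) (σ j) (σ k) = true := by
  choose! g hg hg' using hσ
  rw [InFourBlocks, decide_eq_true_eq] at h ⊢
  refine h.trans ?_
  have hnodup : (blockMasks.map g).Nodup := by
    refine blockMasks_nodup.map_on fun m hm m' hm' hmm => Nat.eq_of_testBit_eq fun n => ?_
    by_cases hn : n < 12
    · rw [← hg' m hm ⟨n, hn⟩, ← hg' m' hm' ⟨n, hn⟩, hmm]
    · have hle : 2 ^ 12 ≤ 2 ^ n := Nat.pow_le_pow_right two_pos (not_lt.mp hn)
      rw [Nat.testBit_lt_two_pow ((blockMasks_lt m hm).trans_le hle),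
        Nat.testBit_lt_two_pow ((blockMasks_lt m' hm').trans_le hle)]
  have hsub : blockMasks.map g ⊆ blockMasks := by
    intro x hx
    obtain ⟨m, hm, rfl⟩ := List.mem_map.mp hx
    exact hg m hm
  refine le_trans (le_of_eq ?_) ((List.subperm_of_subset hnodup hsub).countP_le _)
  rw [List.countP_map]
  refine List.countP_congr fun m hm => ?_
  have h0 := hg' m hm 0
  rw [h₀] at h0
  simp only [Function.comp_apply, hg' m hm]
  rw [show (g m).testBit 0 = m.testBit 0 from h0]

/-- Every extension to the labels in the given list of the partial permutation with the given graph
that is compatible with `InFourBlocks` is the identity. -/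
def onlyIdentity : List (Fin 12) → List (Fin 12 × Fin 12) → Bool
  | [], l => l.all fun p => p.1 == p.2
  | n :: todo, l => (List.finRange 12).all fun y =>
      (l.any fun p => p.2 == y && p.1 != n) ||
      (l.any fun p => l.any fun q => InFourBlocks p.1 q.1 n && !InFourBlocks p.2 q.2 y) ||
      onlyIdentity todo ((n, y) :: l)

theorem eq_of_onlyIdentity {σ : Equiv.Perm (Fin 12)}
    (hσ : ∀ i j k, InFourBlocks i j k = true → InFourBlocks (σ i) (σ j) (σ k) = true)
    {todo : List (Fin 12)} {l : List (Fin 12 × Fin 12)} (h : onlyIdentity todo l = true)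
    (hl : ∀ p ∈ l, σ p.1 = p.2) :
    (∀ p ∈ l, σ p.1 = p.1) ∧ ∀ n ∈ todo, σ n = n := by
  induction todo generalizing l with
  | nil =>
    refine ⟨fun p hp => ?_, by simp⟩
    rw [onlyIdentity, List.all_eq_true] at h
    rw [hl p hp, beq_iff_eq.mp (h p hp)]
  | cons n todo ih =>
    rw [onlyIdentity, List.all_eq_true] at h
    have h := h (σ n) (List.mem_finRange _)
    rw [Bool.or_eq_true, Bool.or_eq_true] at h
    rcases h with (h | h) | h
    · obtain ⟨p, hp, h⟩ := List.any_eq_true.mp h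
      rw [Bool.and_eq_true, beq_iff_eq, bne_iff_ne, ← hl p hp] at h
      exact absurd (σ.injective h.1) h.2
    · obtain ⟨p, hp, h⟩ := List.any_eq_true.mp h
      obtain ⟨q, hq, h⟩ := List.any_eq_true.mp h
      rw [Bool.and_eq_true, ← hl p hp, ← hl q hq] at h
      simp [hσ _ _ _ h.1] at h
    · have := ih h (by simpa using hl)
      simp only [List.mem_cons, forall_eq_or_imp] at this ⊢
      exact ⟨this.1.2, this.1.1, this.2⟩

theorem onlyIdentity_three :
    onlyIdentity [3, 4, 5, 6, 7, 8, 9, 10, 11] [(2, 2), (1, 1), (0, 0)] = true := by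
  decide +kernel

theorem PreservesBlocks.eq_one {σ : Equiv.Perm (Fin 12)} (hσ : PreservesBlocks σ)
    (h₀ : σ 0 = 0) (h₁ : σ 1 = 1) (h₂ : σ 2 = 2) : σ = 1 := by
  have := eq_of_onlyIdentity (fun _ _ _ => hσ.inFourBlocks h₀) onlyIdentity_three
    (by simp [h₀, h₁, h₂])
  ext i
  congr 1
  revert i
  simpa [Fin.forall_fin_succ, h₀, h₁, h₂] using this.2

end Blocks

/-! ### The action of `GL₂` on the projective line over `ZMod 11` -/

section Mobius

open OnePoint Matrix

theorem fact_prime_eleven : Fact (Nat.Prime 11) := ⟨by norm_num⟩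

attribute [local instance] fact_prime_eleven

/-- The label `0` stands for the point at infinity and the label `k + 1` for `k`. -/
def projLabel : Fin 12 ≃ OnePoint (ZMod 11) := finSuccEquiv 11

theorem projLabel_zero : projLabel 0 = ∞ := rfl

theorem projLabel_succ (k : ZMod 11) :
    projLabel (Fin.succ (n := 11) k) = (k : OnePoint (ZMod 11)) :=
  finSuccEquiv_succ k

/-- The action of `GL₂` on the labels of the points of the projective line. -/
noncomputable def mobius : GL (Fin 2) (ZMod 11) →* Equiv.Perm (Fin 12) :=
  projLabel.symm.permCongrHom.toMonoidHom.comp (MulAction.toPermHom _ _)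

theorem projLabel_mobius (g : GL (Fin 2) (ZMod 11)) (i : Fin 12) :
    projLabel (mobius g i) = g • projLabel i := by
  simp [mobius]

theorem forall_label {P : Fin 12 → Prop} (h₀ : P 0) (h : ∀ k : ZMod 11, P (Fin.succ (n := 11) k)) :
    ∀ i, P i :=
  Fin.cases h₀ h

/-- Translation by one. -/
noncomputable def translation : GL (Fin 2) (ZMod 11) :=
  GeneralLinearGroup.mkOfDetNeZero !![1, 1; 0, 1] (by simp)

/-- Multiplication by two. -/
noncomputable def doubling : GL (Fin 2) (ZMod 11) :=
  GeneralLinearGroup.mkOfDetNeZero !![2, 0; 0, 1] (by simp; decide)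

/-- Inversion. -/
noncomputable def inversion : GL (Fin 2) (ZMod 11) :=
  GeneralLinearGroup.mkOfDetNeZero !![0, 1; 1, 0] (by simp)

/-- The action of `translation` on labels. -/
def translationFun : Fin 12 → Fin 12 := ![0, 2, 3, 4, 5, 6, 7, 8, 9, 10, 11, 1]

/-- The action of `doubling` on labels. -/
def doublingFun : Fin 12 → Fin 12 := ![0, 1, 3, 5, 7, 9, 11, 2, 4, 6, 8, 10]

/-- The action of `inversion` on labels. -/
def inversionFun : Fin 12 → Fin 12 := ![1, 0, 2, 7, 5, 4, 10, 3, 9, 8, 6, 11]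

theorem mobius_translation : ⇑(mobius translation) = translationFun := by
  refine funext (forall_label ?_ fun k => ?_) <;> apply projLabel.injective <;>
    rw [projLabel_mobius]
  · simp [projLabel_zero, smul_infty_eq_ite, translation, translationFun]
  · rw [projLabel_succ, show translationFun (Fin.succ (n := 11) k) = Fin.succ (n := 11)
      (k + 1 : ZMod 11) by revert k; decide, projLabel_succ, smul_some_eq_ite]
    simp [translation]

theorem mobius_doubling : ⇑(mobius doubling) = doublingFun := by
  refine funext (forall_label ?_ fun k => ?_) <;> apply projLabel.injective <;>
    rw [projLabel_mobius]
  · simp [projLabel_zero, smul_infty_eq_ite, doubling, doublingFun]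
  · rw [projLabel_succ, show doublingFun (Fin.succ (n := 11) k) = Fin.succ (n := 11)
      (2 * k : ZMod 11) by revert k; decide, projLabel_succ, smul_some_eq_ite]
    simp [doubling]

theorem mobius_inversion : ⇑(mobius inversion) = inversionFun := by
  refine funext (forall_label ?_ fun k => ?_) <;> apply projLabel.injective <;>
    rw [projLabel_mobius]
  · rw [show inversionFun 0 = Fin.succ (n := 11) (0 : ZMod 11) from rfl, projLabel_succ]
    simp [projLabel_zero, smul_infty_eq_ite, inversion]
  · rw [projLabel_succ, smul_some_eq_ite]
    by_cases hk : k = 0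
    · subst hk
      rw [show inversionFun (Fin.succ (n := 11) (0 : ZMod 11)) = 0 from rfl, projLabel_zero]
      simp [inversion]
    · rw [show inversionFun (Fin.succ (n := 11) k) = Fin.succ (n := 11)
        (k⁻¹ : ZMod 11) by revert k; decide +kernel, projLabel_succ]
      simp [inversion, hk]

theorem PreservesBlocks.of_apply_eq {σ : Equiv.Perm (Fin 12)} {f : Fin 12 → Fin 12} (h : ⇑σ = f)
    (hf : (blockMasks.all fun m => blockMasks.any fun m' => (List.finRange 12).all fun i =>
      m'.testBit (f i) == m.testBit i) = true) : PreservesBlocks σ := by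
  intro m hm
  obtain ⟨m', hm', h'⟩ := List.any_eq_true.mp (List.all_eq_true.mp hf m hm)
  exact ⟨m', hm', fun i => by
    rw [h]; exact beq_iff_eq.mp (List.all_eq_true.mp h' i (List.mem_finRange i))⟩

theorem preservesBlocks_translation : PreservesBlocks (mobius translation) :=
  .of_apply_eq mobius_translation (by decide +kernel)

theorem preservesBlocks_doubling : PreservesBlocks (mobius doubling) :=
  .of_apply_eq mobius_doubling (by decide +kernel)

theorem preservesBlocks_inversion : PreservesBlocks (mobius inversion) :=
  .of_apply_eq mobius_inversion (by decide +kernel)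

theorem PreservesBlocks.pow_mul {σ τ : Equiv.Perm (Fin 12)} (hσ : PreservesBlocks σ)
    (hτ : PreservesBlocks τ) (n : ℕ) : PreservesBlocks (σ ^ n * τ) := by
  induction n with
  | zero => simpa
  | succ n ih => rw [pow_succ', mul_assoc]; exact hσ.mul ih

theorem PreservesBlocks.exists_mobius_mul_zero {σ : Equiv.Perm (Fin 12)}
    (hσ : PreservesBlocks σ) : ∃ g, PreservesBlocks (mobius g * σ) ∧ mobius g (σ 0) = 0 := by
  by_cases h : σ 0 = 0
  · exact ⟨1, by simpa, by simpa⟩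
  · obtain ⟨k, hk⟩ : ∃ k : Fin 11, inversionFun (translationFun^[k] (σ 0)) = 0 := by
      generalize σ 0 = x at h
      revert x
      decide
    refine ⟨inversion * translation ^ (k : ℕ), ?_, ?_⟩
    · rw [map_mul, map_pow, mul_assoc]
      exact preservesBlocks_inversion.mul (preservesBlocks_translation.pow_mul hσ _)
    · rw [map_mul, map_pow, Equiv.Perm.mul_apply, ← Equiv.Perm.iterate_eq_pow, mobius_inversion,
        mobius_translation, hk]

theorem PreservesBlocks.exists_mobius_mul_one {σ : Equiv.Perm (Fin 12)} (hσ : PreservesBlocks σ) :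
    ∃ g, PreservesBlocks (mobius g * σ) ∧ mobius g (σ 0) = 0 ∧ mobius g (σ 1) = 1 := by
  obtain ⟨g, hg, hg₀⟩ := hσ.exists_mobius_mul_zero
  obtain ⟨k, hk₀, hk⟩ : ∃ k : Fin 11, translationFun^[k] 0 = 0 ∧
      translationFun^[k] (mobius g (σ 1)) = 1 := by
    have h : mobius g (σ 1) ≠ 0 := by rw [← hg₀]; simp
    generalize mobius g (σ 1) = x at h
    revert x
    decide
  refine ⟨translation ^ (k : ℕ) * g, ?_, ?_, ?_⟩
  · rw [map_mul, map_pow, mul_assoc]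
    exact preservesBlocks_translation.pow_mul hg _
  · rw [map_mul, map_pow, Equiv.Perm.mul_apply, ← Equiv.Perm.iterate_eq_pow, mobius_translation,
      hg₀, hk₀]
  · rw [map_mul, map_pow, Equiv.Perm.mul_apply, ← Equiv.Perm.iterate_eq_pow, mobius_translation,
      hk]

theorem PreservesBlocks.mem_range_mobius {σ : Equiv.Perm (Fin 12)} (hσ : PreservesBlocks σ) :
    σ ∈ mobius.range := by
  obtain ⟨g, hg, hg₀, hg₁⟩ := hσ.exists_mobius_mul_one
  obtain ⟨k, hk₀, hk₁, hk⟩ : ∃ k : Fin 11, doublingFun^[k] 0 = 0 ∧ doublingFun^[k] 1 = 1 ∧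
      doublingFun^[k] (mobius g (σ 2)) = 2 := by
    have h₀ : mobius g (σ 2) ≠ 0 := by rw [← hg₀]; simp
    have h₁ : mobius g (σ 2) ≠ 1 := by rw [← hg₁]; simp
    generalize mobius g (σ 2) = x at h₀ h₁
    revert x
    decide
  have h := (preservesBlocks_doubling.pow_mul hg k).eq_one
    (by rw [Equiv.Perm.mul_apply, Equiv.Perm.mul_apply, ← Equiv.Perm.iterate_eq_pow,
      mobius_doubling, hg₀, hk₀])
    (by rw [Equiv.Perm.mul_apply, Equiv.Perm.mul_apply, ← Equiv.Perm.iterate_eq_pow,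
      mobius_doubling, hg₁, hk₁])
    (by rw [Equiv.Perm.mul_apply, Equiv.Perm.mul_apply, ← Equiv.Perm.iterate_eq_pow,
      mobius_doubling, hk])
  rw [← mul_assoc, ← map_pow, ← map_mul] at h
  exact ⟨(doubling ^ (k : ℕ) * g)⁻¹, by rw [map_inv]; exact inv_eq_of_mul_eq_one_right h⟩

theorem mem_center_of_mobius {g : GL (Fin 2) (ZMod 11)} (h₀ : mobius g 0 = 0)
    (h₁ : mobius g 1 = 1) (h₂ : mobius g 2 = 2) : g ∈ Subgroup.center (GL (Fin 2) (ZMod 11)) := by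
  have p₀ := projLabel_mobius g 0
  have p₁ := projLabel_mobius g 1
  have p₂ := projLabel_mobius g 2
  have e₁ : projLabel 1 = ((0 : ZMod 11) : OnePoint (ZMod 11)) := projLabel_succ 0
  have e₂ : projLabel 2 = ((1 : ZMod 11) : OnePoint (ZMod 11)) := projLabel_succ 1
  rw [h₀, projLabel_zero, smul_infty_eq_ite] at p₀
  rw [h₁, e₁, smul_some_eq_ite] at p₁
  rw [h₂, e₂, smul_some_eq_ite] at p₂
  have c₀ : g 1 0 = 0 := by
    by_contra h
    simp [h] at p₀
  have d₀ : g 1 1 ≠ 0 := by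
    intro h
    simp [h] at p₁
  have b₀ : g 0 1 = 0 := by
    simpa [d₀] using p₁.symm
  have a₀ : g 0 0 = g 1 1 := by
    simp only [b₀, c₀, mul_one, zero_add, add_zero, d₀, if_false, OnePoint.coe_eq_coe] at p₂
    exact ((eq_div_iff d₀).mp p₂).symm.trans (one_mul _)
  refine GeneralLinearGroup.mem_center_iff_val_mem_range_scalar.mpr ⟨g 1 1, ?_⟩
  ext i j
  fin_cases i <;> fin_cases j <;> simp [a₀, b₀, c₀]

theorem ker_mobius : mobius.ker = Subgroup.center (GL (Fin 2) (ZMod 11)) := by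
  refine le_antisymm (fun g hg => ?_) fun g hg => ?_
  · rw [MonoidHom.mem_ker] at hg
    exact mem_center_of_mobius (by simp [hg]) (by simp [hg]) (by simp [hg])
  · obtain ⟨a, ha⟩ := GeneralLinearGroup.mem_center_iff_val_mem_range_scalar.mp hg
    have ha₀ : a ≠ 0 := by
      rintro rfl
      apply g.det_ne_zero
      rw [← ha]
      simp
    rw [MonoidHom.mem_ker]
    refine Equiv.ext fun i => projLabel.injective ?_
    rw [projLabel_mobius]
    have e (i j : Fin 2) : g i j = Matrix.scalar (Fin 2) a i j := by rw [ha]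
    rw [Equiv.Perm.one_apply]
    cases projLabel i with
    | infty => simp [smul_infty_eq_ite, e]
    | coe k => simp [smul_some_eq_ite, e, ha₀]

theorem eq_range_mobius {Ψ : Subgroup (Equiv.Perm (Fin 12))}
    (hΨ : ∀ σ ∈ Ψ, PreservesBlocks σ)
    (h : ∀ x y z : Fin 12, x ≠ y → x ≠ z → y ≠ z → ∃ σ ∈ Ψ, σ 0 = x ∧ σ 1 = y ∧ σ 2 = z) :
    Ψ = mobius.range := by
  refine le_antisymm (fun σ hσ => (hΨ σ hσ).mem_range_mobius) ?_
  rintro _ ⟨g, rfl⟩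
  obtain ⟨σ, hσ, h₀, h₁, h₂⟩ := h (mobius g 0) (mobius g 1) (mobius g 2) (by simp) (by simp)
    (by simp)
  obtain ⟨g', rfl⟩ := (hΨ σ hσ).mem_range_mobius
  have : g'⁻¹ * g ∈ mobius.ker := by
    rw [ker_mobius]
    apply mem_center_of_mobius <;> rw [map_mul, map_inv, Equiv.Perm.mul_apply,
      Equiv.Perm.inv_eq_iff_eq]
    exacts [h₀.symm, h₁.symm, h₂.symm]
  rw [MonoidHom.mem_ker, map_mul, map_inv, inv_mul_eq_one] at this
  rwa [← this]

theorem card_GL_quotient_center :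
    Nat.card (GL (Fin 2) (ZMod 11) ⧸ Subgroup.center (GL (Fin 2) (ZMod 11))) = 1320 := by
  have h := Subgroup.card_eq_card_quotient_mul_card_subgroup
    (Subgroup.center (GL (Fin 2) (ZMod 11)))
  have hc : Nat.card (Subgroup.center (GL (Fin 2) (ZMod 11))) = 10 := by
    rw [GeneralLinearGroup.center_eq_range_scalar,
      Nat.card_congr
        (MonoidHom.ofInjective (f := GeneralLinearGroup.scalar (Fin 2)) ?_).symm.toEquiv,
      Nat.card_eq_fintype_card, ZMod.card_units 11]
    intro a b hab
    have := congrArg (fun g : GL (Fin 2) (ZMod 11) => g 0 0) hab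
    exact Units.ext (by simpa [GeneralLinearGroup.scalar] using this)
  rw [hc, card_GL_field, Fin.prod_univ_two, ZMod.card] at h
  norm_num at h
  rw [← Nat.card_eq_fintype_card] at h
  omega

end Mobius

/-! ### The Galois group -/

section GaloisGroup

open scoped NumberField MatrixGroups

theorem exists_isGalois_splits (P : ℤ[X]) : ∃ (K : Type) (_ : Field K) (_ : NumberField K),
    IsGalois ℚ K ∧ (P.map (Int.castRingHom K)).Splits := by
  obtain ⟨K, _, _, _⟩ : ∃ (K : Type) (_ : Field K) (a : Algebra ℚ K),
      IsSplittingField ℚ K (P.map (Int.castRingHom ℚ)) :=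
    ⟨SplittingField (P.map (Int.castRingHom ℚ)), _, _,
      IsSplittingField.splittingField _⟩
  have hK := IsSplittingField.splits K (P.map (Int.castRingHom ℚ))
  rw [map_map, Subsingleton.elim ((algebraMap ℚ K).comp _) (Int.castRingHom K)] at hK
  have := IsSplittingField.finiteDimensional K (P.map (Int.castRingHom ℚ))
  have := Normal.of_isSplittingField (F := ℚ) (E := K) (P.map (Int.castRingHom ℚ))
  have : CharZero K := algebraRat.charZero K
  obtain rfl : ‹Algebra ℚ K› = DivisionRing.toRatAlgebra := Subsingleton.elim _ _
  exact ⟨K, inferInstance, ⟨⟩, IsGalois.mk, hK⟩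

variable {K : Type} [Field K] [NumberField K]

theorem exists_hom_range_eq_mobius [IsGalois ℚ K]
    (hs : ((ev fCoeffs (X : ℤ[X])).map (Int.castRingHom K)).Splits)
    (hs' : ((ev blockResolvent (X ^ 2 : ℤ[X])).map (Int.castRingHom K)).Splits) :
    ∃ Θ : Gal(K/ℚ) →* Equiv.Perm (Fin 12), Θ.range = mobius.range ∧
      ∀ σ, Θ σ = 1 ↔ ∀ r : IntegralRoot K, σ • r = r := by
  obtain ⟨e, he⟩ := exists_labelling hs hs'
  let := Fintype.ofEquiv _ e
  have hcard : Fintype.card (IntegralRoot K) ≤ 12 := by simp [← Fintype.card_congr e]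
  obtain ⟨τ, r₀, hτ, hτ'⟩ := exists_frobenius_five hs
  obtain ⟨ρ, r₁, r₂, hr, h₁, h₂, hρ⟩ := exists_frobenius_nineteen hs
  obtain ⟨μ, hμ⟩ := exists_frobenius_seven hs
  let Θ : Gal(K/ℚ) →* Equiv.Perm (Fin 12) :=
    e.symm.permCongrHom.toMonoidHom.comp (MulAction.toPermHom _ _)
  have hΘ (σ : Gal(K/ℚ)) (i : Fin 12) : e (Θ σ i) = σ • e i := by simp [Θ]
  refine ⟨Θ, eq_range_mobius ?_ fun x y z hxy hxz hyz => ?_, fun σ => ⟨fun h r => ?_, fun h => ?_⟩⟩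
  · rintro _ ⟨σ, rfl⟩ m hm
    obtain ⟨m', hm', h⟩ := he σ m hm
    exact ⟨m', hm', fun i => h i _ (hΘ σ i).symm⟩
  · obtain ⟨σ, hx, hy, hz⟩ := exists_smul_eq_of_minimalPeriod hcard hτ hτ' hr h₁ h₂ hρ hμ
      (e.injective.ne (show (0 : Fin 12) ≠ 1 by decide))
      (e.injective.ne (show (0 : Fin 12) ≠ 2 by decide))
      (e.injective.ne (show (1 : Fin 12) ≠ 2 by decide))
      (e.injective.ne hxy) (e.injective.ne hxz) (e.injective.ne hyz)
    refine ⟨Θ σ, ⟨σ, rfl⟩, ?_, ?_, ?_⟩ <;> apply e.injective <;> rwa [hΘ]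
  · rw [← e.apply_symm_apply r, ← hΘ, h, Equiv.Perm.one_apply]
  · exact Equiv.ext fun i => e.injective (by rw [hΘ, h, Equiv.Perm.one_apply])

theorem restrict_eq_one_iff {f : ℚ[X]} (hf : f = ev fCoeffs (X : ℚ[X])) (hf₀ : f ≠ 0)
    [Fact ((f.map (algebraMap ℚ K)).Splits)] (σ : Gal(K/ℚ)) :
    Gal.restrict f K σ = 1 ↔ ∀ r : IntegralRoot K, σ • r = r := by
  have hev (x : K) : aeval x f = ev fCoeffs x := by
    simpa [hf] using map_ev (aeval (R := ℚ) x : ℚ[X] →+* K) fCoeffs X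
  rw [← map_eq_one_iff _ (Gal.galActionHom_injective f K)]
  constructor
  · intro h r
    have hr : ((r : 𝓞 K) : K) ∈ f.rootSet K := by
      rw [mem_rootSet, hev]
      refine ⟨hf₀, ?_⟩
      have := congrArg (algebraMap (𝓞 K) K) r.2
      rwa [map_ev, map_zero] at this
    have := Gal.galActionHom_restrict f K σ ⟨(r : 𝓞 K), hr⟩
    rw [h] at this
    exact Subtype.ext (NumberField.RingOfIntegers.ext this.symm)
  · intro h
    refine Equiv.ext fun x => Subtype.ext ?_
    rw [Gal.galActionHom_restrict]
    have hx := (mem_rootSet.mp x.2).2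
    rw [hev] at hx
    have hint : IsIntegral ℤ (x : K) := by
      refine ⟨ev fCoeffs X,
        monic_ev_X [-380, 774, -1062, 456, 258, -468, 104, 126, -6, -6, -6, 0], ?_⟩
      rw [← aeval_def, aeval_ev_X, hx]
    let r : IntegralRoot K := ⟨⟨x, hint⟩, NumberField.RingOfIntegers.ext (by
      exact (map_ev (algebraMap (𝓞 K) K) fCoeffs _).trans (hx.trans (map_zero _).symm))⟩
    exact congrArg (fun r : IntegralRoot K => ((r : 𝓞 K) : K)) (h r)

theorem nonempty_gal_mulEquiv {f : ℚ[X]} (hf : f = ev fCoeffs (X : ℚ[X])) :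
    Nonempty (f.Gal ≃*
      GL (Fin 2) (ZMod 11) ⧸ Subgroup.center (GL (Fin 2) (ZMod 11))) := by
  have hP : (ev fCoeffs (X : ℤ[X])).Monic :=
    monic_ev_X [-380, 774, -1062, 456, 258, -468, 104, 126, -6, -6, -6, 0]
  have hQ : (ev blockResolvent (X ^ 2 : ℤ[X])).Monic := monic_ev_sq blockResolvent.dropLast
  have hPf : (ev fCoeffs (X : ℤ[X])).map (Int.castRingHom ℚ) = f := by
    rw [hf]
    simpa using map_ev (mapRingHom (Int.castRingHom ℚ)) fCoeffs X
  have hf₀ : f ≠ 0 := hPf ▸ (hP.map _).ne_zero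
  generalize hP' : ev fCoeffs (X : ℤ[X]) = P at hP hPf
  generalize hQ' : ev blockResolvent (X ^ 2 : ℤ[X]) = Q at hQ
  obtain ⟨K, _, _, _, hK⟩ := exists_isGalois_splits (P * Q)
  have h₀ : (P * Q).map (Int.castRingHom K) ≠ 0 := ((hP.mul hQ).map _).ne_zero
  have hs := hK.of_dvd h₀ (map_dvd (Int.castRingHom K) (dvd_mul_right P Q))
  have hs' := hK.of_dvd h₀ (map_dvd (Int.castRingHom K) (dvd_mul_left Q P))
  have : Fact ((f.map (algebraMap ℚ K)).Splits) := ⟨by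
    rwa [← hPf, map_map, Subsingleton.elim ((algebraMap ℚ K).comp _) (Int.castRingHom K)]⟩
  obtain ⟨Θ, hΘ, hker⟩ := exists_hom_range_eq_mobius (hP' ▸ hs) (hQ' ▸ hs')
  have hker' : (Gal.restrict f K).ker = Θ.ker := by
    ext σ
    rw [MonoidHom.mem_ker, MonoidHom.mem_ker, restrict_eq_one_iff hf hf₀, hker]
  exact ⟨(QuotientGroup.quotientKerEquivOfSurjective _ (Gal.restrict_surjective f K)).symm.trans <|
    (QuotientGroup.quotientMulEquivOfEq hker').trans <|
    (QuotientGroup.quotientKerEquivRange Θ).trans <|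
    (MulEquiv.subgroupCongr hΘ).trans <|
    (QuotientGroup.quotientKerEquivRange mobius).symm.trans <|
    QuotientGroup.quotientMulEquivOfEq ker_mobius⟩

end GaloisGroup

end GaloisPGL

open GaloisPGL in
/-- The Galois group over `ℚ` of
`x¹² - 6x¹⁰ - 6x⁹ - 6x⁸ + 126x⁷ + 104x⁶ - 468x⁵ + 258x⁴ + 456x³ - 1062x² + 774x - 380`
is isomorphic to `PGL₂(𝔽₁₁) = GL₂(𝔽₁₁)/Z(GL₂(𝔽₁₁))`; in particular it has order `1320`. -/
theorem galois_group_isomorphic_to_PGL2_F11 :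
    let f : Polynomial ℚ :=
      X ^ 12 - 6 * X ^ 10 - 6 * X ^ 9 - 6 * X ^ 8 + 126 * X ^ 7 + 104 * X ^ 6
        - 468 * X ^ 5 + 258 * X ^ 4 + 456 * X ^ 3 - 1062 * X ^ 2 + 774 * X - 380
    let PGL2F11 : Type :=
      Matrix.GeneralLinearGroup (Fin 2) (ZMod 11) ⧸
        Subgroup.center (Matrix.GeneralLinearGroup (Fin 2) (ZMod 11))
    Nonempty (f.Gal ≃* PGL2F11) ∧ Nat.card f.Gal = 1320 := by
  intro f PGL2F11
  have hf : f = ev fCoeffs (X : ℚ[X]) := by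
    simp only [fCoeffs, ev_cons, ev_nil]
    push_cast
    ring
  obtain ⟨e⟩ := nonempty_gal_mulEquiv hf
  exact ⟨⟨e⟩, (Nat.card_congr e.toEquiv).trans card_GL_quotient_center⟩
end
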